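/- Let G be a finite connected cubic simple graph of genus g ≥ 9. If g = 5·a·2^m + 1 for some a ∈ {1,3} and some m ≥ 2, then 4·|Aut(G)| ≤ 5·2^{o(g)} (i.e., |Aut(G)| ≤ (5/4)·2^{o(g)}). -/

import Mathlib

/-- `lFun n` is the least `k` such that `n` is a sum of `k` terms each of the
form `2^j` or `3·2^j`. -/
noncomputable def lFun (n : ℕ) : ℕ :=
  sInf {k | ∃ a e : Fin k → ℕ, (∀ i, a i = 1 ∨ a i = 3) ∧ n = ∑ i, a i * 2 ^ e i}

/-- `oFun n = n - lFun n`. -/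
noncomputable def oFun (n : ℕ) : ℕ := n - lFun n

namespace CubicAut

open Finset
open scoped Classical

noncomputable section

set_option linter.unusedSectionVars false

variable {V : Type*} [Fintype V] {G : SimpleGraph V} {K H : Subgroup (Equiv.Perm V)}
  {X Y S C F T W : Finset V} {R : Subgroup (Equiv.Perm V)}

/-- The neighbours of `v` as a finset. -/
def nb (G : SimpleGraph V) (v : V) : Finset V := univ.filter (G.Adj v)

@[simp] lemma mem_nb {G : SimpleGraph V} {v w : V} : w ∈ nb G v ↔ G.Adj v w := by simp [nb]

/-- The automorphism group of `G`, as a group of permutations. -/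
def aut (G : SimpleGraph V) : Subgroup (Equiv.Perm V) where
  carrier := {σ | ∀ x y, G.Adj (σ x) (σ y) ↔ G.Adj x y}
  mul_mem' := by
    intro a b ha hb x y
    simp only [Set.mem_ofPred_eq] at ha hb
    rw [Equiv.Perm.mul_apply, Equiv.Perm.mul_apply, ha, hb]
  one_mem' := by simp
  inv_mem' := by
    intro a ha x y
    simp only [Set.mem_ofPred_eq] at ha
    rw [← ha]; simp

lemma mem_aut {G : SimpleGraph V} {σ : Equiv.Perm V} :
    σ ∈ aut G ↔ ∀ x y, G.Adj (σ x) (σ y) ↔ G.Adj x y := Iff.rfl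

lemma card_aut (G : SimpleGraph V) : Nat.card (G ≃g G) = Nat.card (aut G) := by
  refine Nat.card_congr ⟨fun e => ⟨e.toEquiv, fun x y => e.map_rel_iff⟩,
    fun s => ⟨s.1, fun {x y} => s.2 x y⟩, fun e => ?_, fun s => ?_⟩
  · ext; rfl
  · ext; rfl

/-- The pointwise stabilizer of `S` in `K`. -/
def fx (K : Subgroup (Equiv.Perm V)) (S : Finset V) : Subgroup (Equiv.Perm V) where
  carrier := {σ | σ ∈ K ∧ ∀ s ∈ S, σ s = s}
  mul_mem' := by
    rintro a b ⟨ha, ha'⟩ ⟨hb, hb'⟩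
    refine ⟨K.mul_mem ha hb, fun s hs => ?_⟩
    rw [Equiv.Perm.mul_apply, hb' s hs, ha' s hs]
  one_mem' := ⟨K.one_mem, fun _ _ => rfl⟩
  inv_mem' := by
    rintro a ⟨ha, ha'⟩
    refine ⟨K.inv_mem ha, fun s hs => ?_⟩
    rw [Equiv.Perm.inv_eq_iff_eq, ha' s hs]

lemma mem_fx {K : Subgroup (Equiv.Perm V)} {S : Finset V} {σ : Equiv.Perm V} :
    σ ∈ fx K S ↔ σ ∈ K ∧ ∀ s ∈ S, σ s = s := Iff.rfl

lemma fx_le (K : Subgroup (Equiv.Perm V)) (S : Finset V) : fx K S ≤ K := fun _ h => h.1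

lemma fx_fx (K : Subgroup (Equiv.Perm V)) (S T : Finset V) : fx (fx K S) T = fx K (S ∪ T) := by
  ext σ; simp only [mem_fx, mem_union]; constructor
  · rintro ⟨⟨h1, h2⟩, h3⟩
    exact ⟨h1, fun s hs => hs.elim (h2 s) (h3 s)⟩
  · rintro ⟨h1, h2⟩
    exact ⟨⟨h1, fun s hs => h2 s (Or.inl hs)⟩, fun s hs => h2 s (Or.inr hs)⟩

lemma fx_anti (K : Subgroup (Equiv.Perm V)) {S T : Finset V} (h : S ⊆ T) : fx K T ≤ fx K S :=
  fun _ hs => ⟨hs.1, fun s hs' => hs.2 s (h hs')⟩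

lemma fx_eq_self {K : Subgroup (Equiv.Perm V)} {S : Finset V}
    (h : ∀ k ∈ K, ∀ s ∈ S, k s = s) : fx K S = K :=
  le_antisymm (fx_le K S) fun k hk => ⟨hk, h k hk⟩

lemma card_pos (K : Subgroup (Equiv.Perm V)) : 0 < Nat.card K := Nat.card_pos

lemma fx_univ (K : Subgroup (Equiv.Perm V)) : Nat.card (fx K univ) = 1 := by
  have : fx K univ = ⊥ := by
    rw [eq_bot_iff]; intro σ hσ
    rw [Subgroup.mem_bot]; ext x; exact hσ.2 x (mem_univ x)
  rw [this]; simp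

/-- The orbit of `x` under `K`. -/
def orb (K : Subgroup (Equiv.Perm V)) (x : V) : Finset V := univ.filter fun y => ∃ k ∈ K, k x = y

lemma mem_orb {K : Subgroup (Equiv.Perm V)} {x y : V} : y ∈ orb K x ↔ ∃ k ∈ K, k x = y := by
  simp [orb]

lemma self_mem_orb (K : Subgroup (Equiv.Perm V)) (x : V) : x ∈ orb K x :=
  mem_orb.2 ⟨1, K.one_mem, rfl⟩

lemma card_eq_orb_mul (K : Subgroup (Equiv.Perm V)) (x : V) :
    Nat.card K = (orb K x).card * Nat.card (fx K {x}) := by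
  have h := MulAction.card_orbit_mul_card_stabilizer_eq_card_group K x
  rw [← Nat.card_eq_fintype_card, ← Nat.card_eq_fintype_card, ← Nat.card_eq_fintype_card] at h
  rw [← h]
  congr 1
  · rw [← Fintype.card_coe, ← Nat.card_eq_fintype_card]
    refine Nat.card_congr (Equiv.subtypeEquivRight fun y => ?_)
    rw [mem_orb, MulAction.mem_orbit_iff]
    exact ⟨fun ⟨k, hk⟩ => ⟨k.1, k.2, hk⟩, fun ⟨k, hk, e⟩ => ⟨⟨k, hk⟩, e⟩⟩
  · refine Nat.card_congr ⟨fun s => ⟨s.1.1, s.1.2, ?_⟩, fun s => ⟨⟨s.1, s.2.1⟩, ?_⟩, fun _ => rfl, fun _ => rfl⟩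
    · intro y hy; rw [mem_singleton] at hy; subst hy; exact s.2
    · exact s.2.2 x (mem_singleton_self x)

/-- `x` is fixed by every element of `K`. -/
def Fixed (K : Subgroup (Equiv.Perm V)) (x : V) : Prop := ∀ k ∈ K, k x = x

lemma Fixed.mono {K L : Subgroup (Equiv.Perm V)} {x : V} (h : Fixed L x) (hKL : K ≤ L) :
    Fixed K x := fun k hk => h k (hKL hk)

lemma fixed_fx {K : Subgroup (Equiv.Perm V)} {S : Finset V} {x : V} (hx : x ∈ S) :
    Fixed (fx K S) x := fun _ hk => hk.2 x hx

lemma orb_eq_of_mem {K : Subgroup (Equiv.Perm V)} {x y : V} (h : y ∈ orb K x) :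
    orb K y = orb K x := by
  obtain ⟨k, hk, rfl⟩ := mem_orb.1 h
  ext z; simp only [mem_orb]; constructor
  · rintro ⟨l, hl, rfl⟩; exact ⟨l * k, K.mul_mem hl hk, rfl⟩
  · rintro ⟨l, hl, rfl⟩; exact ⟨l * k⁻¹, K.mul_mem hl (K.inv_mem hk), by simp⟩

lemma orb_eq_singleton {K : Subgroup (Equiv.Perm V)} {x : V} (h : Fixed K x) : orb K x = {x} := by
  ext y; rw [mem_orb, mem_singleton]
  exact ⟨fun ⟨k, hk, e⟩ => by rw [← e, h k hk], fun e => ⟨1, K.one_mem, e.symm⟩⟩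

lemma fixed_of_card_orb {K : Subgroup (Equiv.Perm V)} {x : V} (h : (orb K x).card = 1) :
    Fixed K x := fun k hk =>
  card_le_one.1 h.le _ (mem_orb.2 ⟨k, hk, rfl⟩) _ (self_mem_orb K x)

/-- Fixing `Y` pointwise costs exactly a factor `2 ^ t` in the order of `K`. -/
def Bits (K : Subgroup (Equiv.Perm V)) (Y : Finset V) (t : ℕ) : Prop :=
  Nat.card K = 2 ^ t * Nat.card (fx K Y)

lemma Bits.trans {K : Subgroup (Equiv.Perm V)} {Y Z : Finset V} {s t : ℕ} (h : Bits K Y s)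
    (h' : Bits (fx K Y) Z t) : Bits K (Y ∪ Z) (s + t) := by
  unfold Bits at *
  rw [h, h', fx_fx, pow_add, mul_assoc]

lemma Bits.le {K : Subgroup (Equiv.Perm V)} {Y : Finset V} {s t : ℕ} (h : Bits K Y s)
    (h' : s ≤ t) : Nat.card K ≤ 2 ^ t * Nat.card (fx K Y) := by
  rw [h]; gcongr; norm_num

lemma Bits.unique {K : Subgroup (Equiv.Perm V)} {Y : Finset V} {s t : ℕ} (h : Bits K Y s)
    (h' : Bits K Y t) : s = t := by
  unfold Bits at *
  rw [h] at h'
  exact Nat.pow_right_injective le_rfl (Nat.eq_of_mul_eq_mul_right (card_pos _) h')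

lemma Bits.zero {K : Subgroup (Equiv.Perm V)} {Y : Finset V} (h : ∀ y ∈ Y, Fixed K y) :
    Bits K Y 0 := by
  rw [Bits, fx_eq_self fun k hk s hs => h s hs k hk]; simp

/-- The elements of `Y` moved by `K`. -/
def mv (K : Subgroup (Equiv.Perm V)) (Y : Finset V) : Finset V := Y.filter fun y => ¬ Fixed K y

lemma mem_mv {K : Subgroup (Equiv.Perm V)} {Y : Finset V} {y : V} :
    y ∈ mv K Y ↔ y ∈ Y ∧ ¬ Fixed K y := by simp [mv]

lemma mv_mono {K L : Subgroup (Equiv.Perm V)} (h : K ≤ L) (Y : Finset V) : mv K Y ⊆ mv L Y := by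
  intro y hy; rw [mem_mv] at *
  exact ⟨hy.1, fun hf => hy.2 (hf.mono h)⟩

lemma explore (K : Subgroup (Equiv.Perm V)) (Y : Finset V) (μ : V → ℕ) (c : ℕ)
    (h : ∀ H ≤ K, (∃ y ∈ Y, ¬ Fixed H y) → ∃ q ∈ Y, ¬ Fixed H q ∧ (orb H q).card = 2 ∧
      c + ∑ y ∈ mv (fx H {q}) Y, μ y ≤ ∑ y ∈ mv H Y, μ y) :
    ∃ t, Bits K Y t ∧ c * t ≤ ∑ y ∈ mv K Y, μ y := by
  induction hn : (mv K Y).card using Nat.strong_induction_on generalizing K with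
  | _ n ih =>
  by_cases hY : ∃ y ∈ Y, ¬ Fixed K y
  · obtain ⟨q, hq, hqf, ho, hc⟩ := h K le_rfl hY
    have hlt : (mv (fx K {q}) Y).card < n := by
      rw [← hn]
      refine card_lt_card ((ssubset_iff_of_subset (mv_mono (fx_le _ _) Y)).2 ⟨q, ?_, ?_⟩)
      · exact mem_mv.2 ⟨hq, hqf⟩
      · exact fun hm => (mem_mv.1 hm).2 (fixed_fx (mem_singleton_self q))
    obtain ⟨t, ht, hct⟩ := ih _ hlt (fx K {q}) (fun H hH => h H (hH.trans (fx_le _ _))) rfl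
    refine ⟨t + 1, ?_, by rw [mul_add]; lia⟩
    rw [Bits, card_eq_orb_mul K q, ho, ht, fx_fx, singleton_union, insert_eq_of_mem hq]
    ring
  · push Not at hY
    exact ⟨0, Bits.zero hY, by simp⟩

/-- Every nonempty proper subset of `Y` is joined by an edge to the rest of `Y`. -/
def Conn (G : SimpleGraph V) (Y : Finset V) : Prop :=
  ∀ S ⊆ Y, S.Nonempty → S ≠ Y → ∃ p ∈ S, ∃ q ∈ Y, q ∉ S ∧ G.Adj p q

/-- A finite connected cubic graph. -/
structure Cub (G : SimpleGraph V) : Prop where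
  deg : ∀ v, (nb G v).card = 3
  conn : Conn G univ

/-- `Y` is preserved by `K`. -/
def Inv (K : Subgroup (Equiv.Perm V)) (Y : Finset V) : Prop := ∀ k ∈ K, ∀ y ∈ Y, k y ∈ Y

lemma Inv.mono {K L : Subgroup (Equiv.Perm V)} {Y : Finset V} (h : Inv L Y) (hKL : K ≤ L) :
    Inv K Y := fun k hk => h k (hKL hk)

lemma Inv.mem_iff {K : Subgroup (Equiv.Perm V)} {Y : Finset V} (h : Inv K Y) {k : Equiv.Perm V}
    (hk : k ∈ K) {y : V} : k y ∈ Y ↔ y ∈ Y :=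
  ⟨fun hy => by simpa using h k⁻¹ (K.inv_mem hk) _ hy, h k hk y⟩

lemma Inv.sdiff {K : Subgroup (Equiv.Perm V)} {Y Z : Finset V} (h : Inv K Y) (h' : Inv K Z) :
    Inv K (Y \ Z) := fun k hk y hy => by
  rw [mem_sdiff] at *; exact ⟨h k hk y hy.1, fun hz => hy.2 ((h'.mem_iff hk).1 hz)⟩

lemma Inv.union {K : Subgroup (Equiv.Perm V)} {Y Z : Finset V} (h : Inv K Y) (h' : Inv K Z) :
    Inv K (Y ∪ Z) := fun k hk y hy => by
  rw [mem_union] at *; exact hy.imp (h k hk y) (h' k hk y)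

lemma inv_univ (K : Subgroup (Equiv.Perm V)) : Inv K univ := fun _ _ _ _ => mem_univ _

lemma inv_of_fixed {K : Subgroup (Equiv.Perm V)} {Y : Finset V} (h : ∀ y ∈ Y, Fixed K y) :
    Inv K Y := fun k hk y hy => by rw [h y hy k hk]; exact hy

lemma inv_orb (K : Subgroup (Equiv.Perm V)) (x : V) : Inv K (orb K x) := fun k hk y hy => by
  obtain ⟨l, hl, rfl⟩ := mem_orb.1 hy
  exact mem_orb.2 ⟨k * l, K.mul_mem hk hl, rfl⟩

lemma orb_subset {K : Subgroup (Equiv.Perm V)} {Y : Finset V} (h : Inv K Y) {x : V} (hx : x ∈ Y) :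
    orb K x ⊆ Y := fun y hy => by
  obtain ⟨l, hl, rfl⟩ := mem_orb.1 hy
  exact h l hl x hx

lemma map_nb {k : Equiv.Perm V} (hk : k ∈ aut G) (v : V) : nb G (k v) = (nb G v).map k.toEmbedding := by
  ext w; simp only [mem_nb, mem_map, Equiv.coe_toEmbedding]
  constructor
  · intro h; exact ⟨k⁻¹ w, by rw [← hk]; simpa using h, by simp⟩
  · rintro ⟨x, hx, rfl⟩; exact (hk _ _).2 hx

lemma inv_nb {K : Subgroup (Equiv.Perm V)} (hK : K ≤ aut G) {v : V} (hv : Fixed K v) :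
    Inv K (nb G v) := fun k hk y hy => by
  rw [mem_nb] at *
  have := (hK hk v y).2 hy
  rwa [hv k hk] at this

/-- `v` and one of its neighbours are fixed by `K`. -/
def Anch (G : SimpleGraph V) (K : Subgroup (Equiv.Perm V)) (v : V) : Prop :=
  Fixed K v ∧ ∃ u, G.Adj v u ∧ Fixed K u

lemma Anch.mono {K L : Subgroup (Equiv.Perm V)} {v : V} (h : Anch G L v) (hKL : K ≤ L) :
    Anch G K v := ⟨h.1.mono hKL, h.2.imp fun _ hu => ⟨hu.1, hu.2.mono hKL⟩⟩

lemma card_three {s : Finset V} (hs : s.card = 3) {a b c : V} (ha : a ∈ s) (hb : b ∈ s) (hc : c ∈ s)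
    (hab : a ≠ b) (hac : a ≠ c) (hbc : b ≠ c) : s = {a, b, c} := by
  symm
  apply eq_of_subset_of_card_le
  · intro x; simp only [mem_insert, mem_singleton]; rintro (rfl | rfl | rfl) <;> assumption
  · rw [hs, card_eq_three.2 ⟨a, b, c, hab, hac, hbc, rfl⟩]

lemma pair_of_moved {H : Subgroup (Equiv.Perm V)} (hH : H ≤ aut G) {p u q : V}
    (hd : (nb G p).card = 3) (hp : Fixed H p) (hu : Fixed H u) (hpu : G.Adj p u) (hpq : G.Adj p q)
    (hq : ¬ Fixed H q) : ∃ q', q' ≠ q ∧ u ≠ q ∧ u ≠ q' ∧ nb G p = {u, q, q'} ∧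
      orb H q = {q, q'} ∧ Fixed (fx H {q}) q' ∧ ∃ h ∈ H, h q = q' ∧ h q' = q := by
  have huq : u ≠ q := fun e => hq (e ▸ hu)
  obtain ⟨h, hh, hne⟩ : ∃ h ∈ H, h q ≠ q := by simpa [Fixed] using hq
  have huq' : u ≠ h q := fun e => huq (h.injective ((hu h hh).trans e))
  have hN : nb G p = {u, q, h q} :=
    card_three hd (by simpa) (by simpa) (inv_nb hH hp h hh q (by simpa)) huq huq' hne.symm
  have key : ∀ k ∈ H, ∀ z ∈ ({q, h q} : Finset V), k z = q ∨ k z = h q := by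
    intro k hk z hz
    have hzu : z ≠ u := by
      simp only [mem_insert, mem_singleton] at hz; rcases hz with rfl | rfl
      · exact huq.symm
      · exact huq'.symm
    have hz' : z ∈ nb G p := by rw [hN]; exact mem_insert_of_mem hz
    have := inv_nb hH hp k hk z hz'
    rw [hN, mem_insert, mem_insert, mem_singleton] at this
    rcases this with h1 | h1
    · exact absurd (k.injective (h1.trans (hu k hk).symm)) hzu
    · exact h1
  have hsw : h (h q) = q := by
    rcases key h hh (h q) (by simp) with h1 | h1
    · exact h1
    · exact absurd (h.injective h1) hne
  refine ⟨h q, hne, huq, huq', hN, ?_, ?_, h, hh, rfl, hsw⟩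
  · ext z; rw [mem_orb, mem_insert, mem_singleton]; constructor
    · rintro ⟨k, hk, rfl⟩; exact key k hk q (by simp)
    · rintro (rfl | rfl)
      · exact ⟨1, H.one_mem, rfl⟩
      · exact ⟨h, hh, rfl⟩
  · intro k hk
    rcases key k hk.1 (h q) (by simp) with h1 | h1
    · exact absurd (k.injective (h1.trans (hk.2 q (mem_singleton_self q)).symm)) hne
    · exact h1

lemma exists_moved_of_conn {H : Subgroup (Equiv.Perm V)} {Y : Finset V}
    (hY : Conn G Y) {v : V} (hv : v ∈ Y) (hva : Anch G H v) (hm : ∃ y ∈ Y, ¬ Fixed H y) :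
    ∃ p ∈ Y, ∃ q ∈ Y, Anch G H p ∧ G.Adj p q ∧ ¬ Fixed H q := by
  obtain ⟨p, hp, q, hq, hqS, hpq⟩ := hY (Y.filter (Anch G H)) (filter_subset _ _)
    ⟨v, by simp [hv, hva]⟩ (fun e => by
      obtain ⟨y, hy, hyf⟩ := hm
      rw [← e, mem_filter] at hy; exact hyf hy.2.1)
  rw [mem_filter] at hp
  refine ⟨p, hp.1, q, hq, hp.2, hpq, fun hf => hqS ?_⟩
  rw [mem_filter]; exact ⟨hq, hf, p, hpq.symm, hp.2.1⟩

lemma card_add_sum_le {K L : Subgroup (Equiv.Perm V)} {Y D : Finset V} {μ : V → ℕ} (h : K ≤ L)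
    (hD : D ⊆ Y) (hL : ∀ d ∈ D, ¬ Fixed L d) (hK : ∀ d ∈ D, Fixed K d) :
    ∑ y ∈ D, μ y + ∑ y ∈ mv K Y, μ y ≤ ∑ y ∈ mv L Y, μ y := by
  rw [← sum_union]
  · apply sum_le_sum_of_subset
    intro y hy
    rcases mem_union.1 hy with hy | hy
    · exact mem_mv.2 ⟨hD hy, hL y hy⟩
    · exact mv_mono h Y hy
  · rw [disjoint_left]; intro y hy hy'
    exact (mem_mv.1 hy').2 (hK y hy)

lemma not_fixed_of_swap {H : Subgroup (Equiv.Perm V)} {h : Equiv.Perm V} (hh : h ∈ H) {q q' : V}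
    (e : h q = q') (hne : q' ≠ q) : ¬ Fixed H q := fun hf => hne (e ▸ hf h hh)

lemma explore_conn (hG : Cub G) {K : Subgroup (Equiv.Perm V)} (hK : K ≤ aut G) {Y : Finset V}
    (hY : Conn G Y) (hinv : Inv K Y) {v : V} (hv : v ∈ Y) (hva : Anch G K v) :
    ∃ t, Bits K Y t ∧ 2 * t ≤ (mv K Y).card := by
  have := explore K Y (fun _ => 1) 2 fun H hHK hm => by
    obtain ⟨p, hp, q, hq, ⟨hpf, u, hpu, huf⟩, hpq, hqf⟩ :=
      exists_moved_of_conn hY hv (hva.mono hHK) hm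
    obtain ⟨q', hne, -, -, -, ho, hf', h, hh, e1, e2⟩ :=
      pair_of_moved (hHK.trans hK) (hG.deg p) hpf huf hpu hpq hqf
    refine ⟨q, hq, hqf, by rw [ho, card_pair hne.symm], ?_⟩
    have hq' : q' ∈ Y := e1 ▸ hinv h (hHK hh) q hq
    have := card_add_sum_le (μ := fun _ => 1) (D := {q, q'}) (fx_le H {q})
      (Y := Y) (by intro z; simp only [mem_insert, mem_singleton]; rintro (rfl | rfl) <;> assumption)
      (by
        intro z; simp only [mem_insert, mem_singleton]; rintro (rfl | rfl)
        · exact hqf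
        · exact not_fixed_of_swap hh e2 hne.symm)
      (by
        intro z; simp only [mem_insert, mem_singleton]; rintro (rfl | rfl)
        · exact fixed_fx (mem_singleton_self z)
        · exact hf')
    rwa [sum_const, card_pair hne.symm] at this
  simpa using this

lemma even_sum_inter (G : SimpleGraph V) (T : Finset V) : Even (∑ x ∈ T, (nb G x ∩ T).card) := by
  let H : SimpleGraph V :=
    { Adj := fun x y => G.Adj x y ∧ x ∈ T ∧ y ∈ T
      symm := ⟨fun x y h => ⟨h.1.symm, h.2.2, h.2.1⟩⟩
      loopless := ⟨fun x h => G.loopless.irrefl x h.1⟩ }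
  have h := H.sum_degrees_eq_twice_card_edges
  have h2 : ∑ x ∈ T, (nb G x ∩ T).card = ∑ x, H.degree x := by
    rw [← sum_subset (subset_univ T)]
    · refine sum_congr rfl fun x hx => ?_
      rw [← SimpleGraph.card_neighborFinset_eq_degree]
      congr 1; ext y
      simp [H, hx]
    · intro x _ hx
      rw [← SimpleGraph.card_neighborFinset_eq_degree, card_eq_zero]
      ext y; simp [H, hx]
  rw [h2, h]; exact even_two_mul _

/-- `T` is one side of the bridge `p r`, with `r ∈ T`. -/
structure Side (G : SimpleGraph V) (T : Finset V) (p r : V) : Prop where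
  mem : r ∈ T
  not_mem : p ∉ T
  adj : G.Adj p r
  cut : ∀ x ∈ T, ∀ y, y ∉ T → G.Adj x y → x = r ∧ y = p

variable {T T' : Finset V} {p r : V}

lemma Side.compl (h : Side G T p r) : Side G Tᶜ r p where
  mem := by simpa using h.not_mem
  not_mem := by simpa using h.mem
  adj := h.adj.symm
  cut x hx y hy hxy := by
    rw [mem_compl, not_not] at hy; rw [mem_compl] at hx
    exact (h.cut y hy x hx hxy.symm).symm

lemma Side.conn (hG : Cub G) (h : Side G T p r) : Conn G T := by
  intro S hST hS hne
  by_cases hr : r ∈ S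
  · have hne' : (T \ S).Nonempty := by
      rw [sdiff_nonempty]; exact fun h' => hne (hST.antisymm h')
    obtain ⟨a, ha, b, -, hb, hab⟩ := hG.conn (T \ S) (subset_univ _) hne'
      (fun e => by have := mem_univ r; rw [← e, mem_sdiff] at this; exact this.2 hr)
    rw [mem_sdiff] at ha
    refine ⟨b, ?_, a, ha.1, ha.2, hab.symm⟩
    by_contra hbS
    have hbT : b ∉ T := fun hbT => hb (mem_sdiff.2 ⟨hbT, hbS⟩)
    exact ha.2 ((h.cut a ha.1 b hbT hab).1 ▸ hr)
  · obtain ⟨a, ha, b, -, hb, hab⟩ := hG.conn S (subset_univ _) hS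
      (fun e => hr (e ▸ mem_univ r))
    refine ⟨a, ha, b, ?_, hb, hab⟩
    by_contra hbT
    exact hr ((h.cut a (hST ha) b hbT hab).1 ▸ ha)

lemma Side.odd (hG : Cub G) (h : Side G T p r) : Odd T.card := by
  have h1 := even_sum_inter G T
  have h2 : ∑ x ∈ T, (nb G x ∩ T).card + 1 = 3 * T.card := by
    rw [← add_sum_erase _ _ h.mem]
    have hr : (nb G r ∩ T).card = 2 := by
      have : nb G r ∩ T = (nb G r).erase p := by
        ext y; simp only [mem_inter, mem_nb, mem_erase]
        constructor
        · rintro ⟨h1, h2⟩; exact ⟨fun e => h.not_mem (e ▸ h2), h1⟩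
        · rintro ⟨h1, h2⟩; exact ⟨h2, by_contra fun hy => h1 (h.cut r h.mem y hy h2).2⟩
      rw [this, card_erase_of_mem (by simpa using h.adj.symm), hG.deg]
    have hx : ∀ x ∈ T.erase r, (nb G x ∩ T).card = 3 := by
      intro x hx
      rw [mem_erase] at hx
      rw [← hG.deg x]; congr 1
      rw [inter_eq_left]
      intro y hy; rw [mem_nb] at hy
      by_contra hyT
      exact hx.1 (h.cut x hx.2 y hyT hy).1
    rw [hr, sum_congr rfl hx, sum_const, card_erase_of_mem h.mem, smul_eq_mul]
    have := Finset.card_pos.2 ⟨r, h.mem⟩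
    lia
  rcases h1 with ⟨k, hk⟩
  rw [Nat.odd_iff]; lia

lemma Side.unique (hG : Cub G) (h : Side G T p r) (h' : Side G T' p r) : T = T' := by
  have key : ∀ {A B : Finset V}, Side G A p r → Side G B p r → A ⊆ B := by
    intro A B hA hB
    by_contra hAB
    obtain ⟨x, hx, y, hy, hy', hxy⟩ := hA.conn hG (A ∩ B) inter_subset_left
      ⟨r, mem_inter.2 ⟨hA.mem, hB.mem⟩⟩ (fun e => hAB (inter_eq_left.1 e))
    rw [mem_inter] at hx hy'
    have := hB.cut x hx.2 y (fun hyB => hy' ⟨hy, hyB⟩) hxy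
    exact hA.not_mem (this.2 ▸ hy)
  exact (key h h').antisymm (key h' h)

lemma Side.map (h : Side G T p r) {k : Equiv.Perm V} (hk : k ∈ aut G) :
    Side G (T.map k.toEmbedding) (k p) (k r) where
  mem := by simpa using h.mem
  not_mem := by simpa using h.not_mem
  adj := (hk _ _).2 h.adj
  cut x hx y hy hxy := by
    rw [mem_map] at hx; obtain ⟨x, hx, rfl⟩ := hx
    have := h.cut x hx (k⁻¹ y) (fun hy' => hy (mem_map.2 ⟨_, hy', by simp⟩))
      (by rw [← hk]; simpa using hxy)
    rw [← this.1, ← this.2]; simp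

lemma Side.inv (hG : Cub G) (h : Side G T p r) {K : Subgroup (Equiv.Perm V)} (hK : K ≤ aut G)
    (hp : Fixed K p) (hr : Fixed K r) : Inv K T := by
  intro k hk y hy
  have := h.map (hK hk)
  rw [hp k hk, hr k hk] at this
  rw [h.unique hG this]
  exact mem_map.2 ⟨y, hy, rfl⟩

lemma Side.anch (h : Side G T p r) {K : Subgroup (Equiv.Perm V)}
    (hp : Fixed K p) (hr : Fixed K r) : Anch G K r := ⟨hr, p, h.adj.symm, hp⟩

lemma Side.bits (hG : Cub G) (h : Side G T p r) {K : Subgroup (Equiv.Perm V)} (hK : K ≤ aut G)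
    (hp : Fixed K p) (hr : Fixed K r) : ∃ t, Bits K T t ∧ 2 * t + 1 ≤ T.card := by
  obtain ⟨t, ht, htc⟩ := explore_conn hG hK (h.conn hG) (h.inv hG hK hp hr) h.mem (h.anch hp hr)
  refine ⟨t, ht, ?_⟩
  have : mv K T ⊂ T := (ssubset_iff_of_subset (filter_subset _ _)).2
    ⟨r, h.mem, fun hm => (mem_mv.1 hm).2 hr⟩
  have := card_lt_card this
  lia

/-- A side of a bridge containing less than half of the vertices. -/
def Small (G : SimpleGraph V) (T : Finset V) (p r : V) : Prop :=
  Side G T p r ∧ 2 * T.card < Fintype.card V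

/-- The vertices lying in no small side. -/
def core (G : SimpleGraph V) : Finset V := univ.filter fun v => ∀ T p r, Small G T p r → v ∉ T

lemma mem_core {v : V} : v ∈ core G ↔ ∀ T p r, Small G T p r → v ∉ T := by simp [core]

lemma inv_core : Inv (aut G) (core G) := by
  intro k hk v hv
  rw [mem_core] at *
  intro T p r hT hvT
  have hk' := (aut G).inv_mem hk
  refine hv _ _ _ ⟨hT.1.map hk', by rw [card_map]; exact hT.2⟩ ?_
  exact mem_map.2 ⟨k v, hvT, by simp⟩

lemma Small.trichotomy (hG : Cub G) {p' r' : V} (h : Small G T p r) (h' : Small G T' p' r') :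
    T ⊆ T' ∨ T' ⊆ T ∨ Disjoint T T' := by
  by_contra hcon
  push Not at hcon
  obtain ⟨h1, h2, h3⟩ := hcon
  rw [not_disjoint_iff] at h3
  obtain ⟨z, hz, hz'⟩ := h3
  have key : ∀ {A B : Finset V} {p q p' r' : V}, Side G A p q → Side G B p' r' → ¬ A ⊆ B → z ∈ A → z ∈ B →
      p' ∈ A := by
    intro A B p q p' r' hA hB hAB hzA hzB
    obtain ⟨x, hx, y, hy, hy', hxy⟩ := hA.conn hG (A ∩ B) inter_subset_left
      ⟨z, mem_inter.2 ⟨hzA, hzB⟩⟩ (fun e => hAB (inter_eq_left.1 e))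
    rw [mem_inter] at hx hy'
    have := hB.cut x hx.2 y (fun hyB => hy' ⟨hy, hyB⟩) hxy
    exact this.2 ▸ hy
  have hp' := key h.1 h'.1 h1 hz hz'
  have hp := key h'.1 h.1 h2 hz' hz
  obtain ⟨x, hx, y, -, hy, hxy⟩ := hG.conn (T ∪ T') (subset_univ _) ⟨z, mem_union_left _ hz⟩
    (fun e => by
      have := card_union_le T T'
      rw [e, card_univ] at this
      have := h.2; have := h'.2; lia)
  rw [mem_union, not_or] at hy
  rcases mem_union.1 hx with hx | hx
  · exact hy.2 ((h.1.cut x hx y hy.1 hxy).2 ▸ hp)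
  · exact hy.1 ((h'.1.cut x hx y hy.2 hxy).2 ▸ hp')

lemma exists_small_max {v : V} (hv : v ∉ core G) : ∃ T p r, Small G T p r ∧ v ∈ T ∧
    ∀ T' p' r', Small G T' p' r' → T ⊆ T' → T' = T := by
  rw [mem_core] at hv
  push Not at hv
  obtain ⟨T₀, p₀, r₀, h₀, hv₀⟩ := hv
  obtain ⟨T, hT, hmax⟩ := (univ.filter fun T : Finset V => v ∈ T ∧ ∃ p r, Small G T p r).exists_max_image
    card ⟨T₀, by simp only [mem_filter, mem_univ, true_and]; exact ⟨hv₀, _, _, h₀⟩⟩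
  simp only [mem_filter, mem_univ, true_and] at hT
  obtain ⟨hvT, p, r, hs⟩ := hT
  refine ⟨T, p, r, hs, hvT, fun T' p' r' hs' hTT' => ?_⟩
  exact (eq_of_subset_of_card_le hTT'
    (hmax T' (by simp only [mem_filter, mem_univ, true_and]; exact ⟨hTT' hvT, _, _, hs'⟩))).symm

lemma Small.parent_mem_core (hG : Cub G) (h : Small G T p r)
    (hmax : ∀ T' p' r', Small G T' p' r' → T ⊆ T' → T' = T) : p ∈ core G := by
  by_contra hp
  obtain ⟨T', p', r', hs', hp', hmax'⟩ := exists_small_max hp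
  have hd : Disjoint T T' := by
    rcases h.trichotomy hG hs' with h1 | h1 | h1
    · rw [hmax _ _ _ hs' h1] at hp'; exact absurd hp' h.1.not_mem
    · rw [← hmax' _ _ _ h h1] at hp'; exact absurd hp' h.1.not_mem
    · exact h1
  have hr : r ∉ T' := disjoint_left.1 hd h.1.mem
  obtain ⟨e1, e2⟩ := hs'.1.cut p hp' r hr h.1.adj
  obtain ⟨x, hx, y, -, hy, hxy⟩ := hG.conn (T ∪ T') (subset_univ _) ⟨r, mem_union_left _ h.1.mem⟩
    (fun e => by
      have := card_union_le T T'
      rw [e, card_univ] at this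
      have := h.2; have := hs'.2; lia)
  rw [mem_union, not_or] at hy
  rcases mem_union.1 hx with hx | hx
  · exact hy.2 ((h.1.cut x hx y hy.1 hxy).2 ▸ hp')
  · exact hy.1 ((hs'.1.cut x hx y hy.2 hxy).2 ▸ e2 ▸ h.1.mem)

lemma core_nonempty (hG : Cub G) (v : V) : (core G).Nonempty := by
  by_cases hv : v ∈ core G
  · exact ⟨v, hv⟩
  · obtain ⟨T, p, r, hs, -, hmax⟩ := exists_small_max hv
    exact ⟨p, hs.parent_mem_core hG hmax⟩

lemma exists_small_of_adj {v r : V} (hv : v ∈ core G) (hr : r ∉ core G) (h : G.Adj v r) :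
    ∃ T, Small G T v r := by
  obtain ⟨T, p, r', hs, hrT, -⟩ := exists_small_max hr
  have := hs.1.cut r hrT v (mem_core.1 hv T p r' hs) h.symm
  rw [this.1, this.2]; exact ⟨T, hs⟩

lemma exists_parent (hG : Cub G) {v : V} (hv : v ∉ core G) : ∃ T p r, Small G T p r ∧ v ∈ T ∧
    p ∈ core G ∧ r ∉ core G := by
  obtain ⟨T, p, r, hs, hvT, hmax⟩ := exists_small_max hv
  exact ⟨T, p, r, hs, hvT, hs.parent_mem_core hG hmax, fun hr => mem_core.1 hr T p r hs hs.1.mem⟩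

lemma Small.disjoint (hG : Cub G) {p' r' : V} (h : Small G T p r) (h' : Small G T' p' r')
    (hp : p ∈ core G) (hp' : p' ∈ core G) (hne : r ≠ r') : Disjoint T T' := by
  have key : ∀ {A B : Finset V} {p q p' r' : V}, Small G A p q → Small G B p' r' → p ∈ core G →
      p' ∈ core G → A ⊆ B → q = r' := by
    intro A B p q p' r' hA hB hp hp' hAB
    exact (hB.1.cut q (hAB hA.1.mem) p (mem_core.1 hp _ _ _ hB) hA.1.adj.symm).1
  rcases h.trichotomy hG h' with h1 | h1 | h1
  · exact absurd (key h h' hp hp' h1) hne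
  · exact absurd (key h' h hp' hp h1).symm hne
  · exact h1

lemma Small.disjoint_core (h : Small G T p r) : Disjoint T (core G) :=
  disjoint_left.2 fun _ hx hc => mem_core.1 hc T p r h hx

/-- `S` together with all small sides attached to `S`. -/
def hull (G : SimpleGraph V) (S : Finset V) : Finset V :=
  univ.filter fun v => v ∈ S ∨ ∃ p ∈ S, ∃ T r, Small G T p r ∧ v ∈ T

lemma mem_hull {S : Finset V} {v : V} :
    v ∈ hull G S ↔ v ∈ S ∨ ∃ p ∈ S, ∃ T r, Small G T p r ∧ v ∈ T := by simp [hull]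

lemma mem_hull_of_core {S : Finset V} {v : V} (hv : v ∈ core G) : v ∈ hull G S ↔ v ∈ S := by
  rw [mem_hull]; constructor
  · rintro (h | ⟨p, -, T, r, hs, h⟩)
    · exact h
    · exact absurd h (mem_core.1 hv _ _ _ hs)
  · exact Or.inl

lemma hull_cut {S : Finset V} (hS : S ⊆ core G) {x y : V} (hx : x ∈ hull G S) (hy : y ∉ hull G S)
    (hxy : G.Adj x y) : x ∈ S ∧ y ∈ core G ∧ y ∉ S := by
  rw [mem_hull, not_or] at hy
  have hx' : x ∈ S := by
    rcases mem_hull.1 hx with h | ⟨p, hp, T, r, hs, h⟩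
    · exact h
    · exfalso
      refine hy.1 ?_
      rw [(hs.1.cut x h y (fun hyT => hy.2 ⟨p, hp, T, r, hs, hyT⟩) hxy).2]
      exact hp
  refine ⟨hx', ?_, hy.1⟩
  by_contra hyc
  obtain ⟨T, hT⟩ := exists_small_of_adj (hS hx') hyc hxy
  exact hy.2 ⟨x, hx', T, y, hT, hT.1.mem⟩

lemma conn_core (hG : Cub G) : Conn G (core G) := by
  intro S hS hne hneq
  obtain ⟨c, hc, hcS⟩ : ∃ c ∈ core G, c ∉ S := by
    by_contra h; push Not at h; exact hneq (hS.antisymm h)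
  obtain ⟨x, hx, y, -, hy, hxy⟩ := hG.conn (hull G S) (subset_univ _)
    (hne.imp fun s hs => mem_hull.2 (Or.inl hs))
    (fun e => hcS ((mem_hull_of_core hc).1 (e ▸ mem_univ c)))
  obtain ⟨h1, h2, h3⟩ := hull_cut hS hx hy hxy
  exact ⟨x, h1, y, h2, h3, hxy⟩

/-- The core has no bridge: a second edge leaves `S`. -/
lemma exists_second_edge (hG : Cub G) (hn : 4 ∣ Fintype.card V) {S : Finset V} (hS : S ⊆ core G)
    {x y : V} (hx : x ∈ S) (hy : y ∈ core G) (hyS : y ∉ S) (hxy : G.Adj x y) :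
    ∃ p ∈ S, ∃ q ∈ core G, q ∉ S ∧ G.Adj p q ∧ ¬ (p = x ∧ q = y) := by
  by_contra hcon
  push Not at hcon
  have hside : Side G (hull G S) y x :=
    { mem := mem_hull.2 (Or.inl hx)
      not_mem := fun h => hyS ((mem_hull_of_core hy).1 h)
      adj := hxy.symm
      cut := fun a ha b hb hab => by
        obtain ⟨h1, h2, h3⟩ := hull_cut hS ha hb hab
        exact hcon a h1 b h2 h3 hab }
  have hodd := hside.odd hG
  obtain ⟨k, hk⟩ := hn
  obtain ⟨j, hj⟩ := hodd
  have hc := card_compl (hull G S)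
  have hle := card_le_univ (hull G S)
  rcases lt_or_ge (2 * (hull G S).card) (Fintype.card V) with h | h
  · exact mem_core.1 (hS hx) _ _ _ ⟨hside, h⟩ hside.mem
  · exact mem_core.1 hy _ _ _ ⟨hside.compl, by lia⟩ hside.compl.mem

lemma two_core_nb (hG : Cub G) (hn : 4 ∣ Fintype.card V) (hC : (core G).card ≠ 1) {v : V}
    (hv : v ∈ core G) : 2 ≤ (nb G v ∩ core G).card := by
  obtain ⟨p, hp, q, hq, hqv, hpq⟩ := conn_core hG {v} (by simpa) (by simp)
    (fun e => hC (by rw [← e]; simp))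
  rw [mem_singleton] at hp; subst hp
  obtain ⟨p', hp', q', hq', hqv', hpq', hne⟩ := exists_second_edge hG hn (S := {p}) (by simpa)
    (mem_singleton_self p) hq hqv hpq
  rw [mem_singleton] at hp'; subst hp'
  have : q' ≠ q := fun e => hne ⟨rfl, e⟩
  rw [← card_pair this]
  apply card_le_card
  intro z; simp only [mem_insert, mem_singleton, mem_inter, mem_nb]
  rintro (rfl | rfl)
  · exact ⟨hpq', hq'⟩
  · exact ⟨hpq, hq⟩

/-- `S ⊆ X` is anchored, and fixing `X` after fixing `S` costs the largest possible number of
bits. -/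
structure Tight (G : SimpleGraph V) (K : Subgroup (Equiv.Perm V)) (X S : Finset V) : Prop where
  sub : S ⊆ X
  anch : ∀ s ∈ S, Anch G (fx K S) s
  bits : ∃ t, Bits (fx K S) X t ∧ 2 * t = (X \ S).card

lemma Tight.step (hG : Cub G) (hK : K ≤ aut G) (hX : Conn G X) (hinv : Inv K X)
    (hS : Tight G K X S) {p q : V} (hp : p ∈ S) (hq : q ∈ X) (hqS : q ∉ S) (hpq : G.Adj p q) :
    ∃ u q', q' ∈ X ∧ q' ∉ S ∧ q' ≠ q ∧ (u ∈ X → u ∈ S) ∧ nb G p = {u, q, q'} ∧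
      Tight G K X (S ∪ {q, q'}) ∧ ∃ k ∈ fx K S, k q = q' ∧ k q' = q := by
  have moved : ∀ z ∈ X, z ∉ S → ∀ p ∈ S, G.Adj p z → ¬ Fixed (fx K S) z := by
    intro z hz hzS p hp hpz hf
    obtain ⟨t, ht, h2t⟩ := hS.bits
    obtain ⟨t', ht', h2t'⟩ := explore_conn hG ((fx_le K S).trans hK) hX (hinv.mono (fx_le K S))
      (hS.sub hp) (hS.anch p hp)
    rw [ht'.unique ht, h2t] at h2t'
    have : mv (fx K S) X ⊆ (X \ S).erase z := by
      intro w hw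
      rw [mem_mv] at hw
      rw [mem_erase, mem_sdiff]
      exact ⟨fun e => hw.2 (e ▸ hf), hw.1, fun hwS => hw.2 (fixed_fx hwS)⟩
    have h3 := card_le_card this
    rw [card_erase_of_mem (mem_sdiff.2 ⟨hz, hzS⟩)] at h3
    have := Finset.card_pos.2 ⟨z, mem_sdiff.2 ⟨hz, hzS⟩⟩
    lia
  have hqf := moved q hq hqS p hp hpq
  obtain ⟨hpf, u, hpu, huf⟩ := hS.anch p hp
  obtain ⟨q', hne, huq, huq', hN, ho, hf', k, hk, e1, e2⟩ :=
    pair_of_moved ((fx_le K S).trans hK) (hG.deg p) hpf huf hpu hpq hqf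
  have hq' : q' ∈ X := e1 ▸ hinv k hk.1 q hq
  have hqS' : q' ∉ S := fun h => not_fixed_of_swap hk e2 hne.symm (fixed_fx h)
  have hpq' : G.Adj p q' := by rw [← mem_nb, hN]; simp
  have hcard : Nat.card (fx K S) = 2 * Nat.card (fx K (S ∪ {q, q'})) := by
    rw [card_eq_orb_mul (fx K S) q, ho, card_pair hne.symm, ← fx_fx]
    suffices h : fx (fx K S) {q} = fx (fx K S) {q, q'} by rw [h]
    refine le_antisymm (fun σ hσ => ⟨hσ.1, ?_⟩) (fx_anti _ (by simp))
    intro s hs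
    rcases mem_insert.1 hs with rfl | hs
    · exact hσ.2 s (by simp)
    · rw [mem_singleton.1 hs]; exact hf' σ hσ
  have hsub : S ∪ {q, q'} ⊆ X := by
    intro z; simp only [mem_union, mem_insert, mem_singleton]
    rintro (h | rfl | rfl)
    · exact hS.sub h
    · exact hq
    · exact hq'
  refine ⟨u, q', hq', hqS', hne, fun hu => ?_, hN, ⟨hsub, ?_, ?_⟩, k, hk, e1, e2⟩
  · by_contra huS
    exact moved u hu huS p hp hpu huf
  · intro s hs
    rw [mem_union] at hs
    rcases hs with hs | hs
    · exact (hS.anch s hs).mono (fx_anti K subset_union_left)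
    · refine ⟨fixed_fx (mem_union_right _ hs), p, ?_, fixed_fx (mem_union_left _ hp)⟩
      simp only [mem_insert, mem_singleton] at hs
      rcases hs with rfl | rfl
      · exact hpq.symm
      · exact hpq'.symm
  · obtain ⟨t, ht, h2t⟩ := hS.bits
    have h1 : (X \ S).card = (X \ (S ∪ {q, q'})).card + 2 := by
      rw [← card_pair hne.symm, ← sup_eq_union, ← sdiff_sdiff]
      rw [card_sdiff_add_card_eq_card]
      intro z; simp only [mem_insert, mem_singleton, mem_sdiff]
      rintro (rfl | rfl) <;> constructor <;> assumption
    refine ⟨t - 1, ?_, by lia⟩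
    unfold Bits at *
    rw [hcard, fx_fx, union_eq_right.2 hS.sub] at ht
    rw [fx_fx, union_eq_right.2 hsub]
    obtain ⟨t, rfl⟩ : ∃ s, t = s + 1 := ⟨t - 1, by lia⟩
    rw [pow_succ] at ht
    simp only [Nat.add_sub_cancel]
    lia

/-- The part of `X` closed off by `x`. -/
def Shut (G : SimpleGraph V) (X F : Finset V) (x : V) (D : Finset V) : Prop :=
  D ⊆ X ∧ x ∈ D ∧ (∀ d ∈ D, d ∈ F → d = x) ∧
    ∀ a ∈ D, ∀ b ∈ X, b ∉ D → G.Adj a b → a = x ∧ b ∈ F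

set_option maxHeartbeats 400000 in
lemma closing (hG : Cub G) (hK : K ≤ aut G) (hX : Conn G X) (hinv : Inv K X)
    (hF : Tight G K X F) {x y : V} (hx : x ∈ F) (hy : y ∈ F) (hxy : x ≠ y)
    (hout : ∀ f ∈ F, f ≠ x → f ≠ y → ∀ q ∈ X, G.Adj f q → q ∈ F) :
    (∃ D, Shut G X F x D) ∨ (∃ D, Shut G X F y D) ∨
    (X.card = F.card + 2 ∧ ∃ q ∈ X, ∃ q' ∈ X, q ∉ F ∧ q' ∉ F ∧ q ≠ q' ∧ G.Adj x q ∧ G.Adj x q') ∨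
    (X.card = F.card + 4 ∧ ∀ a ∈ X, a ∉ F → nb G a ⊆ X) := by
  obtain ⟨S, hS, hmax⟩ := (univ.filter fun S : Finset V => Tight G K X S ∧ F ⊆ S ∧
    (∀ a ∈ S, a ∉ F → ¬ G.Adj y a) ∧ (S = F ∨ ∃ a ∈ S, a ∉ F ∧ G.Adj x a)).exists_max_image
    card ⟨F, by
      simp only [mem_filter, mem_univ, true_and]
      exact ⟨hF, subset_rfl, fun a h h' => absurd h h', Or.inl trivial⟩⟩
  simp only [mem_filter, mem_univ, true_and] at hS hmax
  obtain ⟨hZ, hFS, hyS, hgrow⟩ := hS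
  by_cases hex : ∃ p ∈ S, p ≠ y ∧ ∃ q ∈ X, q ∉ S ∧ G.Adj p q
  swap
  · left
    push Not at hex
    refine ⟨S.filter fun s => s ∈ F → s = x, fun s hs => hZ.sub (mem_filter.1 hs).1, ?_, ?_, ?_⟩
    · simp [hFS hx]
    · intro d hd; exact (mem_filter.1 hd).2
    · intro a ha b hb hbD hab
      rw [mem_filter] at ha hbD
      have hay : a ≠ y := by rintro rfl; exact hxy (ha.2 hy).symm
      have hbS : b ∈ S := by by_contra h; exact hex a ha.1 hay b hb h hab
      have hbF : b ∈ F := by by_contra h; exact hbD ⟨hbS, fun h' => absurd h' h⟩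
      refine ⟨?_, hbF⟩
      by_contra hax
      have haF : a ∉ F := fun h => hax (ha.2 h)
      by_cases hby : b = y
      · subst hby; exact hyS a ha.1 haF hab.symm
      · refine haF (hout b hbF (fun e => hbD ⟨hbS, fun _ => e⟩) hby a (hZ.sub ha.1) hab.symm)
  right
  obtain ⟨p, hp, hpy, q, hq, hqS, hpq⟩ := hex
  have hqF : q ∉ F := fun h => hqS (hFS h)
  have hpF : p ∈ F → p = x := fun h => by
    by_contra hpx; exact hqF (hout p h hpx hpy q hq hpq)
  obtain ⟨u, q', hq', hqS', hne, huX, hNp, hZ', k, hk, e1, e2⟩ :=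
    hZ.step hG hK hX hinv hp hq hqS hpq
  have hqF' : q' ∉ F := fun h => hqS' (hFS h)
  have hpq' : G.Adj p q' := by rw [← mem_nb, hNp]; simp
  have hky : k y = y := hk.2 y (hFS hy)
  have hyq : G.Adj y q ∧ G.Adj y q' := by
    have hiff : G.Adj y q ↔ G.Adj y q' := by
      rw [← (hK hk.1 y q), hky, e1]
    by_contra hcon
    have hq1 : ¬ G.Adj y q := fun h => hcon ⟨h, hiff.1 h⟩
    have := hmax (S ∪ {q, q'}) ⟨hZ', hFS.trans subset_union_left, ?_, ?_⟩
    · have h2 : S ⊂ S ∪ {q, q'} := (ssubset_iff_of_subset subset_union_left).2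
        ⟨q, by simp, hqS⟩
      exact absurd (card_lt_card h2) (by lia)
    · intro a ha haF
      simp only [mem_union, mem_insert, mem_singleton] at ha
      rcases ha with ha | rfl | rfl
      · exact hyS a ha haF
      · exact hq1
      · exact fun h => hq1 (hiff.2 h)
    · right
      rcases hgrow with h | ⟨a, ha, haF, hxa⟩
      · have hpx : p = x := hpF (h ▸ hp)
        exact ⟨q, by simp, hqF, hpx ▸ hpq⟩
      · exact ⟨a, mem_union_left _ ha, haF, hxa⟩
  have adj_of : ∀ {v a b c : V}, nb G v = {a, b, c} → ∀ z, G.Adj v z → z = a ∨ z = b ∨ z = c := by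
    intro v a b c h z hz
    rw [← mem_nb, h] at hz; simpa using hz
  obtain ⟨u₁, q₁, hq₁, hqF₁, hne₁, hu₁, hNy, hR, k₁, hk₁, -, -⟩ :=
    hF.step hG hK hX hinv hy hq hqF hyq.1
  have : q' = q₁ := by
    rcases adj_of hNy q' hyq.2 with h | h | h
    · exact absurd (hu₁ (h ▸ hq')) (h ▸ hqF')
    · exact absurd h hne
    · exact h
  subst this
  by_cases hpx : p = x
  · subst hpx
    obtain ⟨u₀, q₂, hq₂, hqF₂, hne₂, hu₀, hNx, -, -⟩ := hF.step hG hK hX hinv hx hq hqF hpq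
    have : q' = q₂ := by
      rcases adj_of hNx q' hpq' with h | h | h
      · exact absurd (hu₀ (h ▸ hq')) (h ▸ hqF')
      · exact absurd h hne
      · exact h
    subst this
    right; left
    have hnoexit : ∀ z, z = q ∨ z = q' → ∀ b ∈ X, b ∉ F ∪ {q, q'} → ¬ G.Adj z b := by
      intro z hz b hb hbR hzb
      obtain ⟨u', b', -, hb', -, -, hNz, -, -⟩ := hR.step hG hK hX hinv (p := z)
        (by simp only [mem_union, mem_insert, mem_singleton]; exact Or.inr hz) hb hbR hzb
      have hzp : G.Adj z p := by
        rcases hz with rfl | rfl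
        · exact hpq.symm
        · exact hpq'.symm
      have hzy : G.Adj z y := by
        rcases hz with rfl | rfl
        · exact hyq.1.symm
        · exact hyq.2.symm
      have mem : ∀ w ∈ F, G.Adj z w → w = u' := by
        intro w hw hzw
        rcases adj_of hNz w hzw with h | h | h
        · exact h
        · exact absurd (mem_union_left _ hw) (h ▸ hbR)
        · exact absurd (mem_union_left _ hw) (h ▸ hb')
      exact hxy ((mem p hx hzp).trans (mem y hy hzy).symm)
    have hXR : F ∪ {q, q'} = X := by
      by_contra hXR
      obtain ⟨a, ha, b, hb, hbR, hab⟩ := hX _ hR.sub ⟨p, mem_union_left _ hx⟩ hXR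
      have hbF : b ∉ F := fun h => hbR (mem_union_left _ h)
      simp only [mem_union, mem_insert, mem_singleton] at ha
      rcases ha with ha | ha
      · have : ∀ {w u : V}, nb G w = {u, q, q'} → (u ∈ X → u ∈ F) → ¬ G.Adj w b := by
          intro w u hw hu hwb
          rcases adj_of hw b hwb with h | h | h
          · exact hbF (h ▸ hu (h ▸ hb))
          · exact hbR (by simp [h])
          · exact hbR (by simp [h])
        by_cases hap : a = p
        · subst hap; exact this hNx hu₀ hab
        · by_cases hay : a = y
          · subst hay; exact this hNy hu₁ hab
          · exact hbF (hout a ha hap hay b hb hab)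
      · exact hnoexit a ha b hb hbR hab
    refine ⟨?_, q, hq, q', hq', hqF, hqF', hne.symm, hpq, hpq'⟩
    rw [← hXR, card_union_of_disjoint, card_pair hne.symm]
    rw [disjoint_right]; intro z; simp only [mem_insert, mem_singleton]
    rintro (rfl | rfl) <;> assumption
  · have hpF' : p ∉ F := fun h => hpx (hpF h)
    have hpX : p ∈ X := hZ.sub hp
    have hpq_ne : p ≠ q := hpq.ne
    have hpq_ne' : p ≠ q' := hpq'.ne
    have hpR : p ∉ F ∪ {q, q'} := by simp [hpF', hpq_ne, hpq_ne']
    obtain ⟨u₂, m, hm, hmR, hmp, hu₂, hNq, hR₂, k₂, hk₂, f1, f2⟩ :=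
      hR.step hG hK hX hinv (p := q) (by simp) hpX hpR hpq.symm
    have hk₂q' : k₂ q' = q' := hk₂.2 q' (by simp)
    have hk₂q : k₂ q = q := hk₂.2 q (by simp)
    have hmF : m ∉ F := fun h => hmR (mem_union_left _ h)
    have hmq : m ≠ q := fun h => hmR (by simp [h])
    have hmq' : m ≠ q' := fun h => hmR (by simp [h])
    have hqm : G.Adj q m := by rw [← mem_nb, hNq]; simp
    have hqm' : G.Adj q' m := by
      rw [← f1, ← hk₂q']; exact (hK hk₂.1 _ _).2 hpq'.symm
    have hypne : y ≠ p := hpy.symm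
    have hymne : y ≠ m := fun h => hmF (h ▸ hy)
    have hNq' : nb G q = {y, p, m} := card_three (hG.deg q) (by simpa using hyq.1.symm)
      (by simpa using hpq.symm) (by simpa) hypne hymne hmp.symm
    have hNq'' : nb G q' = {y, p, m} := card_three (hG.deg q') (by simpa using hyq.2.symm)
      (by simpa using hpq'.symm) (by simpa) hypne hymne hmp.symm
    set R₂ := F ∪ {q, q'} ∪ {p, m} with hR₂def
    have memR₂ : ∀ z, z ∈ R₂ ↔ z ∈ F ∨ z = q ∨ z = q' ∨ z = p ∨ z = m := by
      intro z; simp only [hR₂def, mem_union, mem_insert, mem_singleton, or_assoc]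
    have hpmexit : ∀ z, z = p ∨ z = m → ∀ b ∈ X, b ∉ R₂ → ¬ G.Adj z b := by
      intro z hz b hb hbR hzb
      obtain ⟨u', b', -, hb', -, -, hNz, -, -⟩ := hR₂.step hG hK hX hinv (p := z)
        ((memR₂ z).2 (Or.inr (Or.inr (Or.inr hz)))) hb hbR hzb
      have hzq : G.Adj z q := by
        rcases hz with rfl | rfl
        · exact hpq
        · exact hqm.symm
      have hzq' : G.Adj z q' := by
        rcases hz with rfl | rfl
        · exact hpq'
        · exact hqm'.symm
      have mem : ∀ w ∈ R₂, G.Adj z w → w = u' := by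
        intro w hw hzw
        rcases adj_of hNz w hzw with h | h | h
        · exact h
        · exact absurd hw (h ▸ hbR)
        · exact absurd hw (h ▸ hb')
      exact hne ((mem q' ((memR₂ _).2 (Or.inr (Or.inr (Or.inl rfl)))) hzq').trans (mem q ((memR₂ _).2 (Or.inr (Or.inl rfl))) hzq).symm)
    have hqexit : ∀ z, z = q ∨ z = q' → ∀ b, G.Adj z b → b = y ∨ b = p ∨ b = m := by
      rintro z (rfl | rfl) b hb
      · exact adj_of hNq' b hb
      · exact adj_of hNq'' b hb
    have hyexit : ∀ b ∈ X, G.Adj y b → b ∈ F ∨ b = q ∨ b = q' := by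
      intro b hb hyb
      rcases adj_of hNy b hyb with h | h | h
      · exact Or.inl (h ▸ hu₁ (h ▸ hb))
      · exact Or.inr (Or.inl h)
      · exact Or.inr (Or.inr h)
    have hk₂x : k₂ x = x := hk₂.2 x (mem_union_left _ hx)
    have hxpm : G.Adj x p ↔ G.Adj x m := by
      rw [← hK hk₂.1 x p, hk₂x, f1]
    by_cases hxp : G.Adj x p
    · obtain ⟨u₀, m', hm', hmF', hmp', hu₀, hNx, -, -⟩ := hF.step hG hK hX hinv hx hpX hpF' hxp
      have : m = m' := by
        rcases adj_of hNx m (hxpm.1 hxp) with h | h | h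
        · exact absurd (hu₀ (h ▸ hm)) (h ▸ hmF)
        · exact absurd h hmp
        · exact h
      subst this
      right; right
      have hXR : R₂ = X := by
        by_contra hXR
        obtain ⟨a, ha, b, hb, hbR, hab⟩ := hX _ hR₂.sub ⟨x, (memR₂ x).2 (Or.inl hx)⟩ hXR
        have hbR' := hbR
        rw [memR₂] at ha hbR'
        push Not at hbR'
        rcases ha with ha | ha
        · by_cases hax : a = x
          · subst hax
            rcases adj_of hNx b hab with h | h | h
            · exact hbR'.1 (h ▸ hu₀ (h ▸ hb))
            · exact hbR'.2.2.2.1 h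
            · exact hbR'.2.2.2.2 h
          · by_cases hay : a = y
            · subst hay
              rcases hyexit b hb hab with h | h | h
              · exact hbR'.1 h
              · exact hbR'.2.1 h
              · exact hbR'.2.2.1 h
            · exact hbR'.1 (hout a ha hax hay b hb hab)
        · rcases ha with ha | ha | ha
          · have := hqexit a (Or.inl ha) b hab
            rcases this with h | h | h
            · exact hbR'.1 (h ▸ hy)
            · exact hbR'.2.2.2.1 h
            · exact hbR'.2.2.2.2 h
          · have := hqexit a (Or.inr ha) b hab
            rcases this with h | h | h
            · exact hbR'.1 (h ▸ hy)
            · exact hbR'.2.2.2.1 h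
            · exact hbR'.2.2.2.2 h
          · exact hpmexit a ha b hb hbR hab
      constructor
      · have hd1 : Disjoint F {q, q'} := by
          rw [disjoint_right]; intro z; simp only [mem_insert, mem_singleton]
          rintro (rfl | rfl) <;> assumption
        have hd2 : Disjoint (F ∪ {q, q'}) {p, m} := by
          rw [disjoint_right]; intro z; simp only [mem_insert, mem_singleton]
          rintro (rfl | rfl) <;> assumption
        rw [← hXR, hR₂def, card_union_of_disjoint hd2, card_union_of_disjoint hd1,
          card_pair hne.symm, card_pair hmp.symm]
      · intro a ha haF
        rw [← hXR, memR₂] at ha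
        have hsub : ∀ {v a b c : V}, nb G v = {a, b, c} → a ∈ X → b ∈ X → c ∈ X → nb G v ⊆ X := by
          intro v a b c h h1 h2 h3
          rw [h]; intro z; simp only [mem_insert, mem_singleton]
          rintro (rfl | rfl | rfl) <;> assumption
        have hyX := hF.sub hy
        have hxX := hF.sub hx
        rcases ha with ha | rfl | rfl | rfl | rfl
        · exact absurd ha haF
        · exact hsub hNq' hyX hpX hm
        · exact hsub hNq'' hyX hpX hm
        · refine hsub (card_three (a := x) (b := q) (c := q') (hG.deg a) ?_ ?_ ?_ ?_ ?_ hne.symm) hxX hq hq'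
          · simpa using hxp.symm
          · simpa
          · simpa
          · exact fun h => hqF (h ▸ hx)
          · exact fun h => hqF' (h ▸ hx)
        · refine hsub (card_three (a := x) (b := q) (c := q') (hG.deg a) ?_ ?_ ?_ ?_ ?_ hne.symm) hxX hq hq'
          · simpa using (hxpm.1 hxp).symm
          · simpa using hqm.symm
          · simpa using hqm'.symm
          · exact fun h => hqF (h ▸ hx)
          · exact fun h => hqF' (h ▸ hx)
    · left
      have hxm : ¬ G.Adj x m := fun h => hxp (hxpm.2 h)
      refine ⟨{y, q, q', p, m}, ?_, by simp, ?_, ?_⟩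
      · intro z; simp only [mem_insert, mem_singleton]
        rintro (rfl | rfl | rfl | rfl | rfl)
        · exact hF.sub hy
        all_goals assumption
      · intro z; simp only [mem_insert, mem_singleton]
        rintro (rfl | rfl | rfl | rfl | rfl) hz
        · rfl
        all_goals contradiction
      · intro a ha b hb hbD hab
        simp only [mem_insert, mem_singleton] at ha hbD
        push Not at hbD
        have not_inner : ¬ (b = y ∨ b = p ∨ b = m) := by
          rintro (h | h | h)
          · exact hbD.1 h
          · exact hbD.2.2.2.1 h
          · exact hbD.2.2.2.2 h
        rcases ha with rfl | ha | ha | ha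
        · rcases hyexit b hb hab with h | h | h
          · exact ⟨rfl, h⟩
          · exact absurd h hbD.2.1
          · exact absurd h hbD.2.2.1
        · exact (not_inner (hqexit a (Or.inl ha) b hab)).elim
        · exact (not_inner (hqexit a (Or.inr ha) b hab)).elim
        · exfalso
          have hbR : b ∈ R₂ := by by_contra h; exact hpmexit a ha b hb h hab
          rw [memR₂] at hbR
          have hbF : b ∈ F := by
            rcases hbR with h | h | h | h | h
            · exact h
            · exact absurd h hbD.2.1
            · exact absurd h hbD.2.2.1
            · exact absurd h hbD.2.2.2.1
            · exact absurd h hbD.2.2.2.2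
          have haX : a ∈ X ∧ a ∉ F := by
            rcases ha with rfl | rfl
            · exact ⟨hpX, hpF'⟩
            · exact ⟨hm, hmF⟩
          by_cases hbx : b = x
          · subst hbx
            rcases ha with rfl | rfl
            · exact hxp hab.symm
            · exact hxm hab.symm
          · exact haX.2 (hout b hbF hbx hbD.1 a haX.1 hab.symm)

lemma adj_cases {v a b c z : V} (h : nb G v = {a, b, c}) (hz : G.Adj v z) :
    z = a ∨ z = b ∨ z = c := by
  rw [← mem_nb, h] at hz; simpa using hz

/-- The numbers `3 * 2 ^ k` and `4 * 2 ^ k`. -/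
def Perfect (h : ℕ) : Prop := ∃ k, h = 3 * 2 ^ k ∨ h = 4 * 2 ^ k

lemma Bits.congr {Y Z : Finset V} {t : ℕ} (h : Bits K Y t) (hYZ : Y ⊆ Z)
    (hf : ∀ z ∈ Z, z ∉ Y → Fixed K z) : Bits K Z t := by
  have : fx K Y = fx K Z := le_antisymm (fun σ hσ => ⟨hσ.1, fun z hz => by
    by_cases hzY : z ∈ Y
    · exact hσ.2 z hzY
    · exact hf z hz hzY σ hσ.1⟩) (fx_anti K hYZ)
  rwa [Bits, ← this]

lemma Side.disjoint_of_ne (hG : Cub G) {D D' : Finset V} {r x y : V} (h : Side G D r x)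
    (h' : Side G D' r y) (hxy : x ≠ y) : Disjoint D D' := by
  have hx : x ∉ D' := fun hx => hxy (h'.cut x hx r h'.not_mem h.adj.symm).1
  by_contra hd
  rw [not_disjoint_iff_nonempty_inter] at hd
  obtain ⟨a, ha, b, hb, hb', hab⟩ := h.conn hG (D ∩ D') inter_subset_left hd
    (fun e => hx (inter_eq_left.1 e h.mem))
  rw [mem_inter] at ha hb'
  have := h'.cut a ha.2 b (fun hbD => hb' ⟨hb, hbD⟩) hab
  exact h.not_mem (this.2 ▸ hb)

lemma tight_split (hG : Cub G) (hK : K ≤ aut G) {p r x y : V} (hT : Side G T p r)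
    (hr : Fixed K r) (hNr : nb G r = {p, x, y}) (hyT : y ∈ T) (hxy : x ≠ y)
    (hadj : ¬ G.Adj x y) {k : Equiv.Perm V} (hk : k ∈ K) (hkx : k x = y)
    (hF : Tight G K T {r, x, y}) {D : Finset V} (hD : Shut G T {r, x, y} x D) :
    (∃ t, Bits (fx K {r, x, y}) D t ∧ 2 * t + 1 = D.card) ∧ T.card = 2 * D.card + 1 ∧
      Side G D r x := by
  obtain ⟨hDT, hxD, hDF, hcut⟩ := hD
  have hrx : G.Adj r x := by rw [← mem_nb, hNr]; simp
  have hrD : r ∉ D := fun h => hrx.ne (hDF r h (by simp))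
  have hDs : Side G D r x := ⟨hxD, hrD, hrx, fun a ha b hb hab => by
    by_cases hbT : b ∈ T
    · obtain ⟨e, hbF⟩ := hcut a ha b hbT hb hab
      refine ⟨e, ?_⟩
      simp only [mem_insert, mem_singleton] at hbF
      rcases hbF with h | h | h
      · exact h
      · exact absurd hxD (h ▸ hb)
      · exact absurd (h ▸ e ▸ hab) hadj
    · exact absurd ha ((hT.cut a (hDT ha) b hbT hab).1 ▸ hrD)⟩
  have hDs' : Side G (D.map k.toEmbedding) r y := by
    have := hDs.map (hK hk)
    rwa [hr k hk, hkx] at this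
  have hcard : (D.map k.toEmbedding).card = D.card := card_map _
  set D' := D.map k.toEmbedding
  have hdis := hDs.disjoint_of_ne hG hDs' hxy
  have hT' : insert r (D ∪ D') = T := by
    have hsub : insert r (D ∪ D') ⊆ T := by
      intro z hz
      rw [mem_insert, mem_union] at hz
      rcases hz with rfl | hz | hz
      · exact hT.mem
      · exact hDT hz
      · by_contra hzT
        have hconn := hDs'.conn hG
        obtain ⟨a, ha, b, hb, hb', hab⟩ := hconn (D'.filter (· ∈ T)) (filter_subset _ _)
          ⟨y, mem_filter.2 ⟨hDs'.mem, hyT⟩⟩ (fun e => by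
            rw [← e, mem_filter] at hz; exact hzT hz.2)
        rw [mem_filter] at ha hb'
        have := hT.cut a ha.2 b (fun h => hb' ⟨hb, h⟩) hab
        exact hDs'.not_mem (this.1 ▸ ha.1)
    by_contra hne
    obtain ⟨a, ha, b, hb, hb', hab⟩ := hT.conn hG _ hsub ⟨r, mem_insert_self _ _⟩ hne
    rw [mem_insert, mem_union] at ha hb'
    push Not at hb'
    rcases ha with rfl | ha | ha
    · rcases adj_cases hNr hab with h | h | h
      · exact hT.not_mem (h ▸ hb)
      · exact hb'.2.1 (h ▸ hxD)
      · exact hb'.2.2 (h ▸ hDs'.mem)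
    · exact hb'.1 (hDs.cut a ha b hb'.2.1 hab).2
    · exact hb'.1 (hDs'.cut a ha b hb'.2.2 hab).2
  have hTcard : T.card = 2 * D.card + 1 := by
    rw [← hT', card_insert_of_notMem, card_union_of_disjoint hdis, hcard]
    · ring
    · rw [mem_union, not_or]; exact ⟨hrD, hDs'.not_mem⟩
  refine ⟨?_, hTcard, hDs⟩
  have hK₁ : fx K {r, x, y} ≤ aut G := (fx_le _ _).trans hK
  obtain ⟨t₁, ht₁, h2t₁⟩ := hDs.bits hG hK₁ (fixed_fx (by simp)) (fixed_fx (by simp))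
  obtain ⟨t₂, ht₂, h2t₂⟩ := hDs'.bits hG ((fx_le _ D).trans hK₁)
    ((fixed_fx (by simp)).mono (fx_le _ _)) ((fixed_fx (by simp)).mono (fx_le _ _))
  have hbits := ht₁.trans ht₂
  obtain ⟨s, hs, h2s⟩ := hF.bits
  have h3 : Bits (fx K {r, x, y}) T (t₁ + t₂) := by
    refine hbits.congr (hT' ▸ subset_insert _ _) fun z hz hz' => ?_
    rw [← hT', mem_insert] at hz
    rcases hz with rfl | hz
    · exact fixed_fx (by simp)
    · exact absurd hz hz'
  have := hs.unique h3
  have h4 : (T \ {r, x, y}).card + 3 = T.card := by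
    rw [← card_sdiff_add_card_eq_card hF.sub]
    congr 1
    rw [card_eq_three.2 ⟨r, x, y, hrx.ne, ?_, hxy, rfl⟩]
    rintro rfl; exact hDs'.not_mem hDs'.mem
  exact ⟨t₁, ht₁, by lia⟩

lemma perfect_of_tight (hG : Cub G) {p r : V} (hK : K ≤ aut G) (hp : Fixed K p) (hr : Fixed K r)
    (hT : Side G T p r) (ht : ∃ t, Bits K T t ∧ 2 * t + 1 = T.card) :
    ∃ h, Perfect h ∧ T.card + 1 = 2 * h := by
  induction hn : T.card using Nat.strong_induction_on generalizing T K p r with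
  | _ n ih =>
  obtain ⟨t, ht, h2t⟩ := ht
  have hfx : fx K {r} = K := fx_eq_self fun k hk s hs => by rw [mem_singleton.1 hs]; exact hr k hk
  have hZ : Tight G K T {r} := by
    refine ⟨by simpa using hT.mem, ?_, t, by rwa [hfx], ?_⟩
    · intro s hs; rw [mem_singleton.1 hs, hfx]; exact hT.anch hp hr
    · rw [card_sdiff_of_subset (by simpa using hT.mem), card_singleton]; lia
  have hinv := hT.inv hG hK hp hr
  obtain ⟨x, hrx, hxp⟩ : ∃ x, G.Adj r x ∧ x ≠ p := by
    have : 1 < (nb G r).card := by rw [hG.deg]; norm_num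
    obtain ⟨x, hx, hxp⟩ := exists_mem_ne this p
    exact ⟨x, by simpa using hx, hxp⟩
  have hxT : x ∈ T := by
    by_contra h; exact hxp (hT.cut r hT.mem x h hrx).2
  obtain ⟨u, y, hyT, hyr, hyx, hu, hNr, hF, k, hk, hkx, hky⟩ :=
    hZ.step hG hK (hT.conn hG) hinv (mem_singleton_self r) hxT (by simpa using hrx.ne') hrx
  have hup : p = u := by
    rcases adj_cases hNr hT.adj.symm with h | h | h
    · exact h
    · exact absurd h.symm hxp
    · exact absurd hyT (h ▸ hT.not_mem)
  subst hup
  rw [singleton_union] at hF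
  have hyr' : y ≠ r := by simpa using hyr
  have hadj : ¬ G.Adj x y := by
    intro hxy
    obtain ⟨z, hz, hz'⟩ : ∃ z ∈ nb G x, z ∉ ({r, y} : Finset V) := by
      apply exists_mem_notMem_of_card_lt_card
      rw [hG.deg]; exact (card_le_two).trans_lt (by norm_num)
    simp only [mem_nb, mem_insert, mem_singleton, not_or] at hz hz'
    have hzT : z ∈ T := by
      by_contra h
      exact hrx.ne' (hT.cut x hxT z h hz).1
    have hzF : z ∉ ({r, x, y} : Finset V) := by
      simp only [mem_insert, mem_singleton, not_or]; exact ⟨hz'.1, hz.ne', hz'.2⟩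
    obtain ⟨u, z', hzT', hzF', -, hu, hNx, -, -⟩ := hF.step hG hK (hT.conn hG) hinv (p := x)
      (by simp) hzT hzF hz
    have h1 : ∀ w ∈ ({r, x, y} : Finset V), G.Adj x w → w = u := by
      intro w hw hxw
      rcases adj_cases hNx hxw with h | h | h
      · exact h
      · exact absurd hw (h ▸ hzF)
      · exact absurd hw (h ▸ hzF')
    exact hyr' ((h1 y (by simp) hxy).trans (h1 r (by simp) hrx.symm).symm)
  have hry : G.Adj r y := by rw [← mem_nb, hNr]; simp
  have hF3 : ({r, x, y} : Finset V).card = 3 :=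
    card_eq_three.2 ⟨r, x, y, hrx.ne, hry.ne, hyx.symm, rfl⟩
  have fin : ∀ {x y : V} {D : Finset V}, Side G D r x →
      (∃ t, Bits (fx K {r, x, y}) D t ∧ 2 * t + 1 = D.card) → T.card = 2 * D.card + 1 →
      ∃ h, Perfect h ∧ n + 1 = 2 * h := by
    intro x y D hD hb hc
    obtain ⟨h, ⟨j, hj⟩, hh⟩ := ih D.card (by lia) ((fx_le _ _).trans hK) (fixed_fx (by simp))
      (fixed_fx (by simp)) hD hb rfl
    refine ⟨2 * h, ⟨j + 1, ?_⟩, by lia⟩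
    rw [pow_succ]; lia
  rcases closing hG hK (hT.conn hG) hinv hF (x := x) (y := y) (by simp) (by simp) hyx.symm (by
      intro f hf hfx hfy q hq hfq
      simp only [mem_insert, mem_singleton] at hf
      have : f = r := by tauto
      subst this
      rcases adj_cases hNr hfq with h | h | h
      · exact absurd hq (h ▸ hT.not_mem)
      · simp [h]
      · simp [h]) with ⟨D, hD⟩ | ⟨D, hD⟩ | ⟨h, -⟩ | ⟨h, -⟩
  · obtain ⟨h1, h2, h3⟩ := tight_split hG hK hT hr hNr hyT hyx.symm hadj hk.1 hkx hF hD
    exact fin h3 h1 h2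
  · have e : ({r, x, y} : Finset V) = {r, y, x} := by rw [pair_comm]
    rw [e] at hF hD
    obtain ⟨h1, h2, h3⟩ := tight_split hG hK hT hr (by rw [hNr, pair_comm]) hxT hyx
      (fun h => hadj h.symm) hk.1 hky hF hD
    exact fin h3 h1 h2
  · exact ⟨3, ⟨0, by norm_num⟩, by lia⟩
  · exact ⟨4, ⟨0, by norm_num⟩, by lia⟩

lemma Side.bits_imperfect (hG : Cub G) {p r : V} (h : Side G T p r) (hK : K ≤ aut G)
    (hp : Fixed K p) (hr : Fixed K r) {n : ℕ} (hn : T.card + 1 = 2 * n) (himp : ¬ Perfect n) :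
    ∃ t, Bits K T t ∧ 2 * t + 3 ≤ T.card := by
  obtain ⟨t, ht, h2t⟩ := h.bits hG hK hp hr
  refine ⟨t, ht, ?_⟩
  by_contra hcon
  obtain ⟨n', hn', e⟩ := perfect_of_tight hG hK hp hr h ⟨t, ht, by lia⟩
  exact himp (by rwa [show n = n' by lia])

lemma card_nb_inter {k : Equiv.Perm V} (hk : k ∈ K) (hK : K ≤ aut G) (hY : Inv K Y) (x : V) :
    (nb G (k x) ∩ Y).card = (nb G x ∩ Y).card := by
  rw [← card_map (k.toEmbedding) (s := nb G x ∩ Y), map_inter, ← map_nb (hK hk)]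
  congr 2
  ext y; rw [mem_map]; constructor
  · intro hy; exact ⟨k⁻¹ y, hY _ (K.inv_mem hk) y hy, by simp⟩
  · rintro ⟨z, hz, rfl⟩; exact hY k hk z hz

lemma card_nb_inter_of_mem (hK : K ≤ aut G) (hY : Inv K Y) {x x' : V} (hx : x' ∈ orb K x) :
    (nb G x' ∩ Y).card = (nb G x ∩ Y).card := by
  obtain ⟨k, hk, rfl⟩ := mem_orb.1 hx
  exact card_nb_inter hk hK hY x

lemma orb_double_count (hK : K ≤ aut G) (x y : V) :
    (orb K x).card * (nb G x ∩ orb K y).card = (orb K y).card * (nb G y ∩ orb K x).card := by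
  refine card_mul_eq_card_mul G.Adj (fun a ha => ?_) (fun b hb => ?_)
  · rw [← card_nb_inter_of_mem hK (inv_orb K y) ha]
    congr 1; ext z; simp [bipartiteAbove, and_comm]
  · rw [← card_nb_inter_of_mem hK (inv_orb K x) hb]
    congr 1; ext z; simp [bipartiteBelow, and_comm, G.adj_comm]

lemma exists_nb_of_orb (hK : K ≤ aut G) {x y y' : V} (hxy : G.Adj x y) (hy' : y' ∈ orb K y) :
    ∃ x' ∈ orb K x, G.Adj x' y' := by
  obtain ⟨k, hk, rfl⟩ := mem_orb.1 hy'
  exact ⟨k x, mem_orb.2 ⟨k, hk, rfl⟩, (hK hk _ _).2 hxy⟩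

lemma fixed_of_unique_nb (hK : K ≤ aut G) {x y : V} (hY : Inv K Y) (hx : Fixed K x)
    (hxy : G.Adj x y) (hy : y ∈ Y) (h1 : (nb G x ∩ Y).card = 1) : Fixed K y := fun k hk =>
  card_le_one.1 h1.le _ (mem_inter.2 ⟨inv_nb hK hx k hk y (by simpa), hY k hk y hy⟩) _
    (mem_inter.2 ⟨by simpa, hy⟩)

/-- No two distinct vertices have two common neighbours. -/
def NoC4 (G : SimpleGraph V) : Prop :=
  ∀ a c, a ≠ c → ∀ b d, G.Adj a b → G.Adj c b → G.Adj a d → G.Adj c d → b = d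

lemma swap_of_two (hK : K ≤ aut G) {x y : V} (hY : Inv K Y) (hx : Fixed K x)
    (hxy : G.Adj x y) (hy : y ∈ Y) (h2 : (nb G x ∩ Y).card = 2) (hm : ¬ Fixed K y) :
    ∃ y' ∈ Y, y' ≠ y ∧ nb G x ∩ Y = {y, y'} ∧ orb K y = {y, y'} ∧ Fixed (fx K {y}) y' ∧
      ∃ k ∈ K, k y = y' ∧ k y' = y := by
  obtain ⟨k, hk, hne⟩ : ∃ h ∈ K, h y ≠ y := by simpa [Fixed] using hm
  have hmem : ∀ l ∈ K, ∀ w ∈ nb G x ∩ Y, l w ∈ nb G x ∩ Y := by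
    intro l hl w hw; rw [mem_inter] at *
    exact ⟨inv_nb hK hx l hl w hw.1, hY l hl w hw.2⟩
  have hyN : y ∈ nb G x ∩ Y := mem_inter.2 ⟨by simpa, hy⟩
  have hN : nb G x ∩ Y = {y, k y} := by
    symm; apply eq_of_subset_of_card_le
    · intro w; rw [mem_insert, mem_singleton]; rintro (rfl | rfl)
      · exact hyN
      · exact hmem k hk y hyN
    · rw [h2, card_pair hne.symm]
  have hc : ∀ l ∈ K, ∀ w ∈ ({y, k y} : Finset V), l w = y ∨ l w = k y := by
    intro l hl w hw
    rw [← hN] at hw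
    have := hmem l hl w hw
    rw [hN] at this; simpa using this
  refine ⟨k y, hY k hk y hy, hne, hN, ?_, ?_, k, hk, rfl, ?_⟩
  · ext w; rw [mem_orb]; constructor
    · rintro ⟨l, hl, rfl⟩; simpa using hc l hl y (by simp)
    · rw [mem_insert, mem_singleton]; rintro (rfl | rfl)
      · exact ⟨1, K.one_mem, rfl⟩
      · exact ⟨k, hk, rfl⟩
  · intro l hl
    rcases hc l hl.1 (k y) (by simp) with h | h
    · exact absurd (l.injective (h.trans (hl.2 y (by simp)).symm)) hne
    · exact h
  · rcases hc k hk (k y) (by simp) with h | h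
    · exact h
    · exact absurd (k.injective h) hne

lemma layer_bits (hK : K ≤ aut G) {x y : V} (hHK : H ≤ K) (hX : ∀ x' ∈ orb K x, Fixed H x')
    (hxy : G.Adj x y) (h2 : (nb G x ∩ orb K y).card = 2) :
    ∃ c, Bits H (orb K y) c ∧ 2 * c ≤ (orb K y).card := by
  have hY := inv_orb K y
  obtain ⟨c, hc, hc2⟩ := explore H (orb K y) (fun _ => 1) 2 fun L hL ⟨w, hw, hwf⟩ => by
    obtain ⟨x', hx', hxw⟩ := exists_nb_of_orb hK hxy hw
    obtain ⟨w', hw', hne, -, ho, hf, k, hk, e1, e2⟩ := swap_of_two ((hL.trans hHK).trans hK)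
      (hY.mono (hL.trans hHK)) ((hX x' hx').mono hL) hxw hw
      (by rw [card_nb_inter_of_mem hK hY hx', h2]) hwf
    refine ⟨w, hw, hwf, by rw [ho, card_pair hne.symm], ?_⟩
    have := card_add_sum_le (μ := fun _ => 1) (D := {w, w'}) (fx_le L {w})
      (Y := orb K y)
      (by intro z; simp only [mem_insert, mem_singleton]; rintro (rfl | rfl) <;> assumption)
      (by
        intro z; simp only [mem_insert, mem_singleton]; rintro (rfl | rfl)
        · exact hwf
        · exact not_fixed_of_swap hk e2 hne.symm)
      (by
        intro z; simp only [mem_insert, mem_singleton]; rintro (rfl | rfl)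
        · exact fixed_fx (mem_singleton_self z)
        · exact hf)
    rwa [sum_const, card_pair hne.symm] at this
  refine ⟨c, hc, hc2.trans ?_⟩
  rw [sum_const, smul_eq_mul, mul_one]
  exact card_le_card (filter_subset _ _)

lemma layer_fixed_one (hK : K ≤ aut G) {x y : V} (hHK : H ≤ K) (hX : ∀ x' ∈ orb K x, Fixed H x')
    (hxy : G.Adj x y) (h1 : (nb G x ∩ orb K y).card = 1) : ∀ y' ∈ orb K y, Fixed H y' := by
  intro w hw
  obtain ⟨x', hx', hxw⟩ := exists_nb_of_orb hK hxy hw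
  exact fixed_of_unique_nb (hHK.trans hK) ((inv_orb K y).mono hHK) (hX x' hx') hxw hw
    (by rw [card_nb_inter_of_mem hK (inv_orb K y) hx', h1])

lemma layer_fixed_two (hG4 : NoC4 G) (hK : K ≤ aut G) {x y : V} (hHK : H ≤ K)
    (hX : ∀ x' ∈ orb K x, Fixed H x') (h2 : (nb G y ∩ orb K x).card = 2) :
    ∀ y' ∈ orb K y, Fixed H y' := by
  intro w hw
  have : (nb G w ∩ orb K x).card = 2 := by rw [card_nb_inter_of_mem hK (inv_orb K x) hw, h2]
  obtain ⟨a, c, hac, hN⟩ := card_eq_two.1 this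
  have ha : a ∈ nb G w ∩ orb K x := by rw [hN]; simp
  have hc : c ∈ nb G w ∩ orb K x := by rw [hN]; simp
  rw [mem_inter, mem_nb] at ha hc
  intro k hk
  have key : ∀ {z}, G.Adj w z → z ∈ orb K x → G.Adj z (k w) := by
    intro z hz hzX
    have := (hK (hHK hk) w z).2 hz
    rw [hX z hzX k hk] at this
    exact this.symm
  exact hG4 a c hac _ _ (key ha.1 ha.2) (key hc.1 hc.2) ha.1.symm hc.1.symm

lemma layer_bits_four (hG4 : NoC4 G) (hK : K ≤ aut G) {x y z : V} (hHK : H ≤ K)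
    (hX : ∀ x' ∈ orb K x, Fixed H x')
    (hxy : G.Adj x y) (h2 : (nb G x ∩ orb K y).card = 2) (hyz : G.Adj y z)
    (hxz : Disjoint (orb K x) (orb K z))
    (h1 : (nb G y ∩ orb K z).card = 1) (h2' : (nb G z ∩ orb K y).card = 2) :
    ∃ c, Bits H (orb K y) c ∧ 4 * c ≤ (orb K y).card := by
  have hY := inv_orb K y
  have hZ := inv_orb K z
  have uniq : ∀ {v w w' : V}, v ∈ orb K y → w ∈ orb K z → w' ∈ orb K z → G.Adj v w →
      G.Adj v w' → w = w' := by
    intro v w w' hv hw hw' h h'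
    have := card_nb_inter_of_mem hK hZ hv
    rw [h1] at this
    exact card_le_one.1 this.le _ (mem_inter.2 ⟨by simpa, hw⟩) _ (mem_inter.2 ⟨by simpa, hw'⟩)
  have other : ∀ {v : V}, v ∈ orb K y → ∃ w ∈ orb K z, G.Adj v w ∧ ∃ v' ∈ orb K y, v' ≠ v ∧
      G.Adj v' w ∧ ∀ u ∈ orb K y, G.Adj u w → u = v ∨ u = v' := by
    intro v hv
    obtain ⟨w, hw, hwv⟩ := exists_nb_of_orb hK hyz.symm hv
    have hc : (nb G w ∩ orb K y).card = 2 := by rw [card_nb_inter_of_mem hK hY hw, h2']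
    have hvm : v ∈ nb G w ∩ orb K y := mem_inter.2 ⟨by simpa, hv⟩
    obtain ⟨v', hv'⟩ := card_eq_one.1 (show ((nb G w ∩ orb K y).erase v).card = 1 by
      rw [card_erase_of_mem hvm, hc])
    have hv'm : v' ∈ (nb G w ∩ orb K y).erase v := by rw [hv']; simp
    rw [mem_erase, mem_inter, mem_nb] at hv'm
    refine ⟨w, hw, hwv.symm, v', hv'm.2.2, hv'm.1, hv'm.2.1.symm, fun u hu huw => ?_⟩
    by_cases huv : u = v
    · exact Or.inl huv
    · right
      have : u ∈ (nb G w ∩ orb K y).erase v :=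
        mem_erase.2 ⟨huv, mem_inter.2 ⟨by simpa using huw.symm, hu⟩⟩
      rw [hv'] at this; simpa using this
  obtain ⟨c, hc, hc2⟩ := explore H (orb K y) (fun _ => 1) 4 fun L hL ⟨w, hw, hwf⟩ => by
    obtain ⟨x', hx', hxw⟩ := exists_nb_of_orb hK hxy hw
    have hLK := hL.trans hHK
    obtain ⟨w', hw', hne, hN, ho, hf, k, hk, e1, e2⟩ := swap_of_two (hLK.trans hK)
      (hY.mono hLK) ((hX x' hx').mono hL) hxw hw
      (by rw [card_nb_inter_of_mem hK hY hx', h2]) hwf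
    have hxw' : G.Adj x' w' := by
      have : w' ∈ nb G x' ∩ orb K y := by rw [hN]; simp
      simpa using (mem_inter.1 this).1
    refine ⟨w, hw, hwf, by rw [ho, card_pair hne.symm], ?_⟩
    obtain ⟨s, hs, hws, v, hv, hvw, hvs, hsu⟩ := other hw
    obtain ⟨s', hs', hws', v', hv', hvw', hvs', hsu'⟩ := other hw'
    have hss : s ≠ s' := by
      rintro rfl
      have hxs : x' ≠ s := fun h => disjoint_left.1 hxz hx' (h ▸ hs)
      exact hne (hG4 x' s hxs _ _ hxw' hws'.symm hxw hws.symm)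
    have hvw2 : v ≠ w' := fun h => hss (uniq hv hs hs' hvs (h ▸ hws'))
    have hvw3 : v' ≠ w := fun h => hss (uniq hw hs hs' hws (h ▸ hvs'))
    have hvv : v ≠ v' := fun h => hss (uniq hv hs hs' hvs (h ▸ hvs'))
    have fixz : ∀ {u t t' : V}, u ∈ orb K y → t ∈ orb K z → G.Adj u t → t' ∈ orb K y →
        u ≠ t' → G.Adj t' t → (∀ r ∈ orb K y, G.Adj r t → r = u ∨ r = t') →
        ∀ l ∈ K, l u = u → l t' = t' := by
      intro u t t' hu ht hut ht' hne htt hall l hl hlu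
      have hlt : l t = t := by
        refine uniq hu (hZ l hl t ht) ht ?_ hut
        have := (hK hl u t).2 hut
        rwa [hlu] at this
      have := (hK hl t' t).2 htt
      rw [hlt] at this
      rcases hall _ (hY l hl t' ht') this with h | h
      · exact absurd (l.injective (hlu.trans h.symm)) hne
      · exact h
    have hkv : k v = v' := by
      have hks : k s = s' := by
        refine uniq hw' (hZ k (hLK hk) s hs) hs' ?_ hws'
        have := (hK (hLK hk) w s).2 hws
        rwa [e1] at this
      have := (hK (hLK hk) v s).2 hvs
      rw [hks] at this
      rcases hsu' _ (hY k (hLK hk) v hv) this with h | h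
      · exact absurd (k.injective (h.trans e1.symm)) hvw
      · exact h
    have hmv : ∀ u ∈ ({w, w', v, v'} : Finset V), ¬ Fixed L u := by
      intro u; simp only [mem_insert, mem_singleton]; rintro (rfl | rfl | rfl | rfl)
      · exact hwf
      · exact not_fixed_of_swap hk e2 hne.symm
      · exact not_fixed_of_swap hk hkv hvv.symm
      · intro hf'
        exact hvv (k.injective (hkv.trans (hf' k hk).symm))
    have := card_add_sum_le (μ := fun _ => 1) (D := {w, w', v, v'}) (fx_le L {w})
      (Y := orb K y)
      (by intro z; simp only [mem_insert, mem_singleton]; rintro (rfl | rfl | rfl | rfl) <;> assumption)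
      hmv
      (by
        intro u; simp only [mem_insert, mem_singleton]; rintro (rfl | rfl | rfl | rfl)
        · exact fixed_fx (mem_singleton_self _)
        · exact hf
        · intro l hl
          exact fixz hw hs hws hv hvw.symm hvs hsu l (hLK hl.1) (hl.2 w (mem_singleton_self _))
        · intro l hl
          exact fixz hw' hs' hws' hv' hvw'.symm hvs' hsu' l (hLK hl.1) (hf l hl))
    rw [sum_const, show ({w, w', v, v'} : Finset V).card = 4 from ?_] at this
    · exact this
    · rw [card_insert_of_notMem, card_insert_of_notMem, card_pair hvv]
      · simp only [mem_insert, mem_singleton, not_or]; exact ⟨hvw2.symm, hvw'.symm⟩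
      · simp only [mem_insert, mem_singleton, not_or]; exact ⟨hne.symm, hvw.symm, hvw3.symm⟩
  refine ⟨c, hc, hc2.trans ?_⟩
  rw [sum_const, smul_eq_mul, mul_one]
  exact card_le_card (filter_subset _ _)

lemma orb_disjoint {x y : V} (h : y ∉ orb K x) : Disjoint (orb K x) (orb K y) := by
  rw [disjoint_left]; intro z hz hz'
  exact h ((orb_eq_of_mem hz).symm.trans (orb_eq_of_mem hz') ▸ self_mem_orb K y)

/-- A sequence of adjacent vertices with disjoint `K`-orbits, both of whose ends are fixed by `K`
and have a neighbour outside the adjacent orbit. -/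
structure Ear (G : SimpleGraph V) (K : Subgroup (Equiv.Perm V)) (z : ℕ → V) (L : ℕ) : Prop where
  adj : ∀ i < L, G.Adj (z i) (z (i + 1))
  fixed_first : Fixed K (z 0)
  fixed_last : Fixed K (z L)
  disj : ∀ i j, i < j → j ≤ L → z j ∉ orb K (z i)
  first : 0 < L → ∃ s, G.Adj (z 0) s ∧ s ∉ orb K (z 1)
  last : 0 < L → ∃ s, G.Adj (z L) s ∧ s ∉ orb K (z (L - 1))

/-- The union of the orbits of the first vertices of a sequence. -/
def layers (K : Subgroup (Equiv.Perm V)) (z : ℕ → V) (i : ℕ) : Finset V :=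
  (range (i + 1)).biUnion fun j => orb K (z j)

lemma mem_layers {z : ℕ → V} {i : ℕ} {v : V} :
    v ∈ layers K z i ↔ ∃ j ≤ i, v ∈ orb K (z j) := by
  simp [layers]

lemma layers_zero (z : ℕ → V) : layers K z 0 = orb K (z 0) := by simp [layers]

lemma layers_succ (z : ℕ → V) (i : ℕ) : layers K z (i + 1) = layers K z i ∪ orb K (z (i + 1)) := by
  rw [layers, range_add_one, biUnion_insert, union_comm]; rfl

variable {z : ℕ → V} {L : ℕ}

lemma Ear.card_succ (h : Ear G K z L) {i : ℕ} (hi : i < L) :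
    (layers K z (i + 1)).card = (layers K z i).card + (orb K (z (i + 1))).card := by
  rw [layers_succ, card_union_of_disjoint]
  rw [disjoint_left]; intro v hv hv'
  obtain ⟨j, hj, hvj⟩ := mem_layers.1 hv
  exact disjoint_left.1 (orb_disjoint (h.disj j (i + 1) (by lia) hi)) hvj hv'

lemma card_nb_inter_le_two (hG : Cub G) {v s : V} (hs : G.Adj v s) (hsX : s ∉ X) :
    (nb G v ∩ X).card ≤ 2 := by
  have : nb G v ∩ X ⊂ nb G v := (ssubset_iff_of_subset inter_subset_left).2
    ⟨s, by simpa, fun h => hsX (mem_inter.1 h).2⟩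
  have := card_lt_card this
  rw [hG.deg] at this; lia

lemma card_nb_inter_add_le (hG : Cub G) (v : V) (h : Disjoint X Y) :
    (nb G v ∩ X).card + (nb G v ∩ Y).card ≤ 3 := by
  rw [← hG.deg v, ← card_union_of_disjoint (h.mono inter_subset_right inter_subset_right),
    ← inter_union_distrib_left]
  exact card_le_card inter_subset_left

lemma card_nb_inter_pos {v w : V} (h : G.Adj v w) (hw : w ∈ X) : 1 ≤ (nb G v ∩ X).card :=
  Finset.card_pos.2 ⟨w, mem_inter.2 ⟨by simpa, hw⟩⟩

lemma Ear.facts (hG : Cub G) (hK : K ≤ aut G) (h : Ear G K z L) :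
    ∃ f b a : ℕ → ℕ, (∀ i, a i = (orb K (z i)).card) ∧
      (∀ i, f i = (nb G (z i) ∩ orb K (z (i + 1))).card) ∧
      (∀ i, b i = (nb G (z (i + 1)) ∩ orb K (z i)).card) ∧
      (∀ i, a i * f i = a (i + 1) * b i) ∧ (∀ i < L, f i = 1 ∨ f i = 2) ∧
      (∀ i < L, b i = 1 ∨ b i = 2) ∧ ∀ i, i + 1 < L → b i + f (i + 1) ≤ 3 := by
  refine ⟨fun i => (nb G (z i) ∩ orb K (z (i + 1))).card,
    fun i => (nb G (z (i + 1)) ∩ orb K (z i)).card, fun i => (orb K (z i)).card,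
    fun _ => rfl, fun _ => rfl, fun _ => rfl, fun i => orb_double_count hK _ _, ?_, ?_, ?_⟩
  · intro i hi
    have h1 := card_nb_inter_pos (h.adj i hi) (self_mem_orb K (z (i + 1)))
    rcases i with _ | i
    · obtain ⟨s, hs, hs'⟩ := h.first hi
      have := card_nb_inter_le_two hG hs hs'
      simp only [zero_add] at *
      lia
    · have h2 := card_nb_inter_pos (h.adj i (by lia)).symm (self_mem_orb K (z i))
      have := card_nb_inter_add_le hG (z (i + 1)) (orb_disjoint (h.disj i (i + 1 + 1) (by lia) hi))
      lia
  · intro i hi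
    have h1 := card_nb_inter_pos (h.adj i hi).symm (self_mem_orb K (z i))
    rcases (show i + 1 ≤ L from hi).eq_or_lt with e | hi'
    · obtain ⟨s, hs, hs'⟩ := h.last (by lia)
      rw [← e] at hs hs'
      have := card_nb_inter_le_two hG hs hs'
      simp only [Nat.add_sub_cancel] at *
      lia
    · have h2 := card_nb_inter_pos (h.adj (i + 1) hi') (self_mem_orb K (z (i + 1 + 1)))
      have := card_nb_inter_add_le hG (z (i + 1)) (orb_disjoint (h.disj i (i + 1 + 1) (by lia) hi'))
      lia
  · intro i hi
    exact card_nb_inter_add_le hG (z (i + 1)) (orb_disjoint (h.disj i (i + 1 + 1) (by lia) hi))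

lemma fixed_fx_layers {i : ℕ} {x : V} (hx : x ∈ orb K (z i)) : Fixed (fx K (layers K z i)) x :=
  fixed_fx (mem_layers.2 ⟨i, le_rfl, hx⟩)

lemma Bits.succ_layers {i t c : ℕ} (h : Bits K (layers K z i) t)
    (h' : Bits (fx K (layers K z i)) (orb K (z (i + 1))) c) : Bits K (layers K z (i + 1)) (t + c) :=
  layers_succ (K := K) z i ▸ h.trans h'

lemma Ear.bits (hG : Cub G) (hK : K ≤ aut G) (h : Ear G K z L) :
    ∃ b, Bits K (layers K z L) b ∧ 8 * b + 2 ≤ 3 * (layers K z L).card := by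
  obtain ⟨f, b, a, ha, hf, hb, hab, hf12, hb12, hbf⟩ := h.facts hG hK
  have main : ∀ i ≤ L, ∃ t, Bits K (layers K z i) t ∧
      8 * t + 5 ≤ 3 * (layers K z i).card + 3 * a i ∧
      ((∀ j, i = j + 1 → b j = 1) → 8 * t + 5 ≤ 3 * (layers K z i).card + 2 * a i) := by
    intro i
    induction i with
    | zero =>
      intro _
      have h1 : a 0 = 1 := by rw [ha, orb_eq_singleton h.fixed_first]; simp
      have h2 : (layers K z 0).card = 1 := by rw [layers_zero, ← ha, h1]
      refine ⟨0, Bits.zero ?_, by lia, fun _ => by lia⟩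
      rw [layers_zero, orb_eq_singleton h.fixed_first]
      intro y hy; rw [mem_singleton.1 hy]; exact h.fixed_first
    | succ i ih =>
      intro hi
      obtain ⟨t, ht, h1, h2⟩ := ih (by lia)
      have hc := h.card_succ (i := i) (by lia)
      rw [← ha] at hc
      have e := hab i
      rcases hf12 i (by lia) with hfi | hfi
      · refine ⟨t + 0, ht.succ_layers (Bits.zero (layer_fixed_one hK (fx_le _ _)
          (fun x hx => fixed_fx_layers hx) (h.adj i (by lia)) (by rw [← hf, hfi]))), ?_, ?_⟩
        · rcases hb12 i (by lia) with hbi | hbi <;> rw [hfi, hbi] at e <;> lia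
        · intro hbi
          have hbi := hbi i rfl
          rw [hfi, hbi] at e; lia
      · obtain ⟨c, hc1, hc2⟩ := layer_bits hK (fx_le _ _)
          (fun x hx => fixed_fx_layers hx) (h.adj i (by lia)) (by rw [← hf, hfi])
        rw [← ha] at hc2
        have h2 := h2 (fun j hj => by
          subst hj
          have := hbf j (by lia)
          rcases hb12 j (by lia) with h | h <;> lia)
        refine ⟨t + c, ht.succ_layers hc1, ?_, ?_⟩
        · rcases hb12 i (by lia) with hbi | hbi <;> rw [hfi, hbi] at e <;> lia
        · intro hbi
          have hbi := hbi i rfl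
          rw [hfi, hbi] at e; lia
  obtain ⟨t, ht, h1, -⟩ := main L le_rfl
  have h3 : a L = 1 := by rw [ha, orb_eq_singleton h.fixed_last]; simp
  exact ⟨t, ht, by lia⟩

lemma Ear.bits_of_noC4 (hG : Cub G) (hG4 : NoC4 G) (hK : K ≤ aut G) (h : Ear G K z L) :
    ∃ b, Bits K (layers K z L) b ∧ 4 * b + 1 ≤ (layers K z L).card := by
  obtain ⟨f, b, a, ha, hf, hb, hab, hf12, hb12, hbf⟩ := h.facts hG hK
  have hL1 : a L = 1 := by rw [ha, orb_eq_singleton h.fixed_last]; simp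
  have main : ∀ i ≤ L, ∃ t, Bits K (layers K z i) t ∧
      4 * t + 2 ≤ (layers K z i).card + 2 * a i ∧
      (i = L ∨ (f i = 1 ∧ b i = 2) → 4 * t + 2 ≤ (layers K z i).card + a i) ∧
      ((∀ j, i = j + 1 → f j = 2 → b j = 2) → 4 * t + 2 ≤ (layers K z i).card + a i) := by
    intro i
    induction i with
    | zero =>
      intro _
      have h1 : a 0 = 1 := by rw [ha, orb_eq_singleton h.fixed_first]; simp
      have h2 : (layers K z 0).card = 1 := by rw [layers_zero, ← ha, h1]
      refine ⟨0, Bits.zero ?_, by lia, by lia, fun _ => by lia⟩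
      rw [layers_zero, orb_eq_singleton h.fixed_first]
      intro y hy; rw [mem_singleton.1 hy]; exact h.fixed_first
    | succ i ih =>
      intro hi
      obtain ⟨t, ht, h1, h2, h3⟩ := ih (by lia)
      have hc := h.card_succ (i := i) (by lia)
      rw [← ha] at hc
      have e := hab i
      rcases hf12 i (by lia) with hfi | hfi
      · have hbits := ht.succ_layers (Bits.zero (layer_fixed_one hK (fx_le _ _)
          (fun x hx => fixed_fx_layers hx) (h.adj i (by lia)) (by rw [← hf, hfi])))
        have hmain : 4 * t + 2 ≤ (layers K z (i + 1)).card + a (i + 1) := by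
          rcases hb12 i (by lia) with hbi | hbi
          · rw [hfi, hbi] at e; lia
          · have := h2 (Or.inr ⟨hfi, hbi⟩)
            rw [hfi, hbi] at e; lia
        exact ⟨t + 0, hbits, by lia, fun _ => by lia, fun _ => by lia⟩
      · rcases hb12 i (by lia) with hbi | hbi
        · by_cases hnext : i + 1 < L ∧ f (i + 1) = 1 ∧ b (i + 1) = 2
          · obtain ⟨c, hc1, hc2⟩ := layer_bits_four hG4 hK (fx_le _ _)
              (fun x hx => fixed_fx_layers hx) (h.adj i (by lia)) (by rw [← hf, hfi])
              (h.adj (i + 1) hnext.1) (orb_disjoint (h.disj i (i + 1 + 1) (by lia) hnext.1))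
              (by rw [← hf, hnext.2.1]) (by rw [← hb, hnext.2.2])
            rw [← ha] at hc2
            rw [hfi, hbi] at e
            exact ⟨t + c, ht.succ_layers hc1, by lia, fun _ => by lia, fun hh => by
              have := hh i rfl hfi; lia⟩
          · obtain ⟨c, hc1, hc2⟩ := layer_bits hK (fx_le _ _)
              (fun x hx => fixed_fx_layers hx) (h.adj i (by lia)) (by rw [← hf, hfi])
            rw [← ha] at hc2
            rw [hfi, hbi] at e
            refine ⟨t + c, ht.succ_layers hc1, by lia, fun hh => ?_, fun hh => ?_⟩
            · rcases hh with hh | hh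
              · rw [hh, hL1] at e; lia
              · by_cases hL : i + 1 = L
                · rw [hL, hL1] at e; lia
                · exact absurd ⟨by lia, hh⟩ hnext
            · have := hh i rfl hfi; lia
        · have hbits := ht.succ_layers (Bits.zero (layer_fixed_two hG4 hK (fx_le _ _)
            (fun x hx => fixed_fx_layers hx) (by rw [← hb, hbi])))
          rw [hfi, hbi] at e
          exact ⟨t + 0, hbits, by lia, fun _ => by lia, fun _ => by lia⟩
  obtain ⟨t, ht, -, h2, -⟩ := main L le_rfl
  have := h2 (Or.inl rfl)
  exact ⟨t, ht, by lia⟩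

lemma exists_seq {R : V → V → Prop} {u t : V} (h : Relation.ReflTransGen R u t) :
    ∃ (L : ℕ) (z : ℕ → V), z 0 = u ∧ z L = t ∧ ∀ i < L, R (z i) (z (i + 1)) := by
  induction h with
  | refl => exact ⟨0, fun _ => u, rfl, rfl, by simp⟩
  | @tail b c _ hbc ih =>
    obtain ⟨L, z, h0, hL, hz⟩ := ih
    refine ⟨L + 1, fun i => if i ≤ L then z i else c, by simpa, by simp, fun i hi => ?_⟩
    rcases (show i ≤ L by lia).eq_or_lt with rfl | hi'
    · simpa [hL]
    · simp only [hi'.le, show i + 1 ≤ L from hi', if_true]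
      exact hz i hi'

/-- A shortest sequence has disjoint orbits. -/
lemma exists_disjoint_seq {R : V → V → Prop} (hR : ∀ k ∈ K, ∀ a b, R a b → R (k a) (k b))
    {u : V} (hu : Fixed K u) {P : V → Prop} {t : V} (ht : P t) (h : Relation.ReflTransGen R u t) :
    ∃ (L : ℕ) (z : ℕ → V), z 0 = u ∧ P (z L) ∧ (∀ i < L, R (z i) (z (i + 1))) ∧
      ∀ i j, i < j → j ≤ L → z j ∉ orb K (z i) := by
  have hex : ∃ (L : ℕ) (z : ℕ → V), z 0 = u ∧ P (z L) ∧ ∀ i < L, R (z i) (z (i + 1)) := by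
    obtain ⟨L, z, h0, hL, hz⟩ := exists_seq h
    exact ⟨L, z, h0, hL ▸ ht, hz⟩
  obtain ⟨z, h0, hL, hz⟩ := Nat.find_spec hex
  have hmin : ∀ m < Nat.find hex, _ := fun m hm => Nat.find_min hex hm
  generalize Nat.find hex = L at *
  refine ⟨L, z, h0, hL, hz, fun i j hij hj hmem => ?_⟩
  obtain ⟨k, hk, e⟩ := mem_orb.1 hmem
  refine hmin (L - (j - i)) (by lia)
    ⟨fun m => if m ≤ i then k (z m) else z (m + (j - i)), ?_, ?_, fun m hm => ?_⟩
  · simp only [Nat.zero_le, if_true, h0, hu k hk]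
  · dsimp only
    split_ifs with hle
    · have : L - (j - i) = i := by lia
      rw [this, e, show j = L by lia]; exact hL
    · rw [show L - (j - i) + (j - i) = L by lia]; exact hL
  · dsimp only
    rcases lt_trichotomy m i with h | rfl | h
    · simp only [h.le, show m + 1 ≤ i from h, if_true]
      exact hR k hk _ _ (hz m (by lia))
    · simp only [le_rfl, if_true, show ¬ (m + 1 ≤ m) by lia, if_false, e]
      rw [show m + 1 + (j - m) = j + 1 by lia]
      exact hz j (by lia)
    · simp only [show ¬ m ≤ i by lia, show ¬ m + 1 ≤ i by lia, if_false]
      rw [show m + 1 + (j - i) = m + (j - i) + 1 by lia]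
      exact hz _ (by lia)

/-- Every vertex of `S` has at least two neighbours in `S`. -/
def Fat (G : SimpleGraph V) (S : Finset V) : Prop := ∀ s ∈ S, 2 ≤ (nb G s ∩ S).card

lemma two_le_nb {x a b : V} (ha : G.Adj x a) (hb : G.Adj x b) (haS : a ∈ S) (hbS : b ∈ S)
    (hab : a ≠ b) : 2 ≤ (nb G x ∩ S).card := by
  rw [← card_pair hab]
  apply card_le_card
  intro z; simp only [mem_insert, mem_singleton, mem_inter, mem_nb]
  rintro (rfl | rfl)
  exacts [⟨ha, haS⟩, ⟨hb, hbS⟩]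

lemma Ear.fat {z : ℕ → V} {L : ℕ} (h : Ear G K z L) (hK : K ≤ aut G) (hS : layers K z L ⊆ S)
    (h0 : 2 ≤ (nb G (z 0) ∩ S).card) (hL : 2 ≤ (nb G (z L) ∩ S).card) :
    ∀ x ∈ layers K z L, 2 ≤ (nb G x ∩ S).card := by
  intro x hx
  obtain ⟨j, hj, hxj⟩ := mem_layers.1 hx
  rcases Nat.eq_zero_or_pos j with rfl | hj0
  · rw [orb_eq_singleton h.fixed_first, mem_singleton] at hxj; rwa [hxj]
  rcases hj.eq_or_lt with rfl | hjL
  · rw [orb_eq_singleton h.fixed_last, mem_singleton] at hxj; rwa [hxj]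
  obtain ⟨i, rfl⟩ : ∃ i, j = i + 1 := ⟨j - 1, by lia⟩
  obtain ⟨a, ha, hax⟩ := exists_nb_of_orb hK (h.adj i (by lia)) hxj
  obtain ⟨b, hb, hbx⟩ := exists_nb_of_orb hK (h.adj (i + 1) (by lia)).symm hxj
  refine two_le_nb hax.symm hbx.symm (hS (mem_layers.2 ⟨i, by lia, ha⟩))
    (hS (mem_layers.2 ⟨i + 1 + 1, by lia, hb⟩)) ?_
  rintro rfl
  exact disjoint_left.1 (orb_disjoint (h.disj i (i + 1 + 1) (by lia) (by lia))) ha hb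

lemma layers_subset {z : ℕ → V} {L : ℕ} (hinv : Inv K X) (h : ∀ i ≤ L, z i ∈ X) :
    layers K z L ⊆ X := by
  intro x hx
  obtain ⟨j, hj, hxj⟩ := mem_layers.1 hx
  exact orb_subset hinv (h j hj) hxj

lemma fixed_of_fat (hG : Cub G) (hK : K ≤ aut G) (hfat : Fat G S) (hfix : ∀ s ∈ S, Fixed K s)
    {s t : V} (hs : s ∈ S) (ht : t ∉ S) (hst : G.Adj s t) : Fixed K t := by
  have hinv : Inv K Sᶜ := by
    rw [compl_eq_univ_sdiff]; exact (inv_univ K).sdiff (inv_of_fixed hfix)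
  refine fixed_of_unique_nb hK hinv (hfix s hs) hst (by simpa) ?_
  have := card_nb_inter_add_le hG s (disjoint_compl_right (a := S))
  have h1 := hfat s hs
  have := card_nb_inter_pos hst (mem_compl.2 ht)
  lia

/-- The relation of adjacency inside `X`. -/
def adjIn (G : SimpleGraph V) (X : Finset V) (a b : V) : Prop := G.Adj a b ∧ a ∈ X ∧ b ∈ X

lemma adjIn_map (hK : K ≤ aut G) (hX : Inv K X) :
    ∀ k ∈ K, ∀ a b, adjIn G X a b → adjIn G X (k a) (k b) :=
  fun k hk a b h => ⟨(hK hk a b).2 h.1, hX k hk a h.2.1, hX k hk b h.2.2⟩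

/-- Adding an ear to a fat set. -/
lemma exists_ear_step (hG : Cub G) (hn : 4 ∣ Fintype.card V) (hK : K ≤ aut G)
    (hSC : S ⊆ core G) (hfat : Fat G S) (hfix : ∀ s ∈ S, Fixed K s) {s u : V}
    (hs : s ∈ S) (hu : u ∈ core G) (huS : u ∉ S) (hsu : G.Adj s u) :
    ∃ z L, Ear G K z L ∧ layers K z L ⊆ core G \ S ∧ Fat G (S ∪ layers K z L) := by
  set X := core G \ S with hX
  have hinv : Inv K X := (inv_core.mono hK).sdiff (inv_of_fixed hfix)
  have huX : u ∈ X := mem_sdiff.2 ⟨hu, huS⟩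
  set D := univ.filter (Relation.ReflTransGen (adjIn G X) u) with hD
  have huD : u ∈ D := by simp [hD, Relation.ReflTransGen.refl]
  have hDX : D ⊆ X := by
    intro d hd
    rw [hD, mem_filter] at hd
    rcases Relation.ReflTransGen.cases_tail hd.2 with e | ⟨c, -, hc⟩
    · exact e ▸ huX
    · exact hc.2.2
  obtain ⟨t, htD, s', hs', hsC', hts, hne⟩ := exists_second_edge hG hn
    (hDX.trans sdiff_subset) huD (hSC hs) (fun h => (mem_sdiff.1 (hDX h)).2 hs) hsu.symm
  have hs'S : s' ∈ S := by
    by_contra hcon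
    refine hsC' ?_
    rw [hD, mem_filter] at htD ⊢
    exact ⟨mem_univ _, htD.2.tail ⟨hts, hDX (by simpa [hD] using htD.2), mem_sdiff.2 ⟨hs', hcon⟩⟩⟩
  obtain ⟨L, z, h0, ⟨hzL, s'', hs'', hzs, hne'⟩, hz, hdisj⟩ :=
    exists_disjoint_seq (K := K) (P := fun t => t ∈ X ∧ ∃ s' ∈ S, G.Adj t s' ∧ ¬ (t = u ∧ s' = s))
      (adjIn_map hK hinv) (fixed_of_fat hG hK hfat hfix hs huS hsu) ⟨hDX htD, s', hs'S, hts, hne⟩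
      (mem_filter.1 htD).2
  have hzX : ∀ i ≤ L, z i ∈ X := by
    intro i hi
    rcases hi.eq_or_lt with rfl | hi
    · exact hzL
    · exact (hz i hi).2.1
  have hS' : ∀ {s}, s ∈ S → ∀ i ≤ L, s ∉ orb K (z i) := fun hs i hi h =>
    (mem_sdiff.1 (orb_subset hinv (hzX i hi) h)).2 hs
  have hear : Ear G K z L :=
    { adj := fun i hi => (hz i hi).1
      fixed_first := h0 ▸ fixed_of_fat hG hK hfat hfix hs huS hsu
      fixed_last := fixed_of_fat hG hK hfat hfix hs'' (mem_sdiff.1 hzL).2 hzs.symm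
      disj := hdisj
      first := fun hL => ⟨s, h0 ▸ hsu.symm, hS' hs 1 hL⟩
      last := fun hL => ⟨s'', hzs, hS' hs'' _ (by lia)⟩ }
  have hlay := layers_subset hinv hzX
  have hmem : ∀ i ≤ L, z i ∈ S ∪ layers K z L := fun i hi =>
    mem_union_right _ (mem_layers.2 ⟨i, hi, self_mem_orb _ _⟩)
  refine ⟨z, L, hear, hlay, fun x hx => ?_⟩
  rcases mem_union.1 hx with hx | hx
  · exact (hfat x hx).trans (card_le_card (inter_subset_inter_left subset_union_left))
  refine hear.fat hK subset_union_right ?_ ?_ x hx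
  · rcases Nat.eq_zero_or_pos L with rfl | hL
    · refine two_le_nb (a := s) (b := s'') (h0 ▸ hsu.symm) hzs (mem_union_left _ hs)
        (mem_union_left _ hs'') ?_
      rintro rfl
      exact hne' ⟨h0, rfl⟩
    · refine two_le_nb (a := s) (b := z 1) (h0 ▸ hsu.symm) (hz 0 hL).1 (mem_union_left _ hs)
        (hmem _ hL) ?_
      rintro rfl
      exact (mem_sdiff.1 (hzX 1 hL)).2 hs
  · rcases Nat.eq_zero_or_pos L with rfl | hL
    · refine two_le_nb (a := s) (b := s'') (h0 ▸ hsu.symm) hzs (mem_union_left _ hs)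
        (mem_union_left _ hs'') ?_
      rintro rfl
      exact hne' ⟨h0, rfl⟩
    · obtain ⟨l, rfl⟩ : ∃ l, L = l + 1 := ⟨L - 1, by lia⟩
      refine two_le_nb (a := s'') (b := z l) hzs (hz l (by lia)).1.symm (mem_union_left _ hs'')
        (hmem _ (by lia)) ?_
      rintro rfl
      exact (mem_sdiff.1 (hzX l (by lia))).2 hs''

/-- A bound for the number of bits of an ear. -/
def EarRate (G : SimpleGraph V) (c e d : ℕ) : Prop :=
  ∀ K ≤ aut G, ∀ z L, Ear G K z L → ∃ b, Bits K (layers K z L) b ∧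
    c * b + e ≤ d * (layers K z L).card

lemma earRate (hG : Cub G) : EarRate G 8 2 3 := fun _ hK _ _ h => h.bits hG hK

lemma earRate_of_noC4 (hG : Cub G) (h4 : NoC4 G) : EarRate G 4 1 1 := fun _ hK _ _ h => by
  simpa using h.bits_of_noC4 hG h4 hK

lemma EarRate.bits {c e d : ℕ} (hrate : EarRate G c e d) (hG : Cub G)
    (hn : 4 ∣ Fintype.card V) :
    ∀ (m : ℕ) (S : Finset V) (K : Subgroup (Equiv.Perm V)), K ≤ aut G → S ⊆ core G → S.Nonempty →
      Fat G S → (∀ s ∈ S, Fixed K s) → (core G \ S).card = m →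
      ∃ b, Bits K (core G) b ∧ c * b ≤ d * m := by
  intro m
  induction m using Nat.strong_induction_on with
  | _ m ih =>
    intro S K hK hSC hne hfat hfix hm
    by_cases hSeq : S = core G
    · subst hSeq
      exact ⟨0, Bits.zero hfix, by simp⟩
    obtain ⟨s, hs, u, hu, huS, hsu⟩ := conn_core hG S hSC hne hSeq
    obtain ⟨z, L, hear, hlay, hfat'⟩ := exists_ear_step hG hn hK hSC hfat hfix hs hu huS hsu
    obtain ⟨b, hb, hbc⟩ := hrate K hK z L hear
    have hUpos : 0 < (layers K z L).card :=
      Finset.card_pos.2 ⟨z 0, mem_layers.2 ⟨0, by lia, self_mem_orb _ _⟩⟩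
    have hcard : (core G \ (S ∪ layers K z L)).card + (layers K z L).card = m := by
      rw [← hm, ← card_sdiff_add_card_eq_card hlay, sdiff_sdiff_left]; rfl
    obtain ⟨b', hb', hbc'⟩ := ih _ (by lia) (S ∪ layers K z L) (fx K (layers K z L))
      ((fx_le _ _).trans hK) (union_subset hSC (hlay.trans sdiff_subset))
      (hne.mono subset_union_left) hfat' (fun s hs => by
        rcases mem_union.1 hs with hs | hs
        · exact (hfix s hs).mono (fx_le _ _)
        · exact fixed_fx hs) rfl
    refine ⟨b + b', ?_, ?_⟩
    · have := hb.trans hb'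
      rwa [union_eq_right.2 (hlay.trans sdiff_subset)] at this
    · rw [← hcard]; nlinarith

/-- Adding a first ear which starts at `u`, and stops at `v`. -/
lemma EarRate.bits_of_ear {c e d : ℕ} (hrate : EarRate G c e d) (hG : Cub G)
    (hn : 4 ∣ Fintype.card V) (hK : K ≤ aut G) (hS : S ⊆ core G) (hfix : ∀ s ∈ S, Fixed K s)
    {z : ℕ → V} {L : ℕ} (hear : Ear G K z L) (hlay : layers K z L ⊆ core G \ S)
    (hfat : Fat G (S ∪ layers K z L)) :
    ∃ b, Bits K (core G) b ∧ c * b + e ≤ d * (core G \ S).card := by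
  obtain ⟨b, hb, hbc⟩ := hrate K hK z L hear
  have hcard : (core G \ (S ∪ layers K z L)).card + (layers K z L).card = (core G \ S).card := by
    rw [← card_sdiff_add_card_eq_card hlay, sdiff_sdiff_left]; rfl
  obtain ⟨b', hb', hbc'⟩ := hrate.bits hG hn _ (S ∪ layers K z L) (fx K (layers K z L))
    ((fx_le _ _).trans hK) (union_subset hS (hlay.trans sdiff_subset))
    ⟨z 0, mem_union_right _ (mem_layers.2 ⟨0, by lia, self_mem_orb _ _⟩)⟩ hfat (fun s hs => by
      rcases mem_union.1 hs with hs | hs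
      · exact (hfix s hs).mono (fx_le _ _)
      · exact fixed_fx hs) rfl
  refine ⟨b + b', ?_, ?_⟩
  · have := hb.trans hb'
    rwa [union_eq_right.2 (hlay.trans sdiff_subset)] at this
  · rw [← hcard]; nlinarith

/-- The bits of the stabilizer of an arc of a bridgeless graph. -/
lemma EarRate.bits_arc {c e d : ℕ} (hrate : EarRate G c e d) (hG : Cub G)
    (hn : 4 ∣ Fintype.card V) (hC : core G = univ) (hK : K ≤ aut G) {u v : V} (huv : G.Adj u v)
    (hu : Fixed K u) (hv : Fixed K v) :
    ∃ b, Bits K univ b ∧ c * b + e ≤ d * Fintype.card V := by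
  set R : V → V → Prop := fun a b => G.Adj a b ∧ ¬ (a = u ∧ b = v) ∧ ¬ (a = v ∧ b = u) with hR
  have hRK : ∀ k ∈ K, ∀ a b, R a b → R (k a) (k b) := by
    intro k hk a b ⟨h1, h2, h3⟩
    refine ⟨(hK hk a b).2 h1, ?_, ?_⟩
    · rintro ⟨ea, eb⟩
      exact h2 ⟨k.injective (ea.trans (hu k hk).symm), k.injective (eb.trans (hv k hk).symm)⟩
    · rintro ⟨ea, eb⟩
      exact h3 ⟨k.injective (ea.trans (hv k hk).symm), k.injective (eb.trans (hu k hk).symm)⟩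
  have hreach : Relation.ReflTransGen R u v := by
    by_contra hcon
    set D := univ.filter (Relation.ReflTransGen R u) with hD
    have hmD : ∀ {w}, w ∈ D ↔ Relation.ReflTransGen R u w := by simp [hD]
    obtain ⟨p, hp, q, -, hq, hpq, hne⟩ := exists_second_edge hG hn (S := D) (by rw [hC]; simp)
      (hmD.2 .refl) (by rw [hC]; simp) (fun h => hcon (hmD.1 h)) huv
    refine hq (hmD.2 ((hmD.1 hp).tail ⟨hpq, hne, ?_⟩))
    rintro ⟨rfl, -⟩
    exact hcon (hmD.1 hp)
  obtain ⟨L, z, h0, hL, hz, hdisj⟩ := exists_disjoint_seq (P := fun t => t = v) hRK hu rfl hreach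
  subst h0
  have hL2 : 2 ≤ L := by
    by_contra hcon
    interval_cases L
    · exact huv.ne hL
    · exact (hz 0 (by lia)).2.1 ⟨rfl, hL⟩
  have hs1 : v ∉ orb K (z 1) := fun h => hdisj 1 L (by lia) le_rfl (by rwa [hL])
  have hs2 : z 0 ∉ orb K (z (L - 1)) := fun h => hdisj 0 (L - 1) (by lia) (by lia)
    (by rw [orb_eq_of_mem h]; exact self_mem_orb _ _)
  have hear : Ear G K z L :=
    { adj := fun i hi => (hz i hi).1
      fixed_first := hu
      fixed_last := by rw [hL]; exact hv
      disj := hdisj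
      first := fun _ => ⟨v, huv, hs1⟩
      last := fun _ => ⟨z 0, by rw [hL]; exact huv.symm, hs2⟩ }
  have hlm : ∀ i ≤ L, z i ∈ layers K z L := fun i hi => mem_layers.2 ⟨i, hi, self_mem_orb _ _⟩
  have := hrate.bits_of_ear hG hn hK (S := ∅) (by simp) (by simp) hear (by rw [hC]; simp) (by
    rw [empty_union]
    refine hear.fat hK subset_rfl ?_ ?_
    · refine two_le_nb huv (hz 0 (by lia)).1 (hL ▸ hlm L le_rfl) (hlm 1 (by lia)) ?_
      intro e; exact hs1 (e ▸ self_mem_orb _ _)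
    · obtain ⟨l, rfl⟩ : ∃ l, L = l + 1 := ⟨L - 1, by lia⟩
      refine two_le_nb (hL ▸ huv.symm) (hz l (by lia)).1.symm (hlm 0 (by lia)) (hlm l (by lia)) ?_
      intro e; exact hs2 (by rw [e]; exact self_mem_orb _ _))
  simpa [hC] using this

/-- The bits of the stabilizer of a vertex with two fixed neighbours in the core. -/
lemma EarRate.bits_two {c e d : ℕ} (hrate : EarRate G c e d) (hG : Cub G)
    (hn : 4 ∣ Fintype.card V) (hK : K ≤ aut G) {w x y : V} (hw : w ∈ core G)
    (hxC : x ∈ core G) (hyC : y ∈ core G) (hwx : G.Adj w x) (hwy : G.Adj w y) (hxy : x ≠ y)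
    (hN : nb G w ∩ core G = {x, y})
    (hwf : Fixed K w) (hx : Fixed K x) (hy : Fixed K y) :
    ∃ b, Bits K (core G) b ∧ c * b + e ≤ d * ((core G).card - 1) := by
  have hinv : Inv K (core G \ {w}) :=
    (inv_core.mono hK).sdiff (inv_of_fixed (by simpa using hwf))
  have hxX : x ∈ core G \ {w} := by simp [hxC, hwx.ne']
  have hreach : Relation.ReflTransGen (adjIn G (core G \ {w})) x y := by
    by_contra hcon
    set D := univ.filter (Relation.ReflTransGen (adjIn G (core G \ {w})) x) with hD
    have hmD : ∀ {w'}, w' ∈ D ↔ Relation.ReflTransGen (adjIn G (core G \ {w})) x w' := by simp [hD]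
    have hDX : D ⊆ core G \ {w} := by
      intro t ht
      rcases Relation.ReflTransGen.cases_tail (hmD.1 ht) with e | ⟨c, -, hc⟩
      · exact e ▸ hxX
      · exact hc.2.2
    obtain ⟨p, hp, q, hqC, hq, hpq, hne⟩ := exists_second_edge hG hn (hDX.trans sdiff_subset)
      (hmD.2 .refl) hw (fun h => by simpa using hDX h) hwx.symm
    by_cases hqw : q = w
    · subst hqw
      have : p ∈ nb G q ∩ core G := by
        rw [mem_inter, mem_nb]; exact ⟨hpq.symm, (mem_sdiff.1 (hDX hp)).1⟩
      rw [hN, mem_insert, mem_singleton] at this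
      rcases this with rfl | rfl
      · exact hne ⟨rfl, rfl⟩
      · exact hcon (hmD.1 hp)
    · exact hq (hmD.2 ((hmD.1 hp).tail ⟨hpq, hDX hp, by simp [hqC, hqw]⟩))
  obtain ⟨L, z, h0, hL, hz, hdisj⟩ := exists_disjoint_seq (P := fun t => t = y)
    (adjIn_map hK hinv) hx rfl hreach
  have hL0 : 0 < L := by
    by_contra hcon
    exact hxy (by rw [← h0, ← hL, show L = 0 by lia])
  have hzX : ∀ i ≤ L, z i ∈ core G \ {w} := by
    intro i hi
    rcases hi.eq_or_lt with rfl | hi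
    · simp [hL, hyC, hwy.ne']
    · exact (hz i hi).2.1
  have hwo : ∀ i ≤ L, w ∉ orb K (z i) := fun i hi h => by
    simpa using orb_subset hinv (hzX i hi) h
  have hear : Ear G K z L :=
    { adj := fun i hi => (hz i hi).1
      fixed_first := h0 ▸ hx
      fixed_last := hL ▸ hy
      disj := hdisj
      first := fun h => ⟨w, h0 ▸ hwx.symm, hwo 1 h⟩
      last := fun h => ⟨w, hL ▸ hwy.symm, hwo _ (by lia)⟩ }
  have hlm : ∀ i ≤ L, z i ∈ layers K z L := fun i hi => mem_layers.2 ⟨i, hi, self_mem_orb _ _⟩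
  have hlm' : ∀ i ≤ L, z i ∈ {w} ∪ layers K z L := fun i hi => mem_union_right _ (hlm i hi)
  have := hrate.bits_of_ear hG hn hK (S := {w}) (by simpa) (by simpa) hear
    (layers_subset hinv hzX) (by
      intro s hs
      rcases mem_union.1 hs with hs | hs
      · rw [mem_singleton] at hs; subst hs
        exact two_le_nb hwx hwy (h0 ▸ hlm' 0 (by lia)) (hL ▸ hlm' L le_rfl) hxy
      · refine hear.fat hK subset_union_right ?_ ?_ s hs
        · refine two_le_nb (b := z 1) (h0 ▸ hwx.symm) (hz 0 hL0).1 (mem_union_left _ (mem_singleton_self w))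
            (hlm' 1 hL0) ?_
          intro e; exact hwo 1 hL0 (e ▸ self_mem_orb _ _)
        · obtain ⟨l, rfl⟩ : ∃ l, L = l + 1 := ⟨L - 1, by lia⟩
          refine two_le_nb (b := z l) (hL ▸ hwy.symm) (hz l (by lia)).1.symm
            (mem_union_left _ (mem_singleton_self w)) (hlm' l (by lia)) ?_
          intro e; exact hwo l (by lia) (e ▸ self_mem_orb _ _))
  rwa [card_sdiff_of_subset (by simpa), card_singleton] at this

/-- The vertices outside the core which are adjacent to the core. -/
def roots (G : SimpleGraph V) : Finset V :=
  univ.filter fun r => r ∉ core G ∧ ∃ p ∈ core G, G.Adj p r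

lemma mem_roots {r : V} : r ∈ roots G ↔ r ∉ core G ∧ ∃ p ∈ core G, G.Adj p r := by simp [roots]

lemma exists_branch {r : V} (hr : r ∈ roots G) : ∃ pT : V × Finset V, pT.1 ∈ core G ∧ Small G pT.2 pT.1 r := by
  obtain ⟨hr, p, hp, hpr⟩ := mem_roots.1 hr
  obtain ⟨T, hT⟩ := exists_small_of_adj hp hr hpr
  exact ⟨(p, T), hp, hT⟩

/-- The neighbour in the core of a root. -/
def par (G : SimpleGraph V) (r : V) : V := if h : r ∈ roots G then (exists_branch h).choose.1 else r

/-- The small side with a given root. -/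
def branch (G : SimpleGraph V) (r : V) : Finset V :=
  if h : r ∈ roots G then (exists_branch h).choose.2 else ∅

lemma par_mem {r : V} (hr : r ∈ roots G) : par G r ∈ core G := by
  rw [par, dif_pos hr]; exact (exists_branch hr).choose_spec.1

lemma small_branch {r : V} (hr : r ∈ roots G) : Small G (branch G r) (par G r) r := by
  rw [par, branch, dif_pos hr, dif_pos hr]; exact (exists_branch hr).choose_spec.2

lemma par_eq {r p : V} (hr : r ∈ roots G) (hp : p ∈ core G) (h : G.Adj p r) : p = par G r :=
  ((small_branch hr).1.cut r (small_branch hr).1.mem p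
    (mem_core.1 hp _ _ _ (small_branch hr)) h.symm).2

lemma adj_par {r : V} (hr : r ∈ roots G) : G.Adj (par G r) r := (small_branch hr).1.adj

/-- Half the number of vertices of a branch, rounded up. -/
def hgt (G : SimpleGraph V) (r : V) : ℕ := ((branch G r).card + 1) / 2

lemma card_branch (hG : Cub G) {r : V} (hr : r ∈ roots G) : (branch G r).card + 1 = 2 * hgt G r := by
  obtain ⟨k, hk⟩ := (small_branch hr).1.odd hG
  rw [hgt]; lia

/-- The defect of a branch. -/
def eps (G : SimpleGraph V) (r : V) : ℕ := if Perfect (hgt G r) then 0 else 1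

lemma disjoint_branch (hG : Cub G) {r r' : V} (hr : r ∈ roots G) (hr' : r' ∈ roots G) (h : r ≠ r') :
    Disjoint (branch G r) (branch G r') :=
  (small_branch hr).disjoint hG (small_branch hr') (par_mem hr) (par_mem hr') h

lemma compl_core (hG : Cub G) : (core G)ᶜ = (roots G).biUnion (branch G) := by
  ext v; rw [mem_compl, mem_biUnion]; constructor
  · intro hv
    obtain ⟨T, p, r, hT, hvT, hp, hr⟩ := exists_parent hG hv
    have hrr : r ∈ roots G := mem_roots.2 ⟨hr, p, hp, hT.1.adj⟩
    refine ⟨r, hrr, ?_⟩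
    have := hT.1
    rw [par_eq hrr hp hT.1.adj] at this
    rwa [← this.unique hG (small_branch hrr).1]
  · rintro ⟨r, hr, hv⟩ hv'
    exact disjoint_left.1 (small_branch hr).disjoint_core hv hv'

lemma card_eq_core (hG : Cub G) :
    Fintype.card V + (roots G).card = (core G).card + 2 * ∑ r ∈ roots G, hgt G r := by
  have h1 := card_add_card_compl (core G)
  rw [compl_core hG, card_biUnion fun r hr r' hr' h => disjoint_branch hG hr hr' h] at h1
  rw [← h1, mul_sum, ← sum_congr rfl fun r hr => card_branch hG hr, sum_add_distrib, sum_const,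
    smul_eq_mul, mul_one, add_assoc]

lemma bits_branches (hG : Cub G) (hK : K ≤ aut G) (hcore : ∀ v ∈ core G, Fixed K v) {D : Finset V}
    (hD : D ⊆ roots G) (hfix : ∀ r ∈ D, Fixed K r) :
    ∃ t, Bits K (D.biUnion (branch G)) t ∧ t + D.card + ∑ r ∈ D, eps G r ≤ ∑ r ∈ D, hgt G r := by
  induction D using Finset.induction_on with
  | empty => exact ⟨0, Bits.zero (by simp), by simp⟩
  | insert r D hr ih =>
    obtain ⟨t, ht, htc⟩ := ih (fun x hx => hD (mem_insert_of_mem hx))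
      (fun x hx => hfix x (mem_insert_of_mem hx))
    have hrr := hD (mem_insert_self r D)
    set L := fx K (D.biUnion (branch G))
    have hL : L ≤ K := fx_le _ _
    have hp := (hcore _ (par_mem hrr)).mono hL
    have hrf := (hfix r (mem_insert_self r D)).mono hL
    have hc := card_branch hG hrr
    obtain ⟨s, hs, hsc⟩ : ∃ s, Bits L (branch G r) s ∧ s + 1 + eps G r ≤ hgt G r := by
      by_cases hP : Perfect (hgt G r)
      · obtain ⟨s, hs, hsc⟩ := (small_branch hrr).1.bits hG (hL.trans hK) hp hrf
        exact ⟨s, hs, by rw [eps, if_pos hP]; lia⟩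
      · obtain ⟨s, hs, hsc⟩ := (small_branch hrr).1.bits_imperfect hG (hL.trans hK) hp hrf hc hP
        exact ⟨s, hs, by rw [eps, if_neg hP]; lia⟩
    refine ⟨t + s, ?_, ?_⟩
    · rw [biUnion_insert, union_comm]; exact ht.trans hs
    · rw [card_insert_of_notMem hr, sum_insert hr, sum_insert hr]; lia

lemma card_of_fixed_roots (hG : Cub G) (hK : K ≤ aut G) (hcore : ∀ v ∈ core G, Fixed K v)
    (hfix : ∀ r ∈ roots G, Fixed K r) :
    ∃ t, Nat.card K = 2 ^ t ∧
      t + (roots G).card + ∑ r ∈ roots G, eps G r ≤ ∑ r ∈ roots G, hgt G r := by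
  obtain ⟨t, ht, htc⟩ := bits_branches hG hK hcore subset_rfl hfix
  refine ⟨t, ?_, htc⟩
  have := ht.congr (Z := univ) (subset_univ _) fun z _ hz => hcore z (by
    rwa [← compl_core hG, mem_compl, not_not] at hz)
  rw [this, fx_univ, mul_one]

lemma fixed_root (hG : Cub G) (hn : 4 ∣ Fintype.card V) (hC : (core G).card ≠ 1) (hK : K ≤ aut G)
    {r : V} (hr : r ∈ roots G) (hp : Fixed K (par G r)) : Fixed K r := by
  have hinv : Inv K (core G)ᶜ := by
    rw [compl_eq_univ_sdiff]; exact (inv_univ K).sdiff (inv_core.mono hK)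
  refine fixed_of_unique_nb hK hinv hp (adj_par hr) (by simpa using (mem_roots.1 hr).1) ?_
  have := card_nb_inter_add_le hG (par G r) (disjoint_compl_right (a := core G))
  have h1 := two_core_nb hG hn hC (par_mem hr)
  have := card_nb_inter_pos (adj_par hr) (X := (core G)ᶜ) (by simpa using (mem_roots.1 hr).1)
  lia

lemma fixed_par (hK : K ≤ aut G) {r : V} (hr : r ∈ roots G) (hf : Fixed K r) :
    Fixed K (par G r) := fun k hk =>
  par_eq hr (inv_core k (hK hk) _ (par_mem hr)) (by
    have := (hK hk _ _).2 (adj_par hr)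
    rwa [hf k hk] at this)

lemma inv_roots : Inv (aut G) (roots G) := by
  intro k hk r hr
  rw [mem_roots] at *
  obtain ⟨h, p, hp, hpr⟩ := hr
  exact ⟨fun h' => h ((inv_core.mem_iff hk).1 h'), k p, inv_core k hk p hp, (hk _ _).2 hpr⟩

lemma par_map {k : Equiv.Perm V} (hk : k ∈ aut G) {r : V} (hr : r ∈ roots G) :
    par G (k r) = k (par G r) :=
  (par_eq (inv_roots k hk r hr) (inv_core k hk _ (par_mem hr)) ((hk _ _).2 (adj_par hr))).symm

lemma hgt_map (hG : Cub G) {k : Equiv.Perm V} (hk : k ∈ aut G) {r : V} (hr : r ∈ roots G) :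
    hgt G (k r) = hgt G r := by
  have h1 := (small_branch hr).1.map hk
  rw [← par_map hk hr] at h1
  rw [hgt, ← h1.unique hG (small_branch (inv_roots k hk r hr)).1, card_map, ← hgt]

lemma par_injOn (hG : Cub G) (hn : 4 ∣ Fintype.card V) (hC : (core G).card ≠ 1) :
    Set.InjOn (par G) (roots G) := by
  intro r hr r' hr' h
  have := card_nb_inter_add_le hG (par G r) (disjoint_compl_right (a := core G))
  have h1 := two_core_nb hG hn hC (par_mem hr)
  have h2 : (nb G (par G r) ∩ (core G)ᶜ).card ≤ 1 := by lia
  refine card_le_one.1 h2 _ ?_ _ ?_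
  · exact mem_inter.2 ⟨by simpa using adj_par hr, by simpa using (mem_roots.1 hr).1⟩
  · exact mem_inter.2 ⟨by simpa [h] using adj_par hr', by simpa using (mem_roots.1 hr').1⟩

/-- The order of a group in terms of its bits on the core. -/
lemma card_of_bits_core (hG : Cub G) (hn : 4 ∣ Fintype.card V) (hC : (core G).card ≠ 1)
    (hK : K ≤ aut G) {b : ℕ} (hb : Bits K (core G) b) :
    ∃ s, Nat.card K = 2 ^ s ∧ 2 * s + (core G).card + (roots G).card + 2 * ∑ r ∈ roots G, eps G r ≤
      2 * b + Fintype.card V := by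
  obtain ⟨t, ht, htc⟩ := card_of_fixed_roots hG ((fx_le K (core G)).trans hK)
    (fun v hv => fixed_fx hv)
    (fun r hr => fixed_root hG hn hC ((fx_le _ _).trans hK) hr (fixed_fx (par_mem hr)))
  have := card_eq_core hG
  refine ⟨b + t, ?_, by lia⟩
  rw [hb, ht, pow_add]

lemma Perfect.eq_three {h : ℕ} (hp : Perfect h) (ho : h % 2 = 1) : h = 3 := by
  obtain ⟨k, rfl | rfl⟩ := hp
  · rcases k with _ | k
    · rfl
    · rw [pow_succ] at ho; lia
  · lia

/-- The numbers `5 * 2 ^ m` and `15 * 2 ^ m` with `m ≥ 2`. -/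
def Shape (N : ℕ) : Prop := ∃ a m : ℕ, (a = 1 ∨ a = 3) ∧ 2 ≤ m ∧ N = 5 * a * 2 ^ m

lemma Shape.four_dvd {N : ℕ} (h : Shape N) : 20 ∣ N := by
  obtain ⟨a, m, -, hm, rfl⟩ := h
  obtain ⟨k, rfl⟩ := Nat.exists_eq_add_of_le hm
  exact ⟨a * 2 ^ k, by ring⟩

lemma Shape.le {N : ℕ} (h : Shape N) : 20 ≤ N := by
  obtain ⟨a, m, ha, hm, rfl⟩ := h
  have : 2 ^ 2 ≤ 2 ^ m := Nat.pow_le_pow_right (by lia) hm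
  rcases ha with rfl | rfl <;> lia

lemma not_perfect_of_double {N h h' : ℕ} (hN : Shape N) (hp : Perfect h) (e : h' + 2 * h = N + 1) :
    ¬ Perfect h' := by
  intro hp'
  obtain ⟨k, hk⟩ := hN.four_dvd
  have := hN.le
  have h3 := hp'.eq_three (by lia)
  have := hp.eq_three (by lia)
  lia

lemma not_perfect_of_triple {N h : ℕ} (hN : Shape N) (e : 3 * h = N + 1) : ¬ Perfect h := by
  intro hp
  obtain ⟨k, hk⟩ := hN.four_dvd
  have := hN.le
  have h3 := hp.eq_three (by lia)
  lia

lemma sixteen_mul_le {N o t E : ℕ} (h : 16 * o ≤ 5 * 2 ^ E) (ht : t + E ≤ N) :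
    16 * (o * 2 ^ t) ≤ 5 * 2 ^ N := by
  calc 16 * (o * 2 ^ t) = 16 * o * 2 ^ t := by ring
    _ ≤ 5 * 2 ^ E * 2 ^ t := by gcongr
    _ = 5 * 2 ^ (t + E) := by ring
    _ ≤ 5 * 2 ^ N := by gcongr; norm_num

/-- The bound for graphs whose core is a vertex. -/
lemma bound_of_core_vertex (hG : Cub G) {N : ℕ} (hN : Shape N) (hV : Fintype.card V = 2 * N)
    (hC : (core G).card = 1) : 16 * Nat.card (aut G) ≤ 5 * 2 ^ N := by
  obtain ⟨v, hv⟩ := card_eq_one.1 hC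
  have hroots : roots G = nb G v := by
    ext r; rw [mem_roots, hv, mem_nb]; constructor
    · rintro ⟨-, p, hp, h⟩
      rw [mem_singleton] at hp; rwa [← hp]
    · intro h
      exact ⟨fun h' => h.ne (mem_singleton.1 h').symm, v, by simp, h⟩
  have hvf : Fixed (aut G) v := fun k hk => by
    have := inv_core k hk v (by simp [hv])
    rwa [hv, mem_singleton] at this
  have hdeg := hG.deg v
  have hinv : Inv (aut G) (nb G v) := inv_nb le_rfl hvf
  have hcard := card_eq_core hG
  rw [hroots, hdeg, hC] at hcard
  -- two fixed neighbours suffice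
  have key : ∀ {r r' r''}, nb G v = {r, r', r''} → r ≠ r' → r ≠ r'' → r' ≠ r'' →
      ∃ t, Nat.card (fx (aut G) {r, r'}) = 2 ^ t ∧
        t + 2 + (eps G r + eps G r' + eps G r'') ≤ N := by
    intro r r' r'' hN' h1 h2 h3
    have hK := fx_le (aut G) {r, r'}
    have hr : Fixed (fx (aut G) {r, r'}) r := fixed_fx (by simp)
    have hr' : Fixed (fx (aut G) {r, r'}) r' := fixed_fx (by simp)
    obtain ⟨t, ht, htc⟩ := card_of_fixed_roots hG hK (by
      rw [hv]; intro w hw; rw [mem_singleton.1 hw]; exact hvf.mono hK) (by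
      rw [hroots]
      intro w hw k hk
      rw [hN'] at hw
      simp only [mem_insert, mem_singleton] at hw
      rcases hw with rfl | rfl | rfl
      · exact hr k hk
      · exact hr' k hk
      · have := hinv k (hK hk) w (by simp [hN'])
        rw [hN'] at this
        simp only [mem_insert, mem_singleton] at this
        rcases this with e | e | e
        · exact absurd (k.injective (e.trans (hr k hk).symm)) h2.symm
        · exact absurd (k.injective (e.trans (hr' k hk).symm)) h3.symm
        · exact e)
    refine ⟨t, ht, ?_⟩
    have hs : ∀ f : V → ℕ, ∑ x ∈ nb G v, f x = f r + f r' + f r'' := by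
      intro f
      rw [hN', sum_insert (by simp [h1, h2]), sum_pair h3, add_assoc]
    rw [hroots, hdeg] at htc
    rw [hs] at htc hcard
    rw [hs] at htc
    lia
  have hmul : ∀ r r', Nat.card (aut G) = (orb (aut G) r).card *
      ((orb (fx (aut G) {r}) r').card * Nat.card (fx (aut G) {r, r'})) := by
    intro r r'
    rw [card_eq_orb_mul _ r, card_eq_orb_mul (fx (aut G) {r}) r', fx_fx]; rfl
  have horb2 : ∀ {r r'}, r ∈ nb G v → r' ∈ nb G v → r ≠ r' →
      (orb (fx (aut G) {r}) r').card ≤ 2 := by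
    intro r r' hr hr' hne
    rw [show 2 = ((nb G v).erase r).card by rw [card_erase_of_mem hr, hdeg]]
    refine card_le_card (orb_subset ?_ (mem_erase.2 ⟨hne.symm, hr'⟩))
    intro k hk y hy
    rw [mem_erase] at *
    exact ⟨fun e => hy.1 (k.injective (e.trans (hk.2 r (by simp)).symm)), hinv k hk.1 y hy.2⟩
  have hcases : (∃ r ∈ nb G v, orb (aut G) r = nb G v) ∨ ∃ r ∈ nb G v, Fixed (aut G) r := by
    obtain ⟨r, hr⟩ : (nb G v).Nonempty := by rw [← Finset.card_pos, hdeg]; lia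
    have hsub := orb_subset hinv hr
    have hle := card_le_card hsub
    have hpos : 0 < (orb (aut G) r).card := Finset.card_pos.2 ⟨r, self_mem_orb _ _⟩
    rw [hdeg] at hle
    obtain h | h | h : (orb (aut G) r).card = 1 ∨ (orb (aut G) r).card = 2 ∨
        (orb (aut G) r).card = 3 := by lia
    · exact Or.inr ⟨r, hr, fixed_of_card_orb h⟩
    · have h1 : (nb G v \ orb (aut G) r).card = 1 := by
        rw [card_sdiff_of_subset hsub, hdeg, h]
      obtain ⟨s, hs⟩ := card_eq_one.1 h1
      have hs' : s ∈ nb G v \ orb (aut G) r := by simp [hs]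
      refine Or.inr ⟨s, (mem_sdiff.1 hs').1, fun k hk => ?_⟩
      have := (hinv.sdiff (inv_orb _ r)) k hk s hs'
      rwa [hs, mem_singleton] at this
    · exact Or.inl ⟨r, hr, eq_of_subset_of_card_le hsub (by rw [hdeg, h])⟩
  have heps : ∀ r, ¬ Perfect (hgt G r) → eps G r = 1 := fun r h => by rw [eps, if_neg h]
  have hsum : ∀ {r r' r''}, nb G v = {r, r', r''} → r ≠ r' → r ≠ r'' → r' ≠ r'' →
      hgt G r + hgt G r' + hgt G r'' = N + 1 := by
    intro r r' r'' hN' h1 h2 h3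
    rw [hN', sum_insert (by simp [h1, h2]), sum_pair h3] at hcard
    lia
  have hhgt : ∀ {r r'}, r ∈ nb G v → r' ∈ orb (aut G) r → hgt G r' = hgt G r := by
    intro r r' hr hr'
    obtain ⟨k, hk, rfl⟩ := mem_orb.1 hr'
    exact hgt_map hG hk (hroots ▸ hr)
  have henum : ∀ {r}, r ∈ nb G v → ∃ r' r'', nb G v = {r, r', r''} ∧ r ≠ r' ∧ r ≠ r'' ∧ r' ≠ r'' := by
    intro r hr
    have : ((nb G v).erase r).card = 2 := by rw [card_erase_of_mem hr, hdeg]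
    obtain ⟨a, b, hab, e⟩ := card_eq_two.1 this
    have ha : a ∈ (nb G v).erase r := by simp [e]
    have hb : b ∈ (nb G v).erase r := by simp [e]
    refine ⟨a, b, by rw [← e, insert_erase hr], (mem_erase.1 ha).1.symm, (mem_erase.1 hb).1.symm, hab⟩
  rcases hcases with ⟨r, hr, ho⟩ | ⟨r, hr, hrf⟩
  · obtain ⟨r', r'', hN', h1, h2, h3⟩ := henum hr
    obtain ⟨t, ht, htc⟩ := key hN' h1 h2 h3
    have hr' : r' ∈ nb G v := by simp [hN']
    have hr'' : r'' ∈ nb G v := by simp [hN']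
    have e1 := hhgt hr (ho ▸ hr')
    have e2 := hhgt hr (ho ▸ hr'')
    have e3 := hsum hN' h1 h2 h3
    have hnp := not_perfect_of_triple (h := hgt G r) hN (by lia)
    rw [heps r hnp, heps r' (e1 ▸ hnp), heps r'' (e2 ▸ hnp)] at htc
    have hb := horb2 hr hr' h1
    rw [hmul r r', ho, hdeg, ht, ← mul_assoc 3]
    exact sixteen_mul_le (E := 5) (by lia) (by lia)
  · obtain ⟨r', r'', hN', h1, h2, h3⟩ := henum hr
    obtain ⟨t, ht, htc⟩ := key hN' h1 h2 h3
    have hr' : r' ∈ nb G v := by simp [hN']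
    have hr'' : r'' ∈ nb G v := by simp [hN']
    have hb := horb2 hr hr' h1
    rw [hmul r r', orb_eq_singleton hrf, card_singleton, ht, one_mul]
    by_cases ho : (orb (fx (aut G) {r}) r').card ≤ 1
    · exact sixteen_mul_le (E := 2) (by lia) (by lia)
    have : 1 ≤ eps G r + eps G r' + eps G r'' := by
      by_contra hcon
      have hP : ∀ x, eps G x = 0 → Perfect (hgt G x) := fun x hx => by
        by_contra h; rw [heps x h] at hx; lia
      have hmem : r'' ∈ orb (aut G) r' := by
        obtain ⟨s, hs, hne⟩ := exists_mem_ne (s := orb (fx (aut G) {r}) r') (by lia) r'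
        obtain ⟨k, hk, rfl⟩ := mem_orb.1 hs
        have hin := hinv k hk.1 r' hr'
        rw [hN'] at hin
        simp only [mem_insert, mem_singleton] at hin
        rcases hin with e | e | e
        · exact absurd (k.injective (e.trans (hk.2 r (by simp)).symm)) h1.symm
        · exact absurd e hne
        · exact mem_orb.2 ⟨k, hk.1, e⟩
      have e1 := hhgt hr' hmem
      have e3 := hsum hN' h1 h2 h3
      exact not_perfect_of_double (h := hgt G r') (h' := hgt G r) hN (hP _ (by lia)) (by lia)
        (hP _ (by lia))
    exact sixteen_mul_le (E := 3) (by lia) (by lia)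

lemma card_roots_le (hG : Cub G) (hn : 4 ∣ Fintype.card V) (hC : (core G).card ≠ 1)
    (h : ∀ r ∈ roots G, par G r ∈ S) : (roots G).card ≤ S.card :=
  card_le_card_of_injOn (par G) h (par_injOn hG hn hC)

lemma not_shut (hG : Cub G) (hn : 4 ∣ Fintype.card V) {x w : V} {D : Finset V}
    (hD : Shut G (core G) F x D) (hwD : w ∉ D) (hwC : w ∈ core G)
    (hF : ∀ f ∈ F, G.Adj x f → f = w) : False := by
  obtain ⟨hDX, hxD, -, hcut⟩ := hD
  obtain ⟨a, ha, b, hb, hbD, hab⟩ := conn_core hG D hDX ⟨x, hxD⟩ (fun e => hwD (e ▸ hwC))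
  obtain ⟨a', ha', b', hb', hbD', hab', hne⟩ := exists_second_edge hG hn hDX ha hb hbD hab
  obtain ⟨rfl, hbF⟩ := hcut a ha b hb hbD hab
  obtain ⟨rfl, hbF'⟩ := hcut a' ha' b' hb' hbD' hab'
  exact hne ⟨rfl, (hF b' hbF' hab').trans (hF b hbF hab).symm⟩

lemma par_ne_of_nb {r x a b c : V} (hr : r ∈ roots G) (ha : a ∈ core G) (hb : b ∈ core G)
    (hc : c ∈ core G) (hN : nb G x = {a, b, c}) : par G r ≠ x := by
  rintro rfl
  have : r ∈ nb G (par G r) := by rw [mem_nb]; exact adj_par hr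
  rw [hN] at this
  simp only [mem_insert, mem_singleton] at this
  rcases this with rfl | rfl | rfl <;> exact (mem_roots.1 hr).1 (by assumption)

lemma tight_one (hG : Cub G) (hn : 4 ∣ Fintype.card V) (hC : (core G).card ≠ 1) (hK : K ≤ aut G)
    {r : V} (hr : r ∈ roots G) (hrf : Fixed K r) {b : ℕ} (hb : Bits K (core G) b)
    (hbc : 2 * b + 1 = (core G).card) : (core G).card ≤ 7 ∧ (roots G).card ≤ 4 := by
  have hconn := conn_core hG
  have hinv := inv_core.mono hK
  have hwf := fixed_par hK hr hrf
  have hwC := par_mem hr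
  have hwr := adj_par hr
  have hrC := (mem_roots.1 hr).1
  obtain ⟨w, hw⟩ : ∃ w, w = par G r := ⟨_, rfl⟩
  rw [← hw] at hwf hwC hwr
  have hfx : fx K {w} = K := fx_eq_self fun k hk s hs => by
    rw [mem_singleton.1 hs]; exact hwf k hk
  have hT : Tight G K (core G) {w} :=
    { sub := by simpa
      anch := by
        intro s hs
        rw [mem_singleton.1 hs, hfx]
        exact ⟨hwf, r, hwr, hrf⟩
      bits := ⟨b, by rw [hfx]; exact hb, by
        rw [card_sdiff_of_subset (by simpa), card_singleton]; lia⟩ }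
  obtain ⟨p, hp, x, hxC, hxw, hpx⟩ := hconn {w} (by simpa) (by simp)
    (fun e => hC (by rw [← e]; simp))
  rw [mem_singleton] at hp; subst hp
  obtain ⟨u, y, hyC, hyw, hyx, hu, hN, hF, -⟩ := hT.step hG hK hconn hinv (mem_singleton_self _) hxC
    hxw hpx
  rw [mem_singleton] at hxw hyw hu
  have hFeq : ({p} ∪ {x, y} : Finset V) = {p, x, y} := rfl
  rw [hFeq] at hF
  have hpy : G.Adj p y := by rw [← mem_nb, hN]; simp
  have hFc : ({p, x, y} : Finset V).card = 3 := by
    rw [card_insert_of_notMem (by simp [Ne.symm hxw, Ne.symm hyw]), card_pair hyx.symm]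
  have hnbp : ∀ q ∈ core G, G.Adj p q → q ∈ ({p, x, y} : Finset V) := by
    intro q hq h
    rw [← mem_nb, hN] at h
    simp only [mem_insert, mem_singleton] at h ⊢
    rcases h with rfl | h
    · exact Or.inl (hu hq)
    · exact Or.inr h
  by_cases hxy : G.Adj x y
  · have key : ∀ {x y q : V}, G.Adj p x → G.Adj x y → y ≠ p → x ∈ ({p, x, y} : Finset V) →
        Tight G K (core G) ({p, x, y} : Finset V) → q ∈ core G → q ∉ ({p, x, y} : Finset V) →
        ¬ G.Adj x q := by
      intro x y q hpx hxy hyp hx hF hq hqF hxq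
      obtain ⟨u', q', -, hq', -, -, hN', -⟩ := hF.step hG hK hconn hinv hx hq hqF hxq
      have h1 : p ∈ nb G x := by simpa using hpx.symm
      have h2 : y ∈ nb G x := by simpa using hxy
      rw [hN'] at h1 h2
      simp only [mem_insert, mem_singleton, not_or] at *
      rcases h1 with h1 | h1 | h1
      · rcases h2 with h2 | h2 | h2
        · exact hyp (h2.trans h1.symm)
        · exact hqF.2.2 h2.symm
        · exact hq'.2.2 h2.symm
      · exact hqF.1 h1.symm
      · exact hq'.1 h1.symm
    have hall : ({p, x, y} : Finset V) = core G := by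
      by_contra hne
      obtain ⟨a, ha, q, hq, hqF, haq⟩ := hconn _ hF.sub ⟨p, by simp⟩ hne
      simp only [mem_insert, mem_singleton] at ha
      rcases ha with rfl | rfl | rfl
      · exact hqF (hnbp q hq haq)
      · exact key hpx hxy hyw (by simp) hF hq hqF haq
      · have e : ({p, x, a} : Finset V) = {p, a, x} := by rw [pair_comm x a]
        rw [e] at hF hqF
        exact key hpy hxy.symm hxw (by simp) hF hq hqF haq
    have h3 : (core G).card = 3 := by rw [← hall, hFc]
    have := card_roots_le hG hn hC (S := core G) fun r hr => par_mem hr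
    lia
  · have hpC : p ∈ core G := hwC
    have hns : ∀ {x y : V}, ¬ G.Adj x y → x ≠ p → ¬ ∃ D, Shut G (core G) {p, x, y} x D := by
      rintro x y hxy hxp ⟨D, hD⟩
      refine not_shut hG hn hD (w := p) (fun h => hxp (hD.2.2.1 p h (by simp)).symm) hpC ?_
      intro f hf hxf
      simp only [mem_insert, mem_singleton] at hf
      rcases hf with rfl | rfl | rfl
      · rfl
      · exact absurd hxf (G.loopless.irrefl _)
      · exact absurd hxf hxy
    rcases closing hG hK hconn hinv hF (x := x) (y := y) (by simp) (by simp) hyx.symm (by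
      intro f hf hfx hfy q hq hfq
      simp only [mem_insert, mem_singleton, hfx, hfy, or_false] at hf
      rw [hf] at hfq
      exact hnbp q hq hfq) with h | h | ⟨h, q, hq, q', hq', hqF, hqF', hqq, hxq, hxq'⟩ | ⟨h, hnb⟩
    · exact absurd h (hns hxy hxw)
    · have e : ({p, x, y} : Finset V) = {p, y, x} := by rw [pair_comm x y]
      rw [e] at h
      exact absurd h (hns (fun h => hxy h.symm) hyw)
    · refine ⟨by lia, ?_⟩
      have hne1 : p ≠ q := fun e => hqF (by simp [← e])
      have hne2 : p ≠ q' := fun e => hqF' (by simp [← e])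
      have hNx := card_three (hG.deg x) (a := p) (b := q) (c := q') (by simpa using hpx.symm)
        (by simpa) (by simpa) hne1 hne2 hqq
      have := card_roots_le hG hn hC (S := (core G).erase x) fun r hr => mem_erase.2
        ⟨par_ne_of_nb hr hpC hq hq' hNx, par_mem hr⟩
      rw [card_erase_of_mem hxC] at this
      lia
    · refine ⟨by lia, ?_⟩
      have := card_roots_le hG hn hC (S := {p, x, y}) fun r hr => by
        by_contra hcon
        exact (mem_roots.1 hr).1 (hnb _ (par_mem hr) hcon (by simpa using adj_par hr))
      lia

lemma tight_two (hG : Cub G) (hn : 4 ∣ Fintype.card V) (hC : (core G).card ≠ 1) (hK : K ≤ aut G)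
    {r r' : V} (hr : r ∈ roots G) (hr' : r' ∈ roots G) (hrr : r ≠ r') (hrf : Fixed K r)
    (hrf' : Fixed K r') {b : ℕ} (hb : Bits K (core G) b)
    (hbc : 2 * b + 2 = (core G).card) :
    (core G).card = 4 ∨ (core G).card = 6 ∧ (roots G).card ≤ 2 := by
  have hconn := conn_core hG
  have hinv := inv_core.mono hK
  have hpp : par G r ≠ par G r' := fun e => hrr (par_injOn hG hn hC hr hr' e)
  have hFc : ({par G r, par G r'} : Finset V).card = 2 := card_pair hpp
  have hsub : ({par G r, par G r'} : Finset V) ⊆ core G := by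
    intro s hs
    simp only [mem_insert, mem_singleton] at hs
    rcases hs with rfl | rfl
    exacts [par_mem hr, par_mem hr']
  have hfx : fx K {par G r, par G r'} = K := fx_eq_self fun k hk s hs => by
    simp only [mem_insert, mem_singleton] at hs
    rcases hs with rfl | rfl
    exacts [fixed_par hK hr hrf k hk, fixed_par hK hr' hrf' k hk]
  have hT : Tight G K (core G) {par G r, par G r'} :=
    { sub := hsub
      anch := by
        intro s hs
        simp only [mem_insert, mem_singleton] at hs
        rw [hfx]
        rcases hs with rfl | rfl
        exacts [⟨fixed_par hK hr hrf, r, adj_par hr, hrf⟩, ⟨fixed_par hK hr' hrf', r', adj_par hr', hrf'⟩]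
      bits := ⟨b, by rw [hfx]; exact hb, by rw [card_sdiff_of_subset hsub, hFc]; lia⟩ }
  have hadj : ¬ G.Adj (par G r) (par G r') := by
    intro hadj
    have h1 := two_core_nb hG hn hC (par_mem hr)
    obtain ⟨q, hq, hne⟩ := exists_mem_ne (s := nb G (par G r) ∩ core G) (by lia) (par G r')
    rw [mem_inter, mem_nb] at hq
    obtain ⟨u, q', hq', hqF', -, -, hN, -⟩ := hT.step hG hK hconn hinv (p := par G r) (by simp) hq.2
      (by simp [hne, hq.1.ne']) hq.1
    have h2 : r ∈ nb G (par G r) := by simpa using adj_par hr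
    have h3 : par G r' ∈ nb G (par G r) := by simpa using hadj
    rw [hN] at h2 h3
    simp only [mem_insert, mem_singleton, not_or] at *
    have hrC := (mem_roots.1 hr).1
    rcases h2 with rfl | rfl | rfl
    · rcases h3 with h3 | h3 | h3
      · exact hrC (h3 ▸ par_mem hr')
      · exact hne h3.symm
      · exact hqF'.2 h3.symm
    · exact hrC hq.2
    · exact hrC hq'
  have hns : ∀ {x y : V}, ¬ G.Adj x y → x ≠ y → y ∈ core G →
      ¬ ∃ D, Shut G (core G) {x, y} x D := by
    rintro x y hxy hne hy ⟨D, hD⟩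
    refine not_shut hG hn hD (w := y) (fun h => hne (hD.2.2.1 y h (by simp)).symm) hy ?_
    intro f hf hxf
    simp only [mem_insert, mem_singleton] at hf
    rcases hf with rfl | rfl
    · exact absurd hxf (G.loopless.irrefl _)
    · rfl
  rcases closing hG hK hconn hinv hT (x := par G r) (y := par G r') (by simp) (by simp) hpp (by
    intro f hf hfx hfy
    simp [hfx, hfy] at hf) with h | h | ⟨h, -⟩ | ⟨h, hnb⟩
  · exact absurd h (hns hadj hpp (par_mem hr'))
  · rw [pair_comm] at h
    exact absurd h (hns (fun h => hadj h.symm) hpp.symm (par_mem hr))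
  · left; lia
  · right
    refine ⟨by lia, ?_⟩
    rw [← hFc]
    refine card_roots_le hG hn hC fun r hr => ?_
    by_contra hcon
    exact (mem_roots.1 hr).1 (hnb _ (par_mem hr) hcon (by simpa using adj_par hr))

/-- A set `C` whose boundary vertices `W` form an orbit of length three of a group `R` all of whose
orbits have length one or three. -/
structure Tri (G : SimpleGraph V) (C W : Finset V) (R : Subgroup (Equiv.Perm V)) : Prop where
  deg : ∀ v, (nb G v).card = 3
  conn : Conn G C
  sub : W ⊆ C
  card : W.card = 3
  nbW : ∀ w ∈ W, (nb G w ∩ C).card = 2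
  nbC : ∀ v ∈ C, v ∉ W → nb G v ⊆ C
  le : R ≤ aut G
  inv : Inv (aut G) C
  invW : Inv (aut G) W
  orbW : ∀ w ∈ W, orb R w = W
  orbs : ∀ v, (orb R v).card = 1 ∨ (orb R v).card = 3

variable {R : Subgroup (Equiv.Perm V)}

lemma Tri.not_fixed (h : Tri G C W R) {w : V} (hw : w ∈ W) : ¬ Fixed R w := fun hf => by
  have := h.orbW w hw
  rw [orb_eq_singleton hf] at this
  have := h.card
  rw [← ‹{w} = W›, card_singleton] at this
  lia

lemma Tri.nonempty (h : Tri G C W R) : W.Nonempty := Finset.card_pos.1 (by rw [h.card]; lia)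

lemma Tri.card_orb (h : Tri G C W R) {v : V} (hv : ¬ Fixed R v) : (orb R v).card = 3 :=
  (h.orbs v).resolve_left fun e => hv (fixed_of_card_orb e)

lemma Tri.indep (h : Tri G C W R) (hC : C ≠ W) {w : V} (hw : w ∈ W) : (nb G w ∩ W).card = 0 := by
  have hconst : ∀ x ∈ W, (nb G x ∩ W).card = (nb G w ∩ W).card := fun x hx =>
    card_nb_inter_of_mem h.le (fun k hk => h.invW k (h.le hk)) (by rw [h.orbW w hw]; exact hx)
  have heven := even_sum_inter G W
  rw [sum_congr rfl hconst, sum_const, h.card, smul_eq_mul] at heven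
  have hle : (nb G w ∩ W).card ≤ 2 := by
    rw [← h.nbW w hw]; exact card_le_card (inter_subset_inter_left h.sub)
  by_contra h0
  have h2 : (nb G w ∩ W).card = 2 := by
    obtain ⟨k, hk⟩ := heven
    lia
  obtain ⟨a, ha, q, hq, hqW, haq⟩ := h.conn W h.sub h.nonempty hC.symm
  have e : nb G a ∩ W = nb G a ∩ C :=
    eq_of_subset_of_card_le (inter_subset_inter_left h.sub) (by rw [h.nbW a ha, hconst a ha, h2])
  have : q ∈ nb G a ∩ C := by simp [hq, haq]
  rw [← e, mem_inter] at this
  exact hqW this.2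

lemma Tri.nb_fixed (h : Tri G C W R) {v : V} (hv : v ∈ C) (hf : Fixed R v) :
    ∃ u ∈ C, ¬ Fixed R u ∧ nb G v = orb R u := by
  have key : ∀ {v}, Fixed R v → ∀ {u}, G.Adj v u → ¬ Fixed R u → nb G v = orb R u := by
    intro v hf u hu hnf
    refine (eq_of_subset_of_card_le (orb_subset (inv_nb h.le hf) (by simpa using hu)) ?_).symm
    rw [h.deg, h.card_orb hnf]
  by_contra hcon
  have hvD : ∀ u, G.Adj v u → Fixed R u := by
    intro u hu
    by_contra hnf
    exact hcon ⟨u, h.nbC v hv (fun hw => h.not_fixed hw hf) (by simpa using hu), hnf, key hf hu hnf⟩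
  obtain ⟨w, hw⟩ := h.nonempty
  obtain ⟨a, ha, q, hq, hqD, haq⟩ := h.conn (C.filter fun v => Fixed R v ∧ ∀ u, G.Adj v u → Fixed R u)
    (filter_subset _ _) ⟨v, by simpa using ⟨hv, hf, hvD⟩⟩ (fun e => by
      have := h.sub hw
      rw [← e, mem_filter] at this
      exact h.not_fixed hw this.2.1)
  rw [mem_filter] at ha hqD
  have hqf := ha.2.2 q haq
  refine hqD ⟨hq, hqf, fun u hu => ?_⟩
  by_contra hnf
  have e := key hqf hu hnf
  have haN : a ∈ nb G q := by simpa using haq.symm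
  rw [e] at haN
  have := h.card_orb hnf
  rw [← orb_eq_of_mem haN, orb_eq_singleton ha.2.1, card_singleton] at this
  lia

/-- At most one fixed vertex is attached to the whole boundary. -/
lemma Tri.card_attached (h : Tri G C W R) (hC : C ≠ W) (h5 : C.card ≠ 5) :
    (C.filter fun v => nb G v = W).card ≤ 1 := by
  have hsub : ∀ w ∈ W, C.filter (fun v => nb G v = W) ⊆ nb G w ∩ C := by
    intro w hw v hv
    rw [mem_filter] at hv
    rw [mem_inter, mem_nb, G.adj_comm, ← mem_nb, hv.2]
    exact ⟨hw, hv.1⟩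
  obtain ⟨w, hw⟩ := h.nonempty
  have hle := card_le_card (hsub w hw)
  rw [h.nbW w hw] at hle
  by_contra hcon
  have heq : ∀ w ∈ W, C.filter (fun v => nb G v = W) = nb G w ∩ C := fun w hw =>
    eq_of_subset_of_card_le (hsub w hw) (by rw [h.nbW w hw]; lia)
  have hall : W ∪ C.filter (fun v => nb G v = W) = C := by
    by_contra hne
    obtain ⟨a, ha, q, hq, hqD, haq⟩ := h.conn _ (union_subset h.sub (filter_subset _ _))
      ⟨w, mem_union_left _ hw⟩ hne
    rw [mem_union] at ha hqD
    rcases ha with ha | ha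
    · exact hqD (Or.inr (by rw [heq a ha]; simp [haq, hq]))
    · exact hqD (Or.inl (by rw [← (mem_filter.1 ha).2]; simpa using haq))
  have hdis : Disjoint W (C.filter fun v => nb G v = W) := by
    rw [disjoint_left]
    intro x hx hx'
    have := h.indep hC hx
    rw [(mem_filter.1 hx').2, inter_self, h.card] at this
    lia
  have := card_union_of_disjoint hdis
  rw [hall, h.card] at this
  lia

lemma fixed_of_three (hH : H ≤ aut G) (hX : Inv H X) (hW : ∀ w ∈ W, Fixed H w) (hXc : X.card = 3)
    (hWc : W.card = 3) {d : ℕ} (hd : d = 1 ∨ d = 2) (h1 : ∀ w ∈ W, (nb G w ∩ X).card = d)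
    (h2 : ∀ x ∈ X, (nb G x ∩ W).card = d) : ∀ x ∈ X, Fixed H x := by
  intro x hx
  rcases hd with rfl | rfl
  · obtain ⟨w, hw⟩ := Finset.card_pos.1 (by rw [h2 x hx]; lia : 0 < (nb G x ∩ W).card)
    rw [mem_inter, mem_nb] at hw
    exact fixed_of_unique_nb hH hX (hW w hw.2) hw.1.symm hx (h1 w hw.2)
  · obtain ⟨w, hw, hwx⟩ : ∃ w ∈ W, w ∉ nb G x := by
      by_contra! hcon
      have := h2 x hx
      rw [inter_eq_right.2 hcon] at this
      lia
    have hc : (X \ nb G w).card = 1 := by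
      have := card_sdiff_add_card_inter X (nb G w)
      rw [inter_comm, h1 w hw, hXc] at this
      lia
    have hinv := hX.sdiff (inv_nb hH (hW w hw))
    have hxm : x ∈ X \ nb G w := by
      rw [mem_sdiff, mem_nb, G.adj_comm, ← mem_nb]
      exact ⟨hx, hwx⟩
    exact fun k hk => card_le_one.1 hc.le _ (hinv k hk x hxm) _ hxm

lemma Tri.inv_level (h : Tri G C W R) (hH : H ≤ aut G) (d : ℕ) :
    Inv H ((C \ W).filter fun v => (nb G v ∩ W).card = d) := by
  intro k hk y hy
  rw [mem_filter, mem_sdiff] at *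
  refine ⟨⟨h.inv k (hH hk) y hy.1.1, ?_⟩, ?_⟩
  · intro hky
    apply hy.1.2
    have := h.invW k⁻¹ ((aut G).inv_mem (hH hk)) _ hky
    simpa using this
  · rw [card_nb_inter (hH hk) le_rfl h.invW]; exact hy.2

/-- The orbit of a moved interior vertex. -/
lemma Tri.orb_sub (h : Tri G C W R) {u : V} (hu : u ∈ C) (huW : u ∉ W) : orb R u ⊆ C \ W :=
  orb_subset (Inv.sdiff (fun k hk => h.inv k (h.le hk)) (fun k hk => h.invW k (h.le hk)))
    (mem_sdiff.2 ⟨hu, huW⟩)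

lemma Tri.double (h : Tri G C W R) {u : V} (hu : ¬ Fixed R u) {w x : V} (hw : w ∈ W)
    (hx : x ∈ orb R u) : (nb G x ∩ W).card = (nb G w ∩ orb R u).card := by
  have h1 := orb_double_count h.le w x
  rw [orb_eq_of_mem hx, h.orbW w hw, h.card, h.card_orb hu] at h1
  lia

lemma Tri.fixed_level (h : Tri G C W R) (hH : H ≤ aut G) (hW : ∀ w ∈ W, Fixed H w) {u : V}
    (hu : u ∈ C) (huW : u ∉ W) (huf : ¬ Fixed R u) {d : ℕ} (hd : d = 1 ∨ d = 2)
    (h1 : ∀ w ∈ W, (nb G w ∩ orb R u).card = d)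
    (hlev : ∀ v ∈ C, v ∉ W → v ∉ orb R u → (nb G v ∩ W).card ≠ d) :
    ∀ x ∈ orb R u, Fixed H x := by
  obtain ⟨w, hw⟩ := h.nonempty
  have h2 : ∀ x ∈ orb R u, (nb G x ∩ W).card = d := fun x hx => by rw [h.double huf hw hx, h1 w hw]
  have e : orb R u = (C \ W).filter fun v => (nb G v ∩ W).card = d := by
    ext v
    rw [mem_filter]
    refine ⟨fun hv => ⟨h.orb_sub hu huW hv, h2 v hv⟩, fun hv => ?_⟩
    rw [mem_sdiff] at hv
    by_contra hcon
    exact hlev v hv.1.1 hv.1.2 hcon hv.2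
  exact fixed_of_three hH (by rw [e]; exact h.inv_level hH d) hW (h.card_orb huf) h.card hd h1 h2

lemma Tri.nb_moved (h : Tri G C W R) {v : V} (hv : v ∈ C) (hf : Fixed R v) (hvW : nb G v ≠ W) :
    ∃ u ∈ C, u ∉ W ∧ ¬ Fixed R u ∧ nb G v = orb R u ∧ (nb G v ∩ W).card = 0 := by
  obtain ⟨u, hu, huf, e⟩ := h.nb_fixed hv hf
  have huW : u ∉ W := fun hw => hvW (e.trans (h.orbW u hw))
  refine ⟨u, hu, huW, huf, e, ?_⟩
  rw [card_eq_zero, ← disjoint_iff_inter_eq_empty, e, disjoint_left]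
  exact fun x hx => (mem_sdiff.1 (h.orb_sub hu huW hx)).2

lemma Tri.exists_moved (h : Tri G C W R) (hC : C ≠ W) (h4 : 5 < C.card) :
    ∃ u ∈ C, u ∉ W ∧ ¬ Fixed R u := by
  by_contra! hcon
  have hsub : C ⊆ W ∪ C.filter fun v => nb G v = W := by
    intro v hv
    rw [mem_union, mem_filter]
    by_cases hvW : v ∈ W
    · exact Or.inl hvW
    · refine Or.inr ⟨hv, ?_⟩
      by_contra hne
      obtain ⟨u, hu, huW, huf, -⟩ := h.nb_moved hv (hcon v hv hvW) hne
      exact huf (hcon u hu huW)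
  have := (card_le_card hsub).trans (card_union_le _ _)
  rw [h.card] at this
  have := h.card_attached hC (by lia)
  lia

lemma Tri.fixed_seven (h : Tri G C W R) (h7 : C.card = 7) (hH : H ≤ aut G)
    (hW : ∀ w ∈ W, Fixed H w) : ∀ v ∈ C, Fixed H v := by
  have hC : C ≠ W := by rintro rfl; have := h.card; lia
  obtain ⟨u, hu, huW, huf⟩ := h.exists_moved hC (by lia)
  have hX := h.orb_sub hu huW
  have hXc := h.card_orb huf
  have hcW : (C \ W).card = 4 := by rw [card_sdiff_of_subset h.sub, h.card, h7]
  have hc1 : ((C \ W) \ orb R u).card = 1 := by rw [card_sdiff_of_subset hX, hcW, hXc]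
  obtain ⟨z, hz⟩ := card_eq_one.1 hc1
  have hzm : z ∈ (C \ W) \ orb R u := by simp [hz]
  have hzX := (mem_sdiff.1 hzm).2
  obtain ⟨hzC, hzW⟩ := mem_sdiff.1 (mem_sdiff.1 hzm).1
  have hzu : ∀ v ∈ C, v ∉ W → v ∉ orb R u → v = z := fun v h1 h2 h3 => by
    have : v ∈ (C \ W) \ orb R u := mem_sdiff.2 ⟨mem_sdiff.2 ⟨h1, h2⟩, h3⟩
    simpa [hz] using this
  have hzf : Fixed R z := by
    by_contra hzf
    have := h.card_orb hzf
    have h1 : orb R z ⊆ {z} := by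
      intro v hv
      have hv' := mem_sdiff.1 (h.orb_sub hzC hzW hv)
      rw [mem_singleton]
      refine hzu v hv'.1 hv'.2 fun hvu => hzX ?_
      rw [← orb_eq_of_mem hvu, orb_eq_of_mem hv]
      exact self_mem_orb _ _
    have := card_le_card h1
    rw [card_singleton] at this
    lia
  have hsplit : ∀ w ∈ W, (nb G w ∩ orb R u).card + (nb G w ∩ {z}).card = 2 := by
    intro w hw
    rw [← h.nbW w hw, ← card_union_of_disjoint]
    · have h0 := card_eq_zero.1 (h.indep hC hw)
      congr 1
      ext v
      have h0' : v ∉ nb G w ∩ W := by simp [h0]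
      simp only [mem_union, mem_inter, mem_singleton] at *
      constructor
      · rintro (⟨h1, h2⟩ | ⟨h1, rfl⟩)
        · exact ⟨h1, (mem_sdiff.1 (hX h2)).1⟩
        · exact ⟨h1, hzC⟩
      · rintro ⟨h1, h2⟩
        by_cases hv : v ∈ orb R u
        · exact Or.inl ⟨h1, hv⟩
        · exact Or.inr ⟨h1, hzu v h2 (fun h3 => h0' ⟨h1, h3⟩) hv⟩
    · rw [disjoint_left]
      intro v hv hv'
      simp only [mem_inter, mem_singleton] at hv hv'
      exact hzX (hv'.2 ▸ hv.2)
  have hd : ∃ d, (d = 1 ∨ d = 2) ∧ (∀ w ∈ W, (nb G w ∩ orb R u).card = d) ∧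
      (nb G z ∩ W).card ≠ d := by
    by_cases hzN : nb G z = W
    · refine ⟨1, Or.inl rfl, fun w hw => ?_, by rw [hzN, inter_self, h.card]; lia⟩
      have h1 := hsplit w hw
      have : nb G w ∩ {z} = {z} := by
        rw [inter_eq_right, singleton_subset_iff, mem_nb, G.adj_comm, ← mem_nb, hzN]; exact hw
      rw [this, card_singleton] at h1
      lia
    · obtain ⟨-, -, -, -, -, h0⟩ := h.nb_moved hzC hzf hzN
      refine ⟨2, Or.inr rfl, fun w hw => ?_, by lia⟩
      have h1 := hsplit w hw
      have : nb G w ∩ {z} = ∅ := by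
        rw [inter_singleton_of_notMem]
        intro hz
        rw [mem_nb, G.adj_comm, ← mem_nb] at hz
        have := Finset.card_pos.2 ⟨w, mem_inter.2 ⟨hz, hw⟩⟩
        lia
      rw [this, card_empty] at h1
      lia
  obtain ⟨d, hd, h1, h2⟩ := hd
  have hXf := h.fixed_level hH hW hu huW huf hd h1 fun v hv hvW hvX => by rwa [hzu v hv hvW hvX]
  have hinv : Inv H ((C \ W) \ orb R u) := Inv.sdiff
    (Inv.sdiff (fun k hk => h.inv k (hH hk)) (fun k hk => h.invW k (hH hk))) (inv_of_fixed hXf)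
  intro v hv
  by_cases hvW : v ∈ W
  · exact hW v hvW
  by_cases hvX : v ∈ orb R u
  · exact hXf v hvX
  rw [hzu v hv hvW hvX]
  intro k hk
  have := hinv k hk z hzm
  rw [hz] at this
  exact mem_singleton.1 this

lemma notMem_of_closed (hS : ∀ v ∈ S, orb R v ⊆ S) {u v : V}
    (hv : v ∉ S) (hu : u ∈ orb R v) : u ∉ S := fun hus => hv (hS u hus (by
  rw [orb_eq_of_mem hu]; exact self_mem_orb _ _))

/-- In a set of eleven vertices there are two moved interior orbits and two fixed vertices. -/
lemma Tri.eleven (h : Tri G C W R) (h11 : C.card = 11) :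
    ∃ u ∈ C, ∃ v ∈ C, u ∉ W ∧ v ∉ W ∧ ¬ Fixed R u ∧ ¬ Fixed R v ∧ v ∉ orb R u ∧
      (((C \ W) \ orb R u) \ orb R v).card = 2 ∧
      ∀ z ∈ ((C \ W) \ orb R u) \ orb R v, Fixed R z := by
  have hC : C ≠ W := by rintro rfl; have := h.card; lia
  obtain ⟨u, hu, huW, huf⟩ := h.exists_moved hC (by lia)
  have hX := h.orb_sub hu huW
  have hXc := h.card_orb huf
  have hcW : (C \ W).card = 8 := by rw [card_sdiff_of_subset h.sub, h.card, h11]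
  have hc1 : ((C \ W) \ orb R u).card = 5 := by rw [card_sdiff_of_subset hX, hcW, hXc]
  obtain ⟨v, hv, hvf⟩ : ∃ v ∈ (C \ W) \ orb R u, ¬ Fixed R v := by
    by_contra! hcon
    have hsub : (C \ W) \ orb R u ⊆ (C.filter fun v => nb G v = W) ∪ (nb G u \ {u}) := by
      intro z hz
      have hz' := mem_sdiff.1 hz
      have hzC := mem_sdiff.1 hz'.1
      rw [mem_union, mem_filter]
      by_cases hzN : nb G z = W
      · exact Or.inl ⟨hzC.1, hzN⟩
      · obtain ⟨u', hu', huW', huf', e, -⟩ := h.nb_moved hzC.1 (hcon z hz) hzN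
        have : u' ∈ orb R u := by
          by_contra hcon'
          exact huf' (hcon u' (mem_sdiff.2 ⟨mem_sdiff.2 ⟨hu', huW'⟩, hcon'⟩))
        rw [orb_eq_of_mem this] at e
        refine Or.inr ?_
        have : u ∈ nb G z := e ▸ self_mem_orb _ _
        rw [mem_sdiff, mem_nb, mem_singleton, G.adj_comm, ← mem_nb]
        exact ⟨this, fun e => hz'.2 (e ▸ self_mem_orb _ _)⟩
    have h1 := (card_le_card hsub).trans (card_union_le _ _)
    have h2 := h.card_attached hC (by lia)
    have h3 : (nb G u \ {u}).card ≤ 3 := (card_le_card sdiff_subset).trans (h.deg u).le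
    lia
  have hv' := mem_sdiff.1 hv
  have hvC := mem_sdiff.1 hv'.1
  have hclX : ∀ w ∈ orb R u, orb R w ⊆ orb R u := fun w hw => by rw [orb_eq_of_mem hw]
  have hY : orb R v ⊆ (C \ W) \ orb R u := fun w hw =>
    mem_sdiff.2 ⟨h.orb_sub hvC.1 hvC.2 hw, notMem_of_closed hclX hv'.2 hw⟩
  have hYc := h.card_orb hvf
  have hc2 : (((C \ W) \ orb R u) \ orb R v).card = 2 := by
    rw [card_sdiff_of_subset hY, hc1, hYc]
  refine ⟨u, hu, v, hvC.1, huW, hvC.2, huf, hvf, hv'.2, hc2, fun z hz => ?_⟩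
  by_contra hzf
  have hz1 := mem_sdiff.1 hz
  have hz2 := mem_sdiff.1 hz1.1
  have hz3 := mem_sdiff.1 hz2.1
  have hclY : ∀ w ∈ orb R v, orb R w ⊆ orb R v := fun w hw => by rw [orb_eq_of_mem hw]
  have := card_le_card (s := orb R z) (t := ((C \ W) \ orb R u) \ orb R v) fun w hw =>
    mem_sdiff.2 ⟨mem_sdiff.2 ⟨h.orb_sub hz3.1 hz3.2 hw, notMem_of_closed hclX hz2.2 hw⟩,
      notMem_of_closed hclY hz1.2 hw⟩
  rw [h.card_orb hzf, hc2] at this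
  lia

lemma Tri.bits_of_fixed_orb (hG : Cub G) (h : Tri G C W R) (h11 : C.card = 11) (hH : H ≤ aut G)
    (hW : ∀ w ∈ W, Fixed H w) {w : V} (hw : w ∈ W) (hwa : Anch G H w) {u : V}
    (hu : u ∈ C) (huW : u ∉ W) (huf : ¬ Fixed R u) (hf : ∀ x ∈ orb R u, Fixed H x) :
    ∃ t ≤ 2, Bits H C t := by
  obtain ⟨t, ht, h2t⟩ := explore_conn hG hH h.conn (h.inv.mono hH) (h.sub hw) hwa
  refine ⟨t, ?_, ht⟩
  have hX := h.orb_sub hu huW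
  have : mv H C ⊆ (C \ W) \ orb R u := by
    intro y hy
    rw [mem_mv] at hy
    exact mem_sdiff.2 ⟨mem_sdiff.2 ⟨hy.1, fun hyW => hy.2 (hW y hyW)⟩, fun hyX => hy.2 (hf y hyX)⟩
  have := card_le_card this
  rw [card_sdiff_of_subset hX, card_sdiff_of_subset h.sub, h.card, h11, h.card_orb huf] at this
  lia

/-- The case in which every boundary vertex has one neighbour in each of the two moved orbits and a
fixed vertex is adjacent to the first of them. -/
lemma Tri.bits_of_matched (hG : Cub G) (h : Tri G C W R) (hH : H ≤ aut G)
    (hW : ∀ w ∈ W, Fixed H w) {w : V} (hw : w ∈ W) (hwa : Anch G H w) {u v z : V}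
    (huf : ¬ Fixed R u) (hv : v ∈ C) (hvW : v ∉ W) (hvf : ¬ Fixed R v)
    (hvu : v ∉ orb R u) (hc : (((C \ W) \ orb R u) \ orb R v).card = 2)
    (hz : z ∈ ((C \ W) \ orb R u) \ orb R v)
    (h0 : ∀ z ∈ ((C \ W) \ orb R u) \ orb R v, (nb G z ∩ W).card = 0)
    (hwu : ∀ w ∈ W, (nb G w ∩ orb R u).card = 1) (hwv : ∀ w ∈ W, (nb G w ∩ orb R v).card = 1)
    (hzu : nb G z = orb R u) : ∃ t ≤ 2, Bits H C t := by
  have hux : ∀ x ∈ orb R u, (nb G x ∩ W).card = 1 := fun x hx => by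
    rw [h.double huf hw hx, hwu w hw]
  have hvx : ∀ x ∈ orb R v, (nb G x ∩ W).card = 1 := fun x hx => by
    rw [h.double hvf hw hx, hwv w hw]
  have eF : ((C \ W) \ orb R u) \ orb R v = (C \ W).filter fun x => (nb G x ∩ W).card = 0 := by
    ext x
    rw [mem_filter]
    constructor
    · exact fun hx => ⟨(mem_sdiff.1 (mem_sdiff.1 hx).1).1, h0 x hx⟩
    · rintro ⟨h1, h2⟩
      refine mem_sdiff.2 ⟨mem_sdiff.2 ⟨h1, fun hx => ?_⟩, fun hx => ?_⟩
      · have := hux x hx; lia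
      · have := hvx x hx; lia
  have eXY : orb R v = ((C \ W).filter fun x => (nb G x ∩ W).card = 1) \ orb R u := by
    ext x
    rw [mem_sdiff, mem_filter]
    constructor
    · exact fun hx => ⟨⟨h.orb_sub hv hvW hx, hvx x hx⟩, fun hxu =>
        disjoint_left.1 (orb_disjoint hvu) hxu hx⟩
    · rintro ⟨⟨h1, h2⟩, h3⟩
      by_contra hcon
      have := h0 x (mem_sdiff.2 ⟨mem_sdiff.2 ⟨h1, h3⟩, hcon⟩)
      lia
  have hFinv : Inv H (((C \ W) \ orb R u) \ orb R v) := by rw [eF]; exact h.inv_level hH 0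
  have hle := fx_le H {z}
  have hH' := hle.trans hH
  have hW' : ∀ w ∈ W, Fixed (fx H {z}) w := fun w hw => (hW w hw).mono hle
  have hzf : Fixed (fx H {z}) z := fixed_fx (mem_singleton_self z)
  have hXi : Inv (fx H {z}) (orb R u) := by rw [← hzu]; exact inv_nb hH' hzf
  have hXf := fixed_of_three hH' hXi hW' (h.card_orb huf) h.card (Or.inl rfl) hwu hux
  have hYi : Inv (fx H {z}) (orb R v) := by rw [eXY]; exact (h.inv_level hH' 1).sdiff hXi
  have hYf := fixed_of_three hH' hYi hW' (h.card_orb hvf) h.card (Or.inl rfl) hwv hvx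
  have hall : ∀ y ∈ C, Fixed (fx H {z}) y := by
    intro y hy
    by_cases hyW : y ∈ W
    · exact hW' y hyW
    by_cases hyu : y ∈ orb R u
    · exact hXf y hyu
    by_cases hyv : y ∈ orb R v
    · exact hYf y hyv
    by_cases hyz : y = z
    · rw [hyz]; exact hzf
    have hyF : y ∈ (((C \ W) \ orb R u) \ orb R v) \ {z} := by simp [hy, hyW, hyu, hyv, hyz]
    have hc1 : ((((C \ W) \ orb R u) \ orb R v) \ {z}).card = 1 := by
      rw [card_sdiff_of_subset (by simpa using hz), hc, card_singleton]
    have hi := (hFinv.mono hle).sdiff (inv_of_fixed (Y := {z}) (by simpa using hzf))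
    exact fun k hk => card_le_one.1 hc1.le _ (hi k hk y hyF) _ hyF
  obtain ⟨t, ht, -⟩ := explore_conn hG hH h.conn (h.inv.mono hH) (h.sub hw) hwa
  refine ⟨t, ?_, ht⟩
  have hzC : z ∈ C := (mem_sdiff.1 (mem_sdiff.1 (mem_sdiff.1 hz).1).1).1
  have e1 : fx H C = fx H {z} := by
    refine le_antisymm (fx_anti _ (by simpa)) fun k hk => ?_
    exact mem_fx.2 ⟨hle hk, fun y hy => hall y hy k hk⟩
  have e2 := card_eq_orb_mul H z
  have h2 := card_le_card (orb_subset hFinv hz)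
  rw [hc] at h2
  have hpos := card_pos (fx H {z})
  rw [Bits, e1, e2] at ht
  have ht' := Nat.eq_of_mul_eq_mul_right hpos ht
  by_contra hcon
  have : 2 ^ 3 ≤ 2 ^ t := Nat.pow_le_pow_right (by lia) (by lia)
  lia

lemma Tri.bits_eleven (hG : Cub G) (h : Tri G C W R) (h11 : C.card = 11) (hH : H ≤ aut G)
    (hW : ∀ w ∈ W, Fixed H w) {w : V} (hw : w ∈ W) (hwa : Anch G H w) : ∃ t ≤ 2, Bits H C t := by
  have hC : C ≠ W := by rintro rfl; have := h.card; lia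
  obtain ⟨u, hu, v, hv, huW, hvW, huf, hvf, hvu, hc, hf⟩ := h.eleven h11
  have hX := h.orb_sub hu huW
  have hY := h.orb_sub hv hvW
  have hXY := orb_disjoint hvu
  set F := ((C \ W) \ orb R u) \ orb R v with hF
  have hFC : F ⊆ C \ W := fun z hz => (mem_sdiff.1 (mem_sdiff.1 hz).1).1
  have hmem : ∀ x ∈ C, x ∉ W → x ∉ orb R u → x ∉ orb R v → x ∈ F := fun x h1 h2 h3 h4 =>
    mem_sdiff.2 ⟨mem_sdiff.2 ⟨mem_sdiff.2 ⟨h1, h2⟩, h3⟩, h4⟩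
  have hXF : Disjoint (orb R u ∪ orb R v) F := by
    rw [disjoint_right]
    intro x hx hx'
    rcases mem_union.1 hx' with hx' | hx'
    · exact (mem_sdiff.1 (mem_sdiff.1 hx).1).2 hx'
    · exact (mem_sdiff.1 hx).2 hx'
  have hsplit : ∀ w ∈ W, (nb G w ∩ orb R u).card + (nb G w ∩ orb R v).card + (nb G w ∩ F).card = 2 := by
    intro w hw
    rw [← h.nbW w hw, ← card_union_of_disjoint (hXY.mono inter_subset_right inter_subset_right),
      ← inter_union_distrib_left,
      ← card_union_of_disjoint (hXF.mono inter_subset_right inter_subset_right),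
      ← inter_union_distrib_left]
    have h0 := card_eq_zero.1 (h.indep hC hw)
    congr 1
    ext x
    have h0' : x ∉ nb G w ∩ W := by simp [h0]
    rw [mem_inter, mem_inter, mem_union, mem_union]
    constructor
    · rintro ⟨h1, (h2 | h2) | h2⟩
      exacts [⟨h1, (mem_sdiff.1 (hX h2)).1⟩, ⟨h1, (mem_sdiff.1 (hY h2)).1⟩,
        ⟨h1, (mem_sdiff.1 (hFC h2)).1⟩]
    · rintro ⟨h1, h2⟩
      have h3 : x ∉ W := fun h3 => h0' (mem_inter.2 ⟨h1, h3⟩)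
      refine ⟨h1, ?_⟩
      have := hmem x h2 h3
      tauto
  have hconst : ∀ u, ¬ Fixed R u → ∀ x ∈ W, (nb G x ∩ orb R u).card = (nb G w ∩ orb R u).card :=
    fun u huf x hx => by
      rw [← h.double huf hx (self_mem_orb _ _), h.double huf hw (self_mem_orb _ _)]
  have hlevF : ∀ z ∈ F, (nb G z ∩ W).card = 0 ∨ (nb G z = W ∧ (nb G z ∩ W).card = 3) := by
    intro z hz
    by_cases hzN : nb G z = W
    · exact Or.inr ⟨hzN, by rw [hzN, inter_self, h.card]⟩
    · obtain ⟨-, -, -, -, -, h0⟩ := h.nb_moved (mem_sdiff.1 (hFC hz)).1 (hf z hz) hzN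
      exact Or.inl h0
  have hFle : (nb G w ∩ F).card ≤ 1 := by
    refine le_trans (card_le_card fun z hz => ?_) (h.card_attached hC (by lia))
    rw [mem_inter, mem_nb] at hz
    rw [mem_filter]
    refine ⟨(mem_sdiff.1 (hFC hz.2)).1, ?_⟩
    rcases hlevF z hz.2 with h0 | h3
    · have : w ∈ nb G z ∩ W := by simp [hz.1.symm, hw]
      simp [card_eq_zero.1 h0] at this
    · exact h3.1
  have hs := hsplit w hw
  have hgen : ∀ {u v : V}, u ∈ C → u ∉ W → ¬ Fixed R u → ¬ Fixed R v →
      (∀ x ∈ C, x ∉ W → x ∉ orb R u → x ∉ orb R v → x ∈ F) →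
      (nb G w ∩ orb R u).card = 1 ∨ (nb G w ∩ orb R u).card = 2 →
      (nb G w ∩ orb R v).card ≠ (nb G w ∩ orb R u).card → ∃ t ≤ 2, Bits H C t := by
    intro u v hu huW huf hvf hmem hd hne
    refine h.bits_of_fixed_orb hG h11 hH hW hw hwa hu huW huf
      (h.fixed_level hH hW hu huW huf hd (hconst u huf) fun x hxC hxW hxu => ?_)
    by_cases hxv : x ∈ orb R v
    · rwa [h.double hvf hw hxv]
    · rcases hlevF x (hmem x hxC hxW hxu hxv) with h0 | ⟨-, h3⟩
      · lia
      · lia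
  by_cases h1 : (nb G w ∩ orb R u).card = (nb G w ∩ orb R v).card
  · have hF0 : ∀ x ∈ W, (nb G x ∩ F).card = 0 := fun x hx => by
      have := hsplit x hx
      rw [hconst u huf x hx, hconst v hvf x hx] at this
      lia
    have h0 : ∀ z ∈ F, (nb G z ∩ W).card = 0 := by
      intro z hz
      refine (hlevF z hz).resolve_right fun h3 => ?_
      have : z ∈ nb G w ∩ F := by
        rw [mem_inter, mem_nb, G.adj_comm, ← mem_nb, h3.1]
        exact ⟨hw, hz⟩
      simp [card_eq_zero.1 (hF0 w hw)] at this
    have hF0w := hF0 w hw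
    have hwu : ∀ x ∈ W, (nb G x ∩ orb R u).card = 1 := fun x hx => by rw [hconst u huf x hx]; lia
    have hwv : ∀ x ∈ W, (nb G x ∩ orb R v).card = 1 := fun x hx => by rw [hconst v hvf x hx]; lia
    obtain ⟨z, hz⟩ : F.Nonempty := Finset.card_pos.1 (by lia)
    have hzC := (mem_sdiff.1 (hFC hz)).1
    obtain ⟨u', hu', huW', huf', e, -⟩ := h.nb_moved hzC (hf z hz) (fun e => by
      have := h0 z hz
      rw [e, inter_self, h.card] at this
      lia)
    have hcases : u' ∈ orb R u ∨ u' ∈ orb R v := by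
      by_contra! hcon
      exact huf' (hf u' (hmem u' hu' huW' hcon.1 hcon.2))
    rcases hcases with hm | hm
    · exact h.bits_of_matched hG hH hW hw hwa huf hv hvW hvf hvu hc hz h0 hwu hwv
        (by rw [e, orb_eq_of_mem hm])
    · have hswap : ((C \ W) \ orb R v) \ orb R u = F := by rw [hF, sdiff_right_comm]
      refine h.bits_of_matched hG hH hW hw hwa hvf hu huW huf
        (fun hm => hvu (by rw [orb_eq_of_mem hm]; exact self_mem_orb _ _))
        (by rw [hswap]; exact hc) (z := z) (by rw [hswap]; exact hz) (by rw [hswap]; exact h0) hwv hwu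
        (by rw [e, orb_eq_of_mem hm])
  · by_cases h2 : (nb G w ∩ orb R u).card = 0
    · exact hgen hv hvW hvf huf (fun x a b c d => hmem x a b d c) (by lia) h1
    · exact hgen hu huW huf hvf hmem (by lia) (Ne.symm h1)

lemma Perfect.cases {h : ℕ} (hp : Perfect h) : h = 3 ∨ h = 6 ∨ 4 ∣ h := by
  obtain ⟨k, hk⟩ := hp
  match k, hk with
  | 0, hk => rcases hk with rfl | rfl <;> simp
  | 1, hk => rcases hk with rfl | rfl <;> simp
  | k + 2, hk =>
    refine Or.inr (Or.inr ?_)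
    rcases hk with rfl | rfl
    · exact ⟨3 * 2 ^ k, by ring⟩
    · exact ⟨4 * 2 ^ k, by ring⟩

lemma Perfect.not_five_dvd {h : ℕ} (hp : Perfect h) : ¬ 5 ∣ h := by
  obtain ⟨k, hk⟩ := hp
  intro h5
  have h2 : ¬ 5 ∣ 2 ^ k := fun h => by
    have := Nat.prime_five.dvd_of_dvd_pow h
    lia
  rcases hk with rfl | rfl <;> rcases (Nat.prime_five.dvd_mul).1 h5 with h | h <;> lia

lemma card_core_cases {N h c : ℕ} (hN : Shape N) (hp : Perfect h) (e : c + 6 * h = 2 * N + 3) :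
    c = 7 ∨ c = 11 ∨ 16 ≤ c := by
  obtain ⟨k, hk⟩ := hN.four_dvd
  have := hN.le
  have h5 := hp.not_five_dvd
  rcases hp.cases with rfl | rfl | ⟨j, rfl⟩
  · lia
  · lia
  · by_cases h3 : c = 3
    · lia
    · lia

lemma Bits.le_succ {x : V} {b b' : ℕ} (hb : Bits K Y b) (hb' : Bits (fx K {x}) Y b') (hx : x ∈ Y)
    (h2 : (orb K x).card ≤ 2) : b ≤ b' + 1 := by
  have e := card_eq_orb_mul K x
  rw [Bits, fx_fx, union_eq_right.2 (by simpa)] at hb'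
  rw [hb', hb, ← mul_assoc] at e
  have e' := Nat.eq_of_mul_eq_mul_right (card_pos (fx K Y)) e
  have : 2 ^ b ≤ 2 ^ (b' + 1) := by
    rw [e', pow_succ, mul_comm _ 2]
    exact Nat.mul_le_mul_right _ h2
  exact (Nat.pow_le_pow_iff_right (by lia)).1 this

lemma card_nb_par (hG : Cub G) (hn : 4 ∣ Fintype.card V) (hC : (core G).card ≠ 1) {r : V}
    (hr : r ∈ roots G) : (nb G (par G r) ∩ core G).card = 2 := by
  have h1 := two_core_nb hG hn hC (par_mem hr)
  have h2 := card_nb_inter_add_le hG (par G r) (X := core G) (Y := {r}) (by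
    rw [disjoint_singleton_right]; exact (mem_roots.1 hr).1)
  rw [inter_singleton_of_mem (by simpa using adj_par hr), card_singleton] at h2
  lia

lemma exists_order_three {A : Subgroup (Equiv.Perm V)} (h : 3 ∣ Nat.card A) :
    ∃ R ≤ A, Nat.card R = 3 := by
  have : Fact (Nat.Prime 3) := ⟨Nat.prime_three⟩
  obtain ⟨x, hx⟩ := exists_prime_orderOf_dvd_card' 3 h
  refine ⟨Subgroup.zpowers (x : Equiv.Perm V), by simp, ?_⟩
  rw [Nat.card_zpowers, Subgroup.orderOf_coe, hx]

lemma tri_core (hG : Cub G) (hn : 4 ∣ Fintype.card V) (hC : (core G).card ≠ 1)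
    (hc : (roots G).card = 3) (hA : ∀ r ∈ roots G, orb (aut G) r = roots G)
    (h2 : ∀ r ∈ roots G, ∃ s, Nat.card (fx (aut G) {r}) = 2 ^ s) :
    ∃ R, Tri G (core G) ((roots G).image (par G)) R := by
  obtain ⟨r, hr⟩ : (roots G).Nonempty := Finset.card_pos.1 (by lia)
  obtain ⟨R, hRA, hR⟩ := exists_order_three (A := aut G) (by
    rw [card_eq_orb_mul _ r, hA r hr, hc]; exact dvd_mul_right _ _)
  have horb : ∀ v, (orb R v).card = 1 ∨ (orb R v).card = 3 := fun v => by
    rw [← Nat.dvd_prime Nat.prime_three, ← hR, card_eq_orb_mul R v]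
    exact dvd_mul_right _ _
  have hinv : Inv (aut G) ((roots G).image (par G)) := by
    intro k hk y hy
    obtain ⟨r, hr, rfl⟩ := mem_image.1 hy
    rw [← par_map hk hr]
    exact mem_image_of_mem _ (inv_roots k hk r hr)
  have hcard : ((roots G).image (par G)).card = 3 := by
    rw [card_image_of_injOn (par_injOn hG hn hC), hc]
  refine ⟨R, hG.deg, conn_core hG, ?_, hcard, ?_, ?_, hRA, inv_core, hinv, ?_, horb⟩
  · exact image_subset_iff.2 fun r hr => par_mem hr
  · intro w hw
    obtain ⟨r, hr, rfl⟩ := mem_image.1 hw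
    exact card_nb_par hG hn hC hr
  · intro v hv hvW u hu
    by_contra huC
    rw [mem_nb] at hu
    have hur : u ∈ roots G := mem_roots.2 ⟨huC, v, hv, hu⟩
    exact hvW (mem_image.2 ⟨u, hur, (par_eq hur hv hu).symm⟩)
  · intro w hw
    refine eq_of_subset_of_card_le (orb_subset (hinv.mono hRA) hw) ?_
    rcases horb w with h1 | h3
    · exfalso
      obtain ⟨r, hr, rfl⟩ := mem_image.1 hw
      have hf := fixed_root hG hn hC hRA hr (fixed_of_card_orb h1)
      obtain ⟨s, hs⟩ := h2 r hr
      have hle : R ≤ fx (aut G) {r} := fun k hk =>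
        mem_fx.2 ⟨hRA hk, fun s hs => by rw [mem_singleton.1 hs]; exact hf k hk⟩
      have := Subgroup.card_dvd_of_le hle
      rw [hR, hs] at this
      have := Nat.prime_three.dvd_of_dvd_pow this
      lia
    · rw [h3, hcard]

lemma bits_of_three_roots (hG : Cub G) {N : ℕ} (hN : Shape N) (hV : Fintype.card V = 2 * N)
    (hC : (core G).card ≠ 1) (hc : (roots G).card = 3)
    (hA : ∀ r ∈ roots G, orb (aut G) r = roots G)
    (h2 : ∀ r ∈ roots G, ∃ s, Nat.card (fx (aut G) {r}) = 2 ^ s) {r : V} (hr : r ∈ roots G)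
    (hp : Perfect (hgt G r)) {b : ℕ} (hb : Bits (fx (aut G) {r}) (core G) b) :
    2 * b + 5 ≤ (core G).card := by
  have hn : 4 ∣ Fintype.card V := by
    obtain ⟨k, hk⟩ := hN.four_dvd
    exact ⟨10 * k, by lia⟩
  have hK := fx_le (aut G) {r}
  set K := fx (aut G) {r} with hKdef
  have hrf : Fixed K r := fixed_fx (mem_singleton_self r)
  have hwf := fixed_par hK hr hrf
  have hsum : ∑ x ∈ roots G, hgt G x = 3 * hgt G r := by
    rw [sum_congr rfl (g := fun _ => hgt G r), sum_const, hc, smul_eq_mul]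
    intro x hx
    rw [← hA r hr] at hx
    obtain ⟨k, hk, rfl⟩ := mem_orb.1 hx
    exact hgt_map hG hk hr
  have hcard := card_eq_core hG
  rw [hsum, hV, hc] at hcard
  obtain ⟨R, hT⟩ := tri_core hG hn hC hc hA h2
  obtain ⟨r', hr', hne⟩ := exists_mem_ne (s := roots G) (by lia) r
  have hpp : par G r' ≠ par G r := fun e => hne (par_injOn hG hn hC hr' hr e)
  set W := (roots G).image (par G) with hW
  have hwW : par G r ∈ W := mem_image_of_mem _ hr
  have hwW' : par G r' ∈ W := mem_image_of_mem _ hr'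
  have hWi : Inv K (W \ {par G r}) := (hT.invW.mono hK).sdiff (inv_of_fixed (by simpa using hwf))
  have hWm : par G r' ∈ W \ {par G r} := by simp [hwW', hpp]
  have hWc : (W \ {par G r}).card = 2 := by
    rw [card_sdiff_of_subset (by simpa), hT.card, card_singleton]
  have horb2 : (orb K (par G r')).card ≤ 2 := hWc ▸ card_le_card (orb_subset hWi hWm)
  have hle := fx_le K {par G r'}
  have hH := hle.trans hK
  have hf' : Fixed (fx K {par G r'}) (par G r') := fixed_fx (mem_singleton_self _)
  have hWf : ∀ w ∈ W, Fixed (fx K {par G r'}) w := by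
    intro w hw
    by_cases h1 : w = par G r
    · rw [h1]; exact hwf.mono hle
    by_cases h2 : w = par G r'
    · rw [h2]; exact hf'
    have hm : w ∈ (W \ {par G r}) \ {par G r'} := by simp [hw, h1, h2]
    have hi := (hWi.mono hle).sdiff (inv_of_fixed (Y := {par G r'}) (by simpa using hf'))
    have hc1 : ((W \ {par G r}) \ {par G r'}).card = 1 := by
      rw [card_sdiff_of_subset (by simpa using hWm), hWc, card_singleton]
    exact fun k hk => card_le_one.1 hc1.le _ (hi k hk w hm) _ hm
  rcases card_core_cases hN hp (c := (core G).card) (by lia) with h7 | h11 | h16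
  · have := hb.le_succ (Bits.zero (hT.fixed_seven h7 hH hWf)) (hT.sub hwW') horb2
    lia
  · obtain ⟨t, ht2, ht⟩ := hT.bits_eleven hG h11 hH hWf hwW
      ⟨hWf _ hwW, r, adj_par hr, hrf.mono hle⟩
    have := hb.le_succ ht (hT.sub hwW') horb2
    lia
  · obtain ⟨x, y, hxy, hN⟩ := card_eq_two.1 (card_nb_par hG hn hC hr)
    have hNi : Inv K (nb G (par G r) ∩ core G) := fun k hk v hv => by
      rw [mem_inter] at *
      exact ⟨inv_nb hK hwf k hk v hv.1, inv_core k (hK hk) v hv.2⟩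
    have hx : x ∈ nb G (par G r) ∩ core G := by simp [hN]
    have hy : y ∈ nb G (par G r) ∩ core G := by simp [hN]
    have ho : (orb K x).card ≤ 2 := by
      rw [← card_nb_par hG hn hC hr]; exact card_le_card (orb_subset hNi hx)
    rw [mem_inter, mem_nb] at hx hy
    have hle := fx_le K {x}
    have hxf : Fixed (fx K {x}) x := fixed_fx (mem_singleton_self _)
    have hyf : Fixed (fx K {x}) y := by
      intro k hk
      have := hNi k (hle hk) y (by simp [hN])
      rw [hN, mem_insert, mem_singleton] at this
      refine this.resolve_left fun e => hxy (k.injective ?_)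
      rw [e, hxf k hk]
    obtain ⟨b', hb', hle'⟩ := (earRate hG).bits_two hG hn (hle.trans hK) (par_mem hr) hx.2 hy.2 hx.1
      hy.1 hxy hN (hwf.mono hle) hxf hyf
    have := hb.le_succ hb' hx.2 ho
    lia

lemma exists_fixed_of_odd {s : ℕ} (hs : Nat.card K = 2 ^ s) :
    ∀ {T : Finset V}, Inv K T → Odd T.card → ∃ x ∈ T, Fixed K x := by
  intro T
  induction T using Finset.strongInduction with
  | H T ih =>
    intro hT ho
    obtain ⟨x, hx⟩ : T.Nonempty := Finset.card_pos.1 ho.pos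
    by_cases hf : Fixed K x
    · exact ⟨x, hx, hf⟩
    have hd : (orb K x).card ∣ 2 ^ s := ⟨_, hs ▸ card_eq_orb_mul K x⟩
    obtain ⟨j, -, hj⟩ := (Nat.dvd_prime_pow Nat.prime_two).1 hd
    have hj0 : j ≠ 0 := fun e => hf (fixed_of_card_orb (by rw [hj, e, pow_zero]))
    have hev : Even (orb K x).card := by rw [hj]; exact (even_two).pow_of_ne_zero hj0
    have hsub := orb_subset hT hx
    have hss : T \ orb K x ⊂ T :=
      sdiff_ssubset hsub ⟨x, self_mem_orb K x⟩
    obtain ⟨y, hy, hyf⟩ := ih _ hss (hT.sdiff (inv_orb K x)) (by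
      rw [card_sdiff_of_subset hsub]
      exact Nat.Odd.sub_even (card_le_card hsub) ho hev)
    exact ⟨y, (mem_sdiff.1 hy).1, hyf⟩

lemma sixteen_mul_odd_le : ∀ k, 4 ≤ k → 16 * (2 * k + 1) ≤ 5 * 2 ^ (k + 1)
  | 4, _ => by norm_num
  | k + 5, _ => by
    have := sixteen_mul_odd_le (k + 4) (by lia)
    rw [pow_succ]
    lia

/-- The order of the automorphism group in terms of the orbit of a root. -/
lemma card_of_root (hG : Cub G) (hn : 4 ∣ Fintype.card V) (hC : (core G).card ≠ 1) {r : V}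
    (hr : r ∈ roots G) :
    ∃ b s, Bits (fx (aut G) {r}) (core G) b ∧ Nat.card (fx (aut G) {r}) = 2 ^ s ∧
      2 * b + 1 ≤ (core G).card ∧
      2 * s + (core G).card + (roots G).card + 2 * ∑ r ∈ roots G, eps G r ≤ 2 * b + Fintype.card V := by
  have hK := fx_le (aut G) {r}
  have hrf : Fixed (fx (aut G) {r}) r := fixed_fx (mem_singleton_self r)
  have hwf := fixed_par hK hr hrf
  obtain ⟨b, hb, hbc⟩ := explore_conn hG hK (conn_core hG) (inv_core.mono hK) (par_mem hr)
    ⟨hwf, r, adj_par hr, hrf⟩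
  obtain ⟨s, hs, hsb⟩ := card_of_bits_core hG hn hC hK hb
  have : mv (fx (aut G) {r}) (core G) ⊆ (core G).erase (par G r) := fun v hv => by
    rw [mem_mv] at hv
    exact mem_erase.2 ⟨fun e => hv.2 (e ▸ hwf), hv.1⟩
  have := card_le_card this
  rw [card_erase_of_mem (par_mem hr)] at this
  have := Finset.card_pos.2 ⟨_, par_mem hr⟩
  exact ⟨b, s, hb, hs, by lia, hsb⟩

/-- If the core is small then it contains few of the vertices outside the branches. -/
lemma lt_card_core (hG : Cub G) (h1 : (roots G).card = 1) : Fintype.card V < 2 * (core G).card := by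
  obtain ⟨r, hr⟩ := card_eq_one.1 h1
  have hrr : r ∈ roots G := by simp [hr]
  have h2 := card_eq_core hG
  have h3 := card_branch hG hrr
  have h4 := (small_branch hrr).2
  rw [h1, hr, sum_singleton] at h2
  lia

lemma bound_of_root (hG : Cub G) {N : ℕ} (hN : Shape N) (hV : Fintype.card V = 2 * N)
    (hC : (core G).card ≠ 1) (hne : (roots G).Nonempty) :
    16 * Nat.card (aut G) ≤ 5 * 2 ^ N := by
  have hN20 := hN.le
  obtain ⟨k20, hk20⟩ := hN.four_dvd
  have hn : 4 ∣ Fintype.card V := ⟨10 * k20, by lia⟩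
  obtain ⟨r, hr, hmin⟩ := (roots G).exists_min_image (fun r => (orb (aut G) r).card) hne
  have hsub := orb_subset inv_roots hr
  have ho : (orb (aut G) r).card = (roots G).card ∨
      2 * (orb (aut G) r).card ≤ (roots G).card := by
    by_contra! hcon
    obtain ⟨r', hr', hrr⟩ := exists_of_ssubset (hsub.ssubset_of_ne fun e => hcon.1 (by rw [e]))
    have h1 := hmin r' hr'
    have h2 := card_union_of_disjoint (orb_disjoint hrr)
    have h3 := card_le_card (union_subset hsub (orb_subset inv_roots hr'))
    lia
  have hopos : 0 < (orb (aut G) r).card := Finset.card_pos.2 ⟨r, self_mem_orb _ r⟩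
  obtain ⟨b, s, hb, hs, hbc, hsb⟩ := card_of_root hG hn hC hr
  have hcard := card_eq_core hG
  rw [card_eq_orb_mul (aut G) r, hs]
  have hK := fx_le (aut G) {r}
  have hrf : Fixed (fx (aut G) {r}) r := fixed_fx (mem_singleton_self r)
  have htight : 2 * b + 1 = (core G).card → (core G).card ≤ 7 ∧ (roots G).card ≤ 4 :=
    tight_one hG hn hC hK hr hrf hb
  have hone : (roots G).card = 1 → N < (core G).card := fun h => by
    have := lt_card_core hG h; lia
  by_cases h8 : 8 ≤ (roots G).card
  · obtain ⟨k, hk | hk⟩ := Nat.even_or_odd' (roots G).card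
    · exact sixteen_mul_le (E := k + 1) (by have := sixteen_mul_odd_le k (by lia); lia) (by lia)
    · exact sixteen_mul_le (E := k + 1) (by have := sixteen_mul_odd_le k (by lia); lia) (by lia)
  rcases ho with ho | ho
  swap
  · obtain hc | hc | hc | hc | hc | hc : (roots G).card = 2 ∨ (roots G).card = 3 ∨
      (roots G).card = 4 ∨ (roots G).card = 5 ∨ (roots G).card = 6 ∨ (roots G).card = 7 := by lia
    · exact sixteen_mul_le (E := 2) (by lia) (by lia)
    · exact sixteen_mul_le (E := 2) (by lia) (by lia)
    · exact sixteen_mul_le (E := 3) (by lia) (by lia)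
    · exact sixteen_mul_le (E := 3) (by lia) (by lia)
    · exact sixteen_mul_le (E := 4) (by lia) (by lia)
    · exact sixteen_mul_le (E := 4) (by lia) (by lia)
  have hor : orb (aut G) r = roots G := eq_of_subset_of_card_le hsub ho.ge
  have hconst : ∀ x ∈ roots G, hgt G x = hgt G r := by
    intro x hx
    rw [← hor] at hx
    obtain ⟨k, hk, rfl⟩ := mem_orb.1 hx
    exact hgt_map hG hk hr
  rw [sum_congr rfl hconst, sum_const, smul_eq_mul] at hcard
  by_cases hp : Perfect (hgt G r)
  swap
  · have : ∑ r ∈ roots G, eps G r = (roots G).card := by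
      rw [sum_congr rfl (g := fun _ => 1), sum_const, smul_eq_mul, mul_one]
      exact fun x hx => by rw [eps, hconst x hx, if_neg hp]
    rw [this] at hsb
    obtain hc | hc | hc | hc | hc | hc | hc : (roots G).card = 1 ∨ (roots G).card = 2 ∨
      (roots G).card = 3 ∨ (roots G).card = 4 ∨ (roots G).card = 5 ∨ (roots G).card = 6 ∨
      (roots G).card = 7 := by lia
    · exact sixteen_mul_le (E := 2) (by lia) (by lia)
    · exact sixteen_mul_le (E := 3) (by lia) (by lia)
    · exact sixteen_mul_le (E := 4) (by lia) (by lia)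
    · exact sixteen_mul_le (E := 4) (by lia) (by lia)
    · exact sixteen_mul_le (E := 4) (by lia) (by lia)
    · exact sixteen_mul_le (E := 5) (by lia) (by lia)
    · exact sixteen_mul_le (E := 5) (by lia) (by lia)
  have heven : Even (roots G).card → 2 * b + 2 = (core G).card →
      (core G).card = 4 ∨ (core G).card = 6 ∧ (roots G).card ≤ 2 := by
    intro he h2
    obtain ⟨r', hr', hf⟩ := exists_fixed_of_odd hs (T := (roots G).erase r)
      (by
        rw [← sdiff_singleton_eq_erase]
        exact (inv_roots.mono hK).sdiff (inv_of_fixed (by simpa using hrf)))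
      (by
        rw [card_erase_of_mem hr]
        exact Nat.Even.sub_odd (by lia) he odd_one)
    rw [mem_erase] at hr'
    exact tight_two hG hn hC hK hr hr'.2 (Ne.symm hr'.1) hrf hf hb h2
  have h5 := hp.not_five_dvd
  have hodd := fun h => hp.eq_three (h := hgt G r) h
  obtain hc | hc | hc | hc | hc | hc | hc : (roots G).card = 1 ∨ (roots G).card = 2 ∨
      (roots G).card = 3 ∨ (roots G).card = 4 ∨ (roots G).card = 5 ∨ (roots G).card = 6 ∨
      (roots G).card = 7 := by lia
  · rw [hc] at hcard hsb ho htight hone heven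
    exact sixteen_mul_le (E := 2) (by lia) (by lia)
  · rw [hc] at hcard hsb ho htight hone heven
    have := heven (by decide)
    exact sixteen_mul_le (E := 3) (by lia) (by lia)
  · have horb : ∀ x ∈ roots G, orb (aut G) x = roots G := fun x hx => by
      rw [orb_eq_of_mem (x := r) (by rw [hor]; exact hx), hor]
    have := bits_of_three_roots hG hN hV hC hc horb (fun x hx => by
      obtain ⟨-, s, -, hs, -⟩ := card_of_root hG hn hC hx
      exact ⟨s, hs⟩) hr hp hb
    rw [hc] at hcard hsb ho htight hone heven
    exact sixteen_mul_le (E := 4) (by lia) (by lia)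
  · rw [hc] at hcard hsb ho htight hone heven
    have := heven (by decide)
    exact sixteen_mul_le (E := 4) (by lia) (by lia)
  · rw [hc] at hcard hsb ho htight hone heven
    exact sixteen_mul_le (E := 4) (by lia) (by lia)
  · rw [hc] at hcard hsb ho htight hone heven
    have := heven (by decide)
    exact sixteen_mul_le (E := 5) (by lia) (by lia)
  · rw [hc] at hcard hsb ho htight hone heven
    exact sixteen_mul_le (E := 5) (by lia) (by lia)

/-- The stabilizer of the vertices `v` and `u`. -/
def arcStab (G : SimpleGraph V) (v u : V) : Subgroup (Equiv.Perm V) := fx (fx (aut G) {v}) {u}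

lemma arcStab_le (v u : V) : arcStab G v u ≤ aut G := (fx_le _ _).trans (fx_le _ _)

lemma fixed_arcStab (v u : V) : Fixed (arcStab G v u) v ∧ Fixed (arcStab G v u) u :=
  ⟨(fixed_fx (mem_singleton_self v)).mono (fx_le _ _), fixed_fx (mem_singleton_self u)⟩

lemma card_of_arc {v u : V} {t : ℕ} (h : Bits (arcStab G v u) univ t) :
    Nat.card (aut G) = (orb (aut G) v).card * (orb (fx (aut G) {v}) u).card * 2 ^ t := by
  rw [card_eq_orb_mul (aut G) v, card_eq_orb_mul (fx (aut G) {v}) u, mul_assoc]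
  have : Nat.card (arcStab G v u) = 2 ^ t * Nat.card (fx (arcStab G v u) univ) := h
  rw [fx_univ, mul_one] at this
  rw [← this]; rfl

lemma orb_card_le_three (hG : Cub G) {v u : V} (h : G.Adj v u) :
    (orb (fx (aut G) {v}) u).card ≤ 3 := by
  rw [← hG.deg v]
  exact card_le_card (orb_subset (inv_nb (fx_le _ _) (fixed_fx (mem_singleton_self v))) (by simpa))

lemma exists_third (hG : Cub G) {w a b : V} (ha : G.Adj w a) (hb : G.Adj w b) (hab : a ≠ b) :
    ∃ c, c ≠ a ∧ c ≠ b ∧ G.Adj w c ∧ nb G w = {a, b, c} := by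
  obtain ⟨c, hc⟩ : ((nb G w) \ {a, b}).Nonempty := by
    rw [← Finset.card_pos]
    have := le_card_sdiff {a, b} (nb G w)
    rw [card_pair hab, hG.deg] at this
    lia
  simp only [mem_sdiff, mem_insert, mem_singleton, not_or, mem_nb] at hc
  exact ⟨c, hc.2.1, hc.2.2, hc.1, card_three (hG.deg w) (by simpa) (by simpa) (by simpa using hc.1)
    hab (Ne.symm hc.2.1) (Ne.symm hc.2.2)⟩

lemma eq_univ_of_closed (hG : Cub G) (hne : S.Nonempty) (h : ∀ s ∈ S, ∀ t, G.Adj s t → t ∈ S) :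
    S = univ := by
  by_contra hS
  obtain ⟨p, hp, q, -, hq, hpq⟩ := hG.conn S (subset_univ _) hne hS
  exact hq (h p hp q hpq)

/-- Exploring the graph from a fixed arc. -/
lemma explore_arc (hG : Cub G) (hK : K ≤ aut G) {v u : V} (huv : G.Adj v u) (hv : Fixed K v)
    (hu : Fixed K u) (μ : V → ℕ) (c : ℕ)
    (h : ∀ H ≤ K, ∀ p u q q', Fixed H p → Fixed H u → G.Adj p u → G.Adj p q → G.Adj p q' →
      nb G p = {u, q, q'} → u ≠ q → u ≠ q' → q' ≠ q → ¬ Fixed H q → ¬ Fixed H q' →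
      Fixed (fx H {q}) q' → (∃ k ∈ H, k q = q' ∧ k q' = q) →
      ∃ D : Finset V, (∀ d ∈ D, ¬ Fixed H d) ∧ (∀ d ∈ D, Fixed (fx H {q}) d) ∧ c ≤ ∑ d ∈ D, μ d) :
    ∃ t, Bits K univ t ∧ c * t + μ v + μ u ≤ ∑ w, μ w := by
  obtain ⟨t, ht, hle⟩ := explore K univ μ c fun H hHK hm => by
    obtain ⟨p, -, q, -, ⟨hpf, u, hpu, huf⟩, hpq, hqf⟩ := exists_moved_of_conn hG.conn
      (mem_univ v) ((show Anch G K v from ⟨hv, u, huv, hu⟩).mono hHK) hm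
    obtain ⟨q', hne, h1, h2, hN, ho, hf', k, hk, e1, e2⟩ :=
      pair_of_moved (hHK.trans hK) (hG.deg p) hpf huf hpu hpq hqf
    obtain ⟨D, hD1, hD2, hD⟩ := h H hHK p u q q' hpf huf hpu hpq
      (mem_nb.1 (by rw [hN]; simp)) hN h1 h2 hne hqf
      (not_fixed_of_swap hk e2 hne.symm) hf' ⟨k, hk, e1, e2⟩
    refine ⟨q, mem_univ _, hqf, by rw [ho, card_pair hne.symm], ?_⟩
    have := card_add_sum_le (μ := μ) (fx_le H {q}) (subset_univ D) hD1 hD2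
    lia
  refine ⟨t, ht, ?_⟩
  have : ∑ y ∈ mv K univ, μ y + ∑ y ∈ {v, u}, μ y ≤ ∑ w, μ w := by
    rw [← sum_union]
    · exact sum_le_sum_of_subset (subset_univ _)
    · rw [disjoint_left]; intro y hy hy'
      simp only [mem_insert, mem_singleton] at hy'
      rcases hy' with rfl | rfl
      exacts [(mem_mv.1 hy).2 hv, (mem_mv.1 hy).2 hu]
  rw [sum_pair huv.ne] at this
  lia

/-- The stabilizer of `w` is transitive on the neighbours of `w`. -/
def Loc (G : SimpleGraph V) (w : V) : Prop :=
  ∀ u u', G.Adj w u → G.Adj w u' → ∃ k ∈ aut G, k w = w ∧ k u = u'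

lemma Loc.of_orb {v w : V} (h : Loc G v) (hw : w ∈ orb (aut G) v) : Loc G w := by
  obtain ⟨g, hg, rfl⟩ := mem_orb.1 hw
  intro u u' hu hu'
  have key : ∀ x, G.Adj (g v) x → G.Adj v (g⁻¹ x) := fun x hx => by
    have := ((aut G).inv_mem hg)
    rw [mem_aut] at this
    have := (this (g v) x).2 hx
    simpa using this
  obtain ⟨k, hk, e1, e2⟩ := h _ _ (key u hu) (key u' hu')
  refine ⟨g * k * g⁻¹, mul_mem (mul_mem hg hk) (inv_mem hg), by simp [e1], ?_⟩
  change g (k (g⁻¹ u)) = u'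
  rw [e2]; simp

lemma exists_fixed_of_not_loc (hG : Cub G) {w : V} (h : ¬ Loc G w) :
    ∃ u, G.Adj w u ∧ Fixed (fx (aut G) {w}) u := by
  by_contra! hcon
  apply h
  intro u u' hu hu'
  set K := fx (aut G) {w} with hKdef
  have hinv : Inv K (nb G w) := inv_nb (fx_le _ _) (fixed_fx (mem_singleton_self w))
  by_contra! hno
  have hu'o : u' ∉ orb K u := fun hm => by
    obtain ⟨k, hk, e⟩ := mem_orb.1 hm
    exact hno k hk.1 (hk.2 w (by simp)) e
  have hd := orb_disjoint hu'o
  have h2 : ∀ x, G.Adj w x → 2 ≤ (orb K x).card := fun x hx => by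
    by_contra hlt
    refine hcon x hx (fixed_of_card_orb ?_)
    have := Finset.card_pos.2 ⟨x, self_mem_orb K x⟩
    lia
  have := card_union_of_disjoint hd
  have h4 := card_le_card (union_subset (orb_subset hinv (mem_nb.2 hu)) (orb_subset hinv (mem_nb.2 hu')))
  have := h2 u hu; have := h2 u' hu'; have := hG.deg w
  lia

lemma Loc.pair (hG : Cub G) {w a b a' b' : V} (h : Loc G w) (ha : G.Adj w a) (hb : G.Adj w b)
    (hab : a ≠ b) (ha' : G.Adj w a') (hb' : G.Adj w b') (hab' : a' ≠ b') :
    ∃ k ∈ aut G, k w = w ∧ (k a = a' ∧ k b = b' ∨ k a = b' ∧ k b = a') := by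
  obtain ⟨c, hca, hcb, hc, hN⟩ := exists_third hG ha hb hab
  obtain ⟨c', hca', hcb', hc', hN'⟩ := exists_third hG ha' hb' hab'
  obtain ⟨k, hk, e1, e2⟩ := h c c' hc hc'
  have key : ∀ x, G.Adj w x → x ≠ c → k x = a' ∨ k x = b' := fun x hx hxc => by
    have h1 : k x ∈ nb G w := by
      rw [mem_nb]; have := (mem_aut.1 hk w x).2 hx; rwa [e1] at this
    have h2 : k x ≠ c' := fun e => hxc (k.injective (e.trans e2.symm))
    rw [hN'] at h1
    simp only [mem_insert, mem_singleton] at h1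
    tauto
  refine ⟨k, hk, e1, ?_⟩
  have h3 : k a ≠ k b := fun e => hab (k.injective e)
  rcases key a ha hca.symm with h1 | h1 <;> rcases key b hb hcb.symm with h2 | h2
  · exact absurd (h1.trans h2.symm) h3
  · exact Or.inl ⟨h1, h2⟩
  · exact Or.inr ⟨h1, h2⟩
  · exact absurd (h1.trans h2.symm) h3

/-- Any two neighbours of `w` lie together with `w` on a cycle of length four. -/
def Sq (G : SimpleGraph V) (w : V) : Prop :=
  ∀ a b, G.Adj w a → G.Adj w b → a ≠ b → ∃ z, z ≠ w ∧ G.Adj a z ∧ G.Adj b z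

lemma Loc.sq (hG : Cub G) {w a b z : V} (h : Loc G w) (ha : G.Adj w a) (hb : G.Adj w b)
    (hab : a ≠ b) (hz : z ≠ w) (haz : G.Adj a z) (hbz : G.Adj b z) : Sq G w := by
  intro a' b' ha' hb' hab'
  obtain ⟨k, hk, e1, e2⟩ := h.pair hG ha hb hab ha' hb' hab'
  have h1 := (mem_aut.1 hk a z).2 haz
  have h2 := (mem_aut.1 hk b z).2 hbz
  have hz' : k z ≠ w := fun e => hz (k.injective (e.trans e1.symm))
  rcases e2 with ⟨ea, eb⟩ | ⟨ea, eb⟩ <;> rw [ea] at h1 <;> rw [eb] at h2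
  exacts [⟨k z, hz', h1, h2⟩, ⟨k z, hz', h2, h1⟩]

/-- No other vertex has the same neighbours as `a`. -/
def NoTwin (G : SimpleGraph V) (a : V) : Prop := ∀ c, c ≠ a → nb G c ≠ nb G a

/-- A cubic graph which looks like a cube near `a` is small. -/
lemma card_le_eight_of_sq (hG : Cub G) {a : V} (ha : Sq G a) (htw : NoTwin G a)
    (hsq : ∀ b b' c x, G.Adj a b → G.Adj a b' → b ≠ b' → c ≠ a → G.Adj c b → G.Adj c b' →
      G.Adj c x → x ≠ b → x ≠ b' → Sq G x) : Fintype.card V ≤ 8 := by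
  obtain ⟨b1, b2, b3, h12, h13, h23, hN⟩ := card_eq_three.1 (hG.deg a)
  have hb : ∀ x, G.Adj a x ↔ x = b1 ∨ x = b2 ∨ x = b3 := fun x => by
    rw [← mem_nb, hN]; simp
  have a1 : G.Adj a b1 := by simp [hb]
  have a2 : G.Adj a b2 := by simp [hb]
  have a3 : G.Adj a b3 := by simp [hb]
  obtain ⟨c12, n12, p1, p2⟩ := ha b1 b2 a1 a2 h12
  obtain ⟨c13, n13, q1, q3⟩ := ha b1 b3 a1 a3 h13
  obtain ⟨c23, n23, r2, r3⟩ := ha b2 b3 a2 a3 h23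
  have twin : ∀ c, c ≠ a → G.Adj b1 c → G.Adj b2 c → G.Adj b3 c → False := fun c hc h1 h2 h3 =>
    htw c hc (by
      rw [hN]
      exact card_three (hG.deg c) (by simpa using h1.symm) (by simpa using h2.symm)
        (by simpa using h3.symm) h12 h13 h23)
  have d1 : c12 ≠ c13 := fun e => twin c12 n12 p1 p2 (e ▸ q3)
  have d2 : c12 ≠ c23 := fun e => twin c12 n12 p1 p2 (e ▸ r3)
  have d3 : c13 ≠ c23 := fun e => twin c13 n13 q1 (e ▸ r2) q3
  have hN1 := card_three (hG.deg b1) (by simpa using a1.symm) (by simpa using p1) (by simpa using q1)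
    n12.symm n13.symm d1
  have hN2 := card_three (hG.deg b2) (by simpa using a2.symm) (by simpa using p2) (by simpa using r2)
    n12.symm n23.symm d2
  have hN3 := card_three (hG.deg b3) (by simpa using a3.symm) (by simpa using q3) (by simpa using r3)
    n13.symm n23.symm d3
  obtain ⟨x, hx1, hx2, hx, hNc⟩ := exists_third hG p1.symm p2.symm h12
  have hxs := hsq b1 b2 c12 x a1 a2 h12 n12 p1.symm p2.symm hx hx1 hx2
  have hp : ∀ p, G.Adj x p → p ≠ c12 → p = c13 ∨ p = c23 := by
    intro p hxp hpc
    have hpa : p ≠ a := by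
      rintro rfl
      rcases (hb x).1 hxp.symm with e | e | e
      · exact hx1 e
      · exact hx2 e
      · exact twin c12 n12 p1 p2 (e ▸ hx.symm)
    obtain ⟨z, hzx, hz1, hz2⟩ := hxs c12 p hx.symm hxp hpc.symm
    have : z ∈ nb G c12 := by simpa
    rw [hNc] at this
    simp only [mem_insert, mem_singleton] at this
    rcases this with rfl | rfl | rfl
    · have : p ∈ nb G z := by simpa using hz2.symm
      rw [hN1] at this; simp only [mem_insert, mem_singleton] at this; tauto
    · have : p ∈ nb G z := by simpa using hz2.symm
      rw [hN2] at this; simp only [mem_insert, mem_singleton] at this; tauto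
    · exact absurd rfl hzx
  have hx3 : x ≠ b3 := fun e => twin c12 n12 p1 p2 (e ▸ hx.symm)
  have hNx : nb G x = {c12, c13, c23} := by
    apply eq_of_subset_of_card_le
    · intro p hp'
      simp only [mem_insert, mem_singleton]
      by_cases h : p = c12
      · exact Or.inl h
      · exact Or.inr (hp p (by simpa using hp') h)
    · rw [hG.deg]; exact card_le_three
  have x13 : G.Adj x c13 := by rw [← mem_nb, hNx]; simp
  have x23 : G.Adj x c23 := by rw [← mem_nb, hNx]; simp
  have hNc13 := card_three (hG.deg c13) (by simpa using q1.symm) (by simpa using q3.symm)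
    (by simpa using x13.symm) h13 hx1.symm hx3.symm
  have hNc23 := card_three (hG.deg c23) (by simpa using r2.symm) (by simpa using r3.symm)
    (by simpa using x23.symm) h23 hx2.symm hx3.symm
  have hS : ({a, b1, b2, b3, c12, c13, c23, x} : Finset V) = univ := by
    apply eq_univ_of_closed hG (by simp)
    intro s hs t hst
    have ht : t ∈ nb G s := by simpa
    simp only [mem_insert, mem_singleton] at hs ⊢
    rcases hs with rfl | rfl | rfl | rfl | rfl | rfl | rfl | rfl
    · rw [hN] at ht; simp only [mem_insert, mem_singleton] at ht; tauto
    · rw [hN1] at ht; simp only [mem_insert, mem_singleton] at ht; tauto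
    · rw [hN2] at ht; simp only [mem_insert, mem_singleton] at ht; tauto
    · rw [hN3] at ht; simp only [mem_insert, mem_singleton] at ht; tauto
    · rw [hNc] at ht; simp only [mem_insert, mem_singleton] at ht; tauto
    · rw [hNc13] at ht; simp only [mem_insert, mem_singleton] at ht; tauto
    · rw [hNc23] at ht; simp only [mem_insert, mem_singleton] at ht; tauto
    · rw [hNx] at ht; simp only [mem_insert, mem_singleton] at ht; tauto
  rw [← card_univ, ← hS]
  refine (card_insert_le _ _).trans (Nat.succ_le_succ ?_)
  refine (card_insert_le _ _).trans (Nat.succ_le_succ ?_)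
  exact card_le_six

/-- The stabilizer of the vertices `v` and `u`. -/

lemma card_le_of_not_loc (hG : Cub G) {w : V} (hw : ¬ Loc G w) (h4 : 4 < Fintype.card V)
    (horb : orb (aut G) w = univ) :
    ∃ t, Nat.card (aut G) = Fintype.card V * 2 ^ t ∧ 4 * t + 2 ≤ Fintype.card V := by
  obtain ⟨u, hwu, hu⟩ := exists_fixed_of_not_loc hG hw
  have hex : ∀ x, ∃ k ∈ aut G, k w = x := fun x => mem_orb.1 (by rw [horb]; simp)
  choose g hg hgw using hex
  set f : V → V := fun x => g x u with hf
  have hfk : ∀ k ∈ aut G, ∀ x, f (k x) = k (f x) := by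
    intro k hk x
    have := hu ((k * g x)⁻¹ * g (k x)) ⟨mul_mem (inv_mem (mul_mem hk (hg x))) (hg _), by
      simp only [mem_singleton, forall_eq, Equiv.Perm.mul_apply, hgw]
      rw [Equiv.Perm.inv_eq_iff_eq]
      simp [hgw]⟩
    rw [Equiv.Perm.mul_apply, Equiv.Perm.inv_eq_iff_eq] at this
    simpa [hf] using this
  have hadj : ∀ x, G.Adj x (f x) := fun x => by
    have := (mem_aut.1 (hg x) w u).2 hwu
    rwa [hgw] at this
  have hfw : f w = u := by
    have := hu (g w) ⟨hg w, by simp [hgw]⟩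
    exact this
  have hinj : Function.Injective f := by
    apply Finite.injective_iff_surjective.2
    intro y
    refine ⟨(g y * (g u)⁻¹) w, ?_⟩
    rw [hfk _ (mul_mem (hg y) (inv_mem (hg u))), hfw, Equiv.Perm.mul_apply,
      (Equiv.Perm.inv_eq_iff_eq).2 (hgw u).symm, hgw]
  obtain ⟨t, ht, hle⟩ := explore_arc hG (arcStab_le w u) hwu (fixed_arcStab w u).1
    (fixed_arcStab w u).2 (fun _ => 1) 4 (by
    intro H hH p u' q q' hp hu' hpu hpq hpq' hN h1 h2 hne hq hq' hf' ⟨k, hk, e1, e2⟩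
    have hHA : H ≤ aut G := hH.trans (arcStab_le w u)
    have hfp : f p = u' := by
      have h3 : Fixed H (f p) := fun h hh => by rw [← hfk h (hHA hh), hp h hh]
      have h4 : f p ∈ nb G p := by simpa using hadj p
      rw [hN] at h4; simp only [mem_insert, mem_singleton] at h4
      rcases h4 with h4 | h4 | h4
      · exact h4
      · exact absurd (h4 ▸ h3) hq
      · exact absurd (h4 ▸ h3) hq'
    have hfq : k (f q) = f q' := by rw [← hfk k (hHA hk), e1]
    have hfq' : k (f q') = f q := by rw [← hfk k (hHA hk), e2]
    have hne' : f q' ≠ f q := fun e => hne (hinj e)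
    have hqq : f q ≠ q' := by
      intro e
      have e' : f q' = q := by rw [← hfq, e, e2]
      obtain ⟨z, hz, hzu⟩ : ∃ z, G.Adj p z ∧ G.Adj u' z := by
        have hgg : (g p * (g q)⁻¹) ∈ aut G := mul_mem (hg p) (inv_mem (hg q))
        have hgq : (g p * (g q)⁻¹) q = p := by
          rw [Equiv.Perm.mul_apply, (Equiv.Perm.inv_eq_iff_eq).2 (hgw q).symm, hgw]
        refine ⟨(g p * (g q)⁻¹) p, ?_, ?_⟩
        · have := (mem_aut.1 hgg q p).2 hpq.symm
          rwa [hgq] at this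
        · have := (mem_aut.1 hgg q' p).2 hpq'.symm
          rwa [← e, ← hfk _ hgg, hgq, hfp] at this
      have hboth : G.Adj u' q ∧ G.Adj u' q' := by
        have hz' : z ∈ nb G p := by simpa
        rw [hN] at hz'; simp only [mem_insert, mem_singleton] at hz'
        have := (mem_aut.1 (hHA hk) u' z).2 hzu
        rw [hu' k hk] at this
        rcases hz' with rfl | rfl | rfl
        · exact absurd hzu (G.loopless.irrefl _)
        · exact ⟨hzu, e1 ▸ this⟩
        · exact ⟨e2 ▸ this, hzu⟩
      have hqq' : G.Adj q q' := e ▸ hadj q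
      have hS : ({p, u', q, q'} : Finset V) = univ := by
        apply eq_univ_of_closed hG (by simp)
        have n2 := card_three (hG.deg u') (by simpa using hpu.symm) (by simpa using hboth.1)
          (by simpa using hboth.2) hpq.ne hpq'.ne hne.symm
        have n3 := card_three (hG.deg q) (by simpa using hpq.symm) (by simpa using hboth.1.symm)
          (by simpa using hqq') hpu.ne hpq'.ne h2
        have n4 := card_three (hG.deg q') (by simpa using hpq'.symm) (by simpa using hboth.2.symm)
          (by simpa using hqq'.symm) hpu.ne hpq.ne h1
        intro s hs t hst
        have ht : t ∈ nb G s := by simpa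
        simp only [mem_insert, mem_singleton] at hs ⊢
        rcases hs with rfl | rfl | rfl | rfl
        · rw [hN] at ht; simp only [mem_insert, mem_singleton] at ht; tauto
        · rw [n2] at ht; simp only [mem_insert, mem_singleton] at ht; tauto
        · rw [n3] at ht; simp only [mem_insert, mem_singleton] at ht; tauto
        · rw [n4] at ht; simp only [mem_insert, mem_singleton] at ht; tauto
      have : ({p, u', q, q'} : Finset V).card ≤ 4 := card_le_four
      rw [hS, card_univ] at this
      lia
    have hqq2 : f q' ≠ q := fun e => hqq (k.injective (by rw [hfq, e, e2]))
    refine ⟨{q, q', f q, f q'}, ?_, ?_, ?_⟩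
    · simp only [mem_insert, mem_singleton]
      rintro d (rfl | rfl | rfl | rfl)
      exacts [hq, hq', not_fixed_of_swap hk hfq hne', not_fixed_of_swap hk hfq' hne'.symm]
    · simp only [mem_insert, mem_singleton]
      have key : ∀ d, Fixed (fx H {q}) d → Fixed (fx H {q}) (f d) := fun d hd h hh => by
        rw [← hfk h (hHA hh.1), hd h hh]
      have hqf : Fixed (fx H {q}) q := fixed_fx (mem_singleton_self q)
      rintro d (rfl | rfl | rfl | rfl)
      exacts [hqf, hf', key _ hqf, key _ hf']
    · rw [sum_const, smul_eq_mul, mul_one, card_insert_of_notMem, card_insert_of_notMem, card_pair hne'.symm]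
      · simp only [mem_insert, mem_singleton, not_or]
        exact ⟨hqq.symm, (hadj q').ne⟩
      · simp only [mem_insert, mem_singleton, not_or]
        exact ⟨hne.symm, (hadj q).ne, hqq2.symm⟩)
  refine ⟨t, ?_, by simpa [add_assoc] using hle⟩
  rw [card_of_arc ht, horb, orb_eq_singleton hu, card_singleton, card_univ, mul_one]

lemma noTwin_of_loc (hG : Cub G) (hL : ∀ w, Loc G w) (h6 : 6 < Fintype.card V) (a : V) :
    NoTwin G a := by
  intro c hca hN
  obtain ⟨b1, b2, b3, h12, h13, h23, hNa⟩ := card_eq_three.1 (hG.deg a)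
  have hab : ∀ x, G.Adj a x ↔ x = b1 ∨ x = b2 ∨ x = b3 := fun x => by
    rw [← mem_nb, hNa]; simp
  have hcb : ∀ x, G.Adj c x ↔ x = b1 ∨ x = b2 ∨ x = b3 := fun x => by
    rw [← mem_nb, hN, hNa]; simp
  have a1 : G.Adj a b1 := by simp [hab]
  have c1 : G.Adj c b1 := by simp [hcb]
  obtain ⟨e, hea, hec, he, hNb⟩ := exists_third hG a1.symm c1.symm hca.symm
  obtain ⟨k, hk, -, hkp⟩ := (hL b1).pair hG a1.symm c1.symm hca.symm a1.symm he hea.symm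
  have hNk : nb G (k c) = nb G (k a) := by rw [map_nb hk, map_nb hk, hN]
  have hNe : nb G e = nb G a := by
    rcases hkp with ⟨h1, h2⟩ | ⟨h1, h2⟩ <;> rw [h1, h2] at hNk
    exacts [hNk, hNk.symm]
  have heb : ∀ x, G.Adj e x ↔ x = b1 ∨ x = b2 ∨ x = b3 := fun x => by
    rw [← mem_nb, hNe, hNa]; simp
  have hNb' : ∀ x, x = b1 ∨ x = b2 ∨ x = b3 → nb G x = {a, c, e} := fun x hx =>
    card_three (hG.deg x) (by simpa using ((hab x).2 hx).symm)
      (by simpa using ((hcb x).2 hx).symm) (by simpa using ((heb x).2 hx).symm) hca.symm hea.symm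
      hec.symm
  have hS : ({a, c, e, b1, b2, b3} : Finset V) = univ := by
    apply eq_univ_of_closed hG (by simp)
    intro s hs t hst
    have ht : t ∈ nb G s := by simpa
    have hcase : s = a ∨ s = c ∨ s = e ∨ (s = b1 ∨ s = b2 ∨ s = b3) := by simpa using hs
    simp only [mem_insert, mem_singleton]
    rcases hcase with rfl | rfl | rfl | h
    · exact Or.inr (Or.inr (Or.inr ((hab t).1 hst)))
    · exact Or.inr (Or.inr (Or.inr ((hcb t).1 hst)))
    · exact Or.inr (Or.inr (Or.inr ((heb t).1 hst)))
    · rw [hNb' s h] at ht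
      simp only [mem_insert, mem_singleton] at ht
      exact ht.imp_right (Or.imp_right Or.inl)
  have : ({a, c, e, b1, b2, b3} : Finset V).card ≤ 6 := card_le_six
  rw [hS, card_univ] at this
  lia

lemma noC4_of_loc (hG : Cub G) (hL : ∀ w, Loc G w) (h8 : 8 < Fintype.card V) : NoC4 G := by
  by_contra h4
  simp only [NoC4, not_forall] at h4
  obtain ⟨a, c, hac, b, d, hab, hcb, had, hcd, hbd⟩ := h4
  have hsq : ∀ w, Sq G w := by
    have : univ.filter (Sq G) = univ := by
      apply eq_univ_of_closed hG
      · exact ⟨a, by simpa using (hL a).sq hG hab had hbd hac.symm hcb.symm hcd.symm⟩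
      · intro s hs t hst
        rw [mem_filter] at hs ⊢
        refine ⟨mem_univ _, ?_⟩
        obtain ⟨y, z, hyz, hN⟩ := card_eq_two.1 (show ((nb G s).erase t).card = 2 by
          rw [card_erase_of_mem (by simpa), hG.deg])
        have hy : y ∈ (nb G s).erase t := by rw [hN]; simp
        rw [mem_erase, mem_nb] at hy
        obtain ⟨x, hxs, hx1, hx2⟩ := hs.2 t y hst hy.2 hy.1.symm
        exact (hL t).sq hG hst.symm hx1 hxs.symm hy.1 hy.2 hx2.symm
    intro w
    have hw := mem_univ w
    rw [← this, mem_filter] at hw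
    exact hw.2
  have htw : ∀ a, NoTwin G a := fun a => noTwin_of_loc hG hL (by lia) a
  obtain ⟨v⟩ : Nonempty V := ⟨a⟩
  have := card_le_eight_of_sq hG (hsq v) (htw v) (fun _ _ _ x _ _ _ _ _ _ _ _ _ => hsq x)
  lia

/-- The stabilizer of the vertices `v` and `u`. -/

lemma nb_subset_of_card (hG : Cub G) {x : V} (h : (nb G x ∩ Y).card = 3) : nb G x ⊆ Y := by
  have : nb G x ∩ Y = nb G x := eq_of_subset_of_card_le inter_subset_left (by rw [h, hG.deg])
  exact this ▸ inter_subset_right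

lemma bits_arc_forty (hG : Cub G) (hn : Fintype.card V = 40) (hC : core G = univ) {v u : V}
    (h : G.Adj v u) : ∃ t, Bits (arcStab G v u) univ t ∧ t ≤ 14 := by
  obtain ⟨t, ht, hle⟩ := (earRate hG).bits_arc hG (by rw [hn]; decide) hC (arcStab_le v u) h
    (fixed_arcStab v u).1 (fixed_arcStab v u).2
  exact ⟨t, ht, by lia⟩

lemma bound_of_not_loc (hG : Cub G) (hn : Fintype.card V = 40) (hC : core G = univ) {w : V}
    (hw : ¬ Loc G w) (ho : (orb (aut G) w).card ≤ 20 ∨ orb (aut G) w = univ) :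
    16 * Nat.card (aut G) ≤ 5 * 2 ^ 20 := by
  rcases ho with ho | ho
  · obtain ⟨u, hwu, hu⟩ := exists_fixed_of_not_loc hG hw
    obtain ⟨t, ht, hle⟩ := bits_arc_forty hG hn hC hwu
    rw [card_of_arc ht, orb_eq_singleton hu, card_singleton, mul_one]
    exact sixteen_mul_le (E := 6) (by lia) (by lia)
  · obtain ⟨t, ht, hle⟩ := card_le_of_not_loc hG hw (by lia) ho
    rw [ht, hn]
    exact sixteen_mul_le (E := 7) (by lia) (by lia)

/-- The case of an orbit `X` of size 16 and an orbit `Y` of size 24. -/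
lemma bound_of_orbits_two (hG : Cub G) (hY : Inv (aut G) Y)
    (hd : Disjoint X Y) (hXY : ∀ x ∈ X, nb G x ⊆ Y) (hYX : ∀ y ∈ Y, (nb G y ∩ X).card = 2)
    (hu : X ∪ Y = univ) (hcX : X.card = 16) {y : V} (hloc : ∀ x ∈ X, Loc G x)
    (hy : y ∈ Y) (ho : orb (aut G) y = Y) (hcY : Y.card = 24) :
    16 * Nat.card (aut G) ≤ 5 * 2 ^ 20 := by
  have hYY : ∀ y ∈ Y, (nb G y ∩ Y).card = 1 := fun y hy => by
    have h1 := card_union_of_disjoint (hd.mono inter_subset_right inter_subset_right :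
      Disjoint (nb G y ∩ X) (nb G y ∩ Y))
    rw [← inter_union_distrib_left, hu, inter_univ, hG.deg, hYX y hy] at h1
    lia
  obtain ⟨c, hc⟩ := card_eq_one.1 (hYY y hy)
  have hc' : c ∈ nb G y ∩ Y := by rw [hc]; simp
  rw [mem_inter, mem_nb] at hc'
  have hcf : Fixed (fx (aut G) {y}) c := fixed_of_unique_nb (fx_le _ _)
    (hY.mono (fx_le _ _)) (fixed_fx (mem_singleton_self y)) hc'.1 hc'.2 (hYY y hy)
  obtain ⟨t, ht, hle⟩ := explore_arc hG (arcStab_le y c) hc'.1 (fixed_arcStab y c).1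
    (fixed_arcStab y c).2 (fun w => if w ∈ Y then 1 else 2) 4 (by
    intro H hH p u q q' hp hu' hpu hpq hpq' hN h1 h2 hne hq hq' hf' ⟨k, hk, e1, e2⟩
    have hHA : H ≤ aut G := hH.trans (arcStab_le y c)
    have hqf : Fixed (fx H {q}) q := fixed_fx (mem_singleton_self q)
    have hp' := mem_univ p
    rw [← hu, mem_union] at hp'
    rcases hp' with hpX | hpY
    · have hqY : q ∈ Y := hXY p hpX (by simpa)
      have hqY' : q' ∈ Y := hXY p hpX (by simpa)
      obtain ⟨d, hd⟩ := card_eq_one.1 (hYY q hqY)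
      have hd' : d ∈ nb G q ∩ Y := by rw [hd]; simp
      rw [mem_inter, mem_nb] at hd'
      have hkd : G.Adj q' (k d) := by rw [← e1]; exact (mem_aut.1 (hHA hk) _ _).2 hd'.1
      have hkY : k d ∈ Y := hY k (hHA hk) d hd'.2
      have huniq : ∀ a b c, a ∈ Y → b ∈ Y → c ∈ Y → G.Adj a b → G.Adj a c → b = c := by
        intro a b c ha hb hc hab hac
        exact card_le_one.1 (hYY a ha).le _ (mem_inter.2 ⟨by simpa, hb⟩) _
          (mem_inter.2 ⟨by simpa, hc⟩)
      have hkne : k d ≠ d := fun e =>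
        hne (huniq d q' q hd'.2 hqY' hqY (by rw [e] at hkd; exact hkd.symm) hd'.1.symm)
      have hdq' : d ≠ q' := by
        rintro rfl
        obtain ⟨w, hw1, hw2, hpw, -⟩ := exists_third hG hpq hpq' hne.symm
        obtain ⟨g, hg, -, hgg⟩ := (hloc p hpX).pair hG hpq hpq' hne.symm hpq' hpw hw2.symm
        have hqw := (mem_aut.1 hg _ _).2 hd'.1
        have hdw : G.Adj d w := by
          rcases hgg with ⟨e, e'⟩ | ⟨e, e'⟩ <;> rw [e, e'] at hqw
          exacts [hqw, hqw.symm]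
        exact hw1 (huniq d w q hqY' (hXY p hpX (by simpa)) hqY hdw hd'.1.symm)
      have hkdq : k d ≠ q := fun e => hdq' (k.injective (by rw [e, e2]))
      refine ⟨{q, q', d, k d}, ?_, ?_, ?_⟩
      · simp only [mem_insert, mem_singleton]
        rintro x (rfl | rfl | rfl | rfl)
        exacts [hq, hq', not_fixed_of_swap hk rfl hkne, fun h => hkne (k.injective (h k hk))]
      · simp only [mem_insert, mem_singleton]
        have hHA' := (fx_le H {q}).trans hHA
        rintro x (rfl | rfl | rfl | rfl)
        exacts [hqf, hf', fixed_of_unique_nb hHA' (hY.mono hHA') hqf hd'.1 hd'.2 (hYY _ hqY),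
          fixed_of_unique_nb hHA' (hY.mono hHA') hf' hkd hkY (hYY _ hqY')]
      · rw [sum_insert, sum_insert, sum_pair hkne.symm, if_pos hqY, if_pos hqY', if_pos hd'.2,
          if_pos hkY]
        · decide
        · simp only [mem_insert, mem_singleton, not_or]
          exact ⟨hdq'.symm, hkd.ne⟩
        · simp only [mem_insert, mem_singleton, not_or]
          exact ⟨hne.symm, hd'.1.ne, hkdq.symm⟩
    · have hqY : ∀ q, G.Adj p q → ¬ Fixed H q → q ∉ Y := fun q hpq hq hqY =>
        hq (fixed_of_unique_nb hHA (hY.mono hHA) hp hpq hqY (hYY _ hpY))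
      refine ⟨{q, q'}, ?_, ?_, ?_⟩
      · simp only [mem_insert, mem_singleton]
        rintro x (rfl | rfl)
        exacts [hq, hq']
      · simp only [mem_insert, mem_singleton]
        rintro x (rfl | rfl)
        exacts [hqf, hf']
      · rw [sum_pair hne.symm, if_neg (hqY q hpq hq), if_neg (hqY q' hpq' hq')])
  rw [card_of_arc ht, ho, orb_eq_singleton hcf, card_singleton, mul_one, hcY]
  have hsum : ∑ w, (if w ∈ Y then 1 else 2) = 56 := by
    rw [← hu, sum_union hd, sum_congr rfl (g := fun _ => 2), sum_const, hcX,
      sum_congr (s₁ := Y) rfl (g := fun _ => 1), sum_const, hcY]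
    · rfl
    · intro x hx; rw [if_pos hx]
    · intro x hx; rw [if_neg (disjoint_left.1 hd hx)]
  rw [hsum, if_pos hy] at hle
  exact sixteen_mul_le (E := 7) (by lia) (by lia)

/-- The case of an orbit `Y` of size 24 and all neighbours of the other vertices in `Y`. -/
lemma bound_of_orbits_three (hG : Cub G) (hX : Inv (aut G) X) (hY : Inv (aut G) Y)
    (hZ : Inv (aut G) W) (hXY : ∀ x ∈ X, nb G x ⊆ Y) (hZY : ∀ x ∈ W, nb G x ⊆ Y)
    (hYX : ∀ y ∈ Y, (nb G y ∩ X).card = 1) (hYY : ∀ y ∈ Y, (nb G y ∩ Y).card = 1)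
    (hYZ : ∀ y ∈ Y, (nb G y ∩ W).card = 1)
    (hu : X ∪ Y ∪ W = univ) {y : V} (hy : y ∈ Y) (ho : orb (aut G) y = Y) (hcY : Y.card = 24) :
    16 * Nat.card (aut G) ≤ 5 * 2 ^ 20 := by
  have hu' : ∀ x, x ∈ X ∨ x ∈ Y ∨ x ∈ W := fun x => by
    have := mem_univ x
    rwa [← hu, mem_union, mem_union, or_assoc] at this
  obtain ⟨c, hc⟩ := card_eq_one.1 (hYY y hy)
  have hc' : c ∈ nb G y ∩ Y := by rw [hc]; simp
  rw [mem_inter, mem_nb] at hc'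
  have hcf : Fixed (fx (aut G) {y}) c := fixed_of_unique_nb (fx_le _ _)
    (hY.mono (fx_le _ _)) (fixed_fx (mem_singleton_self y)) hc'.1 hc'.2 (hYY y hy)
  obtain ⟨t, ht, hle⟩ := explore_arc hG (arcStab_le y c) hc'.1 (fixed_arcStab y c).1
    (fixed_arcStab y c).2 (fun w => if w ∈ Y then 1 else 0) 2 (by
    intro H hH p u q q' hp hu'' hpu hpq hpq' hN h1 h2 hne hq hq' hf' ⟨k, hk, e1, e2⟩
    have hHA : H ≤ aut G := hH.trans (arcStab_le y c)
    have hpY : p ∉ Y := fun hpY => hq (by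
      rcases hu' q with h | h | h
      · exact fixed_of_unique_nb hHA (hX.mono hHA) hp hpq h (hYX _ hpY)
      · exact fixed_of_unique_nb hHA (hY.mono hHA) hp hpq h (hYY _ hpY)
      · exact fixed_of_unique_nb hHA (hZ.mono hHA) hp hpq h (hYZ _ hpY))
    have hpn : nb G p ⊆ Y := by
      rcases hu' p with h | h | h
      exacts [hXY p h, absurd h hpY, hZY p h]
    refine ⟨{q, q'}, ?_, ?_, ?_⟩
    · simp only [mem_insert, mem_singleton]
      rintro x (rfl | rfl)
      exacts [hq, hq']
    · simp only [mem_insert, mem_singleton]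
      rintro x (rfl | rfl)
      exacts [fixed_fx (mem_singleton_self x), hf']
    · rw [sum_pair hne.symm, if_pos (hpn (by simpa)), if_pos (hpn (by simpa))])
  rw [card_of_arc ht, ho, orb_eq_singleton hcf, card_singleton, mul_one, hcY]
  rw [sum_ite_mem, univ_inter, sum_const, hcY, smul_eq_mul, mul_one] at hle
  exact sixteen_mul_le (E := 7) (by lia) (by lia)

/-- The case of an orbit `X` of size 10 and an orbit `Y` of size 30. -/
lemma noC4_of_orbits (hG : Cub G) (h8 : 8 < Fintype.card V) (hY : Inv (aut G) Y)
    (hd : Disjoint X Y) (hXY : ∀ x ∈ X, nb G x ⊆ Y) (hYX : ∀ y ∈ Y, (nb G y ∩ X).card = 1)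
    (hu : X ∪ Y = univ) (hloc : ∀ x ∈ X, Loc G x) {v : V} (hv : orb (aut G) v = X)
    (ho : ∀ y ∈ Y, orb (aut G) y = Y) (h4Y : ¬ 4 ∣ Y.card) : NoC4 G := by
  have hu' : ∀ x, x ∈ X ∨ x ∈ Y := fun x => by
    have := mem_univ x
    rwa [← hu, mem_union] at this
  have hsq : ∀ x ∈ X, ¬ Sq G x := by
    intro x hx hs
    have hsX : ∀ x ∈ X, Sq G x := by
      obtain ⟨a, b, c, hab, hac, hbc, hN⟩ := card_eq_three.1 (hG.deg x)
      have ha : G.Adj x a := by rw [← mem_nb, hN]; simp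
      have hb : G.Adj x b := by rw [← mem_nb, hN]; simp
      obtain ⟨z, hzx, haz, hbz⟩ := hs a b ha hb hab
      intro x' hx'
      rw [← hv, ← orb_eq_of_mem (show x ∈ orb (aut G) v by rwa [hv])] at hx'
      obtain ⟨k, hk, rfl⟩ := mem_orb.1 hx'
      have hkx : k x ∈ X := by rw [← hv, ← orb_eq_of_mem (show x ∈ orb (aut G) v by rwa [hv])]; exact hx'
      exact (hloc _ hkx).sq hG ((mem_aut.1 hk _ _).2 ha) ((mem_aut.1 hk _ _).2 hb)
        (fun e => hab (k.injective e)) (fun e => hzx (k.injective e))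
        ((mem_aut.1 hk _ _).2 haz) ((mem_aut.1 hk _ _).2 hbz)
    have huniq : ∀ y ∈ Y, ∀ a b, a ∈ X → b ∈ X → G.Adj y a → G.Adj y b → a = b :=
      fun y hy a b ha hb h1 h2 => card_le_one.1 (hYX y hy).le _ (mem_inter.2 ⟨by simpa, ha⟩) _
        (mem_inter.2 ⟨by simpa, hb⟩)
    have := card_le_eight_of_sq hG (hsX x hx) (by
      intro c hc hN
      have hcY : c ∈ Y := by
        rcases hu' c with h | h
        · exfalso
          obtain ⟨b, hb⟩ := Finset.card_pos.1 (show 0 < (nb G x).card by rw [hG.deg]; decide)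
          refine hc (huniq b (hXY x hx hb) c x h hx ?_ (mem_nb.1 hb).symm)
          rw [← hN] at hb; exact (mem_nb.1 hb).symm
        · exact h
      obtain ⟨a, ha⟩ := Finset.card_pos.1 (show 0 < (nb G c ∩ X).card by rw [hYX c hcY]; decide)
      rw [mem_inter, hN] at ha
      exact disjoint_left.1 hd ha.2 (hXY x hx ha.1)) (by
      intro b b' c z hb hb' hbb hcx hcb hcb' hcz hzb hzb'
      have hbY : b ∈ Y := hXY x hx (by simpa)
      have hbY' : b' ∈ Y := hXY x hx (by simpa)
      have hcY : c ∈ Y := (hu' c).resolve_left fun h => hcx (huniq b hbY c x h hx hcb.symm hb.symm)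
      refine hsX z ?_
      obtain ⟨a, ha⟩ := Finset.card_pos.1 (show 0 < (nb G c ∩ X).card by rw [hYX c hcY]; decide)
      rw [mem_inter] at ha
      have hza : a = z := by
        by_contra hne
        have h3 := card_three (hG.deg c) (by simpa using hcb) (by simpa using hcb')
          (by simpa using hcz) hbb hzb.symm hzb'.symm
        have := ha.1
        rw [h3] at this; simp only [mem_insert, mem_singleton] at this
        rcases this with rfl | rfl | rfl
        exacts [disjoint_left.1 hd ha.2 hbY, disjoint_left.1 hd ha.2 hbY', hne rfl]
      exact hza ▸ ha.2)
    lia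
  by_contra h4
  simp only [NoC4, not_forall] at h4
  obtain ⟨a, c, hac, b, d, hab, hcb, had, hcd, hbd⟩ := h4
  replace hbd : b ≠ d := hbd
  have key : ∀ a b c d, a ≠ c → b ≠ d → G.Adj a b → G.Adj c b → G.Adj a d → G.Adj c d → a ∈ Y := by
    intro a b c d hac hbd hab hcb had hcd
    exact (hu' a).resolve_left fun h =>
      hsq a h ((hloc a h).sq hG hab had hbd hac.symm hcb.symm hcd.symm)
  have haY := key a b c d hac hbd hab hcb had hcd
  have hcY := key c b a d hac.symm hbd hcb hab hcd had
  have hbY := key b a d c hbd hac hab.symm had.symm hcb.symm hcd.symm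
  have hdY := key d a b c hbd.symm hac had.symm hab.symm hcd.symm hcb.symm
  have hYY : ∀ y ∈ Y, (nb G y ∩ Y).card = 2 := fun y hy => by
    have h1 := card_union_of_disjoint (hd.mono inter_subset_right inter_subset_right :
      Disjoint (nb G y ∩ X) (nb G y ∩ Y))
    rw [← inter_union_distrib_left, hu, inter_univ, hG.deg, hYX y hy] at h1
    lia
  have two : ∀ y ∈ Y, ∀ p q, p ∈ Y → q ∈ Y → G.Adj y p → G.Adj y q → p ≠ q →
      ∀ z ∈ Y, G.Adj y z → z = p ∨ z = q := by
    intro y hy p q hp hq hyp hyq hpq z hz hyz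
    have : ({p, q} : Finset V) = nb G y ∩ Y := by
      apply eq_of_subset_of_card_le
      · intro w; simp only [mem_insert, mem_singleton]
        rintro (rfl | rfl) <;> rw [mem_inter, mem_nb] <;> exact ⟨by assumption, by assumption⟩
      · rw [hYY y hy, card_pair hpq]
    have hz' : z ∈ nb G y ∩ Y := mem_inter.2 ⟨by simpa, hz⟩
    rw [← this] at hz'; simpa using hz'
  set B : V → Finset V := fun y => Y.filter fun z => G.Adj y z ∨ ∃ w ∈ Y, G.Adj y w ∧ G.Adj w z
    with hB
  have hBeq : ∀ a b c d, a ∈ Y → b ∈ Y → c ∈ Y → d ∈ Y → a ≠ c → b ≠ d → G.Adj a b → G.Adj c b →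
      G.Adj a d → G.Adj c d → B a = {a, b, c, d} := by
    intro a b c d ha hb hc hd hac hbd hab hcb had hcd
    ext z
    simp only [hB, mem_filter, mem_insert, mem_singleton]
    constructor
    · rintro ⟨hz, h | ⟨w, hw, h1, h2⟩⟩
      · rcases two a ha b d hb hd hab had hbd z hz h with h | h <;> simp [h]
      · rcases two a ha b d hb hd hab had hbd w hw h1 with rfl | rfl
        · rcases two w hb a c ha hc hab.symm hcb.symm hac z hz h2 with h | h <;> simp [h]
        · rcases two w hd a c ha hc had.symm hcd.symm hac z hz h2 with h | h <;> simp [h]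
    · rintro (rfl | rfl | rfl | rfl)
      exacts [⟨ha, Or.inr ⟨b, hb, hab, hab.symm⟩⟩, ⟨hb, Or.inl hab⟩,
        ⟨hc, Or.inr ⟨b, hb, hab, hcb.symm⟩⟩, ⟨hd, Or.inl had⟩]
  have hBa := hBeq a b c d haY hbY hcY hdY hac hbd hab hcb had hcd
  have hBfib : ∀ y ∈ Y, (B y).card = 4 ∧ Y.filter (fun z => B z = B y) = B y := by
    intro y hy
    rw [← ho a haY] at hy
    obtain ⟨k, hk, rfl⟩ := mem_orb.1 hy
    have hadj : ∀ {x y}, G.Adj x y → G.Adj (k x) (k y) := fun h => (mem_aut.1 hk _ _).2 h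
    have hne : ∀ {x y : V}, x ≠ y → k x ≠ k y := fun h e => h (k.injective e)
    have hm : ∀ {y}, y ∈ Y → k y ∈ Y := fun h => hY k hk _ h
    have e1 := hBeq _ _ _ _ (hm haY) (hm hbY) (hm hcY) (hm hdY) (hne hac) (hne hbd) (hadj hab)
      (hadj hcb) (hadj had) (hadj hcd)
    have e2 := hBeq _ _ _ _ (hm hbY) (hm haY) (hm hdY) (hm hcY) (hne hbd) (hne hac) (hadj hab.symm)
      (hadj had.symm) (hadj hcb.symm) (hadj hcd.symm)
    have e3 := hBeq _ _ _ _ (hm hcY) (hm hbY) (hm haY) (hm hdY) (hne hac.symm) (hne hbd) (hadj hcb)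
      (hadj hab) (hadj hcd) (hadj had)
    have e4 := hBeq _ _ _ _ (hm hdY) (hm haY) (hm hbY) (hm hcY) (hne hbd.symm) (hne hac)
      (hadj had.symm) (hadj hab.symm) (hadj hcd.symm) (hadj hcb.symm)
    constructor
    · rw [e1, card_insert_of_notMem, card_insert_of_notMem, card_pair (hne hcd.ne)]
      · simp only [mem_insert, mem_singleton, not_or]
        exact ⟨hne hcb.ne.symm, hne hbd⟩
      · simp only [mem_insert, mem_singleton, not_or]
        exact ⟨hne hab.ne, hne hac, hne had.ne⟩
    · ext z
      rw [mem_filter]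
      constructor
      · rintro ⟨hz, e⟩
        rw [← e]
        obtain ⟨p, hp⟩ := Finset.card_pos.1 (show 0 < (nb G z ∩ Y).card by rw [hYY z hz]; decide)
        rw [mem_inter, mem_nb] at hp
        exact mem_filter.2 ⟨hz, Or.inr ⟨p, hp.2, hp.1, hp.1.symm⟩⟩
      · intro hz
        refine ⟨(mem_filter.1 hz).1, ?_⟩
        rw [e1] at hz
        simp only [mem_insert, mem_singleton] at hz
        rcases hz with rfl | rfl | rfl | rfl
        · rfl
        · rw [e1, e2]; ext; simp only [mem_insert, mem_singleton]; tauto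
        · rw [e1, e3]; ext; simp only [mem_insert, mem_singleton]; tauto
        · rw [e1, e4]; ext; simp only [mem_insert, mem_singleton]; tauto
  apply h4Y
  rw [card_eq_sum_card_image B Y]
  apply dvd_sum
  intro s hs
  obtain ⟨y, hy, rfl⟩ := mem_image.1 hs
  rw [(hBfib y hy).2, (hBfib y hy).1]

/-- The stabilizer of the vertices `v` and `u`. -/

lemma card_orb_add_le {Z : Finset V} {z : V} (hZ : Inv K Z) (hz : z ∉ Z) :
    Z.card + (orb K z).card ≤ Fintype.card V := by
  rw [← card_union_of_disjoint, ← card_univ]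
  · exact card_le_card (subset_univ _)
  · rw [disjoint_right]; intro x hx hxZ
    obtain ⟨k, hk, rfl⟩ := mem_orb.1 hx
    exact hz ((hZ.mem_iff hk).1 hxZ)

lemma bound_of_forty (hG : Cub G) (hn : Fintype.card V = 40) (hC : core G = univ)
    (h4 : ¬ NoC4 G) : 16 * Nat.card (aut G) ≤ 5 * 2 ^ 20 := by
  have : Nonempty V := Fintype.card_pos_iff.1 (by lia)
  obtain ⟨v, hmin⟩ := Finite.exists_min fun v => (orb (aut G) v).card
  set X := orb (aut G) v with hX
  have hvX : v ∈ X := self_mem_orb _ _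
  have hXinv : Inv (aut G) X := inv_orb _ _
  have hnl : ∃ w, ¬ Loc G w := by
    by_contra! h
    exact h4 (noC4_of_loc hG h (by lia))
  by_cases hv : Loc G v
  swap
  · refine bound_of_not_loc hG hn hC hv ?_
    by_contra! hcon
    obtain ⟨z, hz⟩ : ∃ z, z ∉ X := by
      by_contra! h
      exact hcon.2 (eq_univ_of_forall h)
    have := card_orb_add_le hXinv hz
    have := hmin z
    lia
  have hloc : ∀ x ∈ X, Loc G x := fun x hx => hv.of_orb hx
  obtain ⟨y, hy⟩ := Finset.card_pos.1 (show 0 < (nb G v).card by rw [hG.deg]; decide)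
  rw [mem_nb] at hy
  by_cases hr : X.card ≤ 6
  · obtain ⟨t, ht, hle⟩ := bits_arc_forty hG hn hC hy
    have h3 := orb_card_le_three hG hy
    rw [card_of_arc ht]
    have : X.card * (orb (fx (aut G) {v}) y).card ≤ 6 * 3 := Nat.mul_le_mul hr h3
    exact sixteen_mul_le (E := 6) (by rw [← hX]; lia) (by lia)
  push Not at hr
  set Y := orb (aut G) y with hYdef
  have hYinv : Inv (aut G) Y := inv_orb _ _
  have hyY : y ∈ Y := self_mem_orb _ _
  have hoY : ∀ y' ∈ Y, orb (aut G) y' = Y := fun y' hy' => orb_eq_of_mem hy'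
  have hvY : nb G v ⊆ Y := by
    intro u hu
    obtain ⟨k, hk, -, e⟩ := hv y u hy (mem_nb.1 hu)
    exact mem_orb.2 ⟨k, hk, e⟩
  have hv3 : (nb G v ∩ Y).card = 3 := by rw [inter_eq_left.2 hvY, hG.deg]
  have hXY : ∀ x ∈ X, nb G x ⊆ Y := fun x hx =>
    nb_subset_of_card hG (by rw [card_nb_inter_of_mem le_rfl hYinv hx, hv3])
  have hcount := orb_double_count (G := G) le_rfl v y
  rw [← hX, ← hYdef, hv3] at hcount
  have hYX : ∀ y' ∈ Y, (nb G y' ∩ X).card = (nb G y ∩ X).card := fun y' hy' =>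
    card_nb_inter_of_mem le_rfl hXinv hy'
  have hk3 : (nb G y ∩ X).card ≤ 3 := by rw [← hG.deg y]; exact card_le_card inter_subset_left
  have hwY : ∀ w ∈ Y, ¬ Loc G w → (Y.card ≤ 20 ∨ Y = univ) →
      16 * Nat.card (aut G) ≤ 5 * 2 ^ 20 := fun w hw hl h =>
    bound_of_not_loc hG hn hC hl (by rwa [hoY w hw])
  have hIXY : Inv (aut G) (X ∪ Y) := hXinv.union hYinv
  obtain hk | hk | hk | hk : (nb G y ∩ X).card = 0 ∨ (nb G y ∩ X).card = 1 ∨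
    (nb G y ∩ X).card = 2 ∨ (nb G y ∩ X).card = 3 := by lia
  · rw [hk] at hcount; lia
  all_goals rw [hk] at hcount hYX
  · have hd : Disjoint X Y := by
      refine orb_disjoint fun h => ?_
      rw [hYdef, orb_eq_of_mem h] at hcount
      lia
    have hcXY := card_union_of_disjoint hd
    by_cases hu : X ∪ Y = univ
    · rw [hu, card_univ] at hcXY
      exact absurd (noC4_of_orbits hG (by lia) hYinv hd hXY hYX hu hloc hX.symm hoY (by lia)) h4
    obtain ⟨z, hz⟩ : ∃ z, z ∉ X ∪ Y := by
      by_contra! h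
      exact hu (eq_univ_of_forall h)
    set Z := orb (aut G) z with hZdef
    have hZinv : Inv (aut G) Z := inv_orb _ _
    have hZd : Disjoint (X ∪ Y) Z := by
      rw [disjoint_right]; intro x hx hxZ
      obtain ⟨k, hk, rfl⟩ := mem_orb.1 hx
      exact hz ((hIXY.mem_iff hk).1 hxZ)
    have hcZ := card_union_of_disjoint hZd
    have h1 := hmin z
    have hu3 : X ∪ Y ∪ Z = univ := by
      by_contra h
      obtain ⟨z', hz'⟩ : ∃ z', z' ∉ X ∪ Y ∪ Z := by
        by_contra! h'
        exact h (eq_univ_of_forall h')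
      have := card_orb_add_le (hIXY.union hZinv) hz'
      have := hmin z'
      lia
    rw [hu3, card_univ] at hcZ
    have hcount2 := orb_double_count (G := G) le_rfl y z
    rw [← hZdef, ← hYdef] at hcount2
    have hsum := card_union_of_disjoint (hZd.mono inter_subset_right inter_subset_right :
      Disjoint (nb G y ∩ (X ∪ Y)) (nb G y ∩ Z))
    rw [← inter_union_distrib_left, hu3, inter_univ, hG.deg, inter_union_distrib_left,
      card_union_of_disjoint (hd.mono inter_subset_right inter_subset_right), hk] at hsum
    have hj : (nb G z ∩ Y).card ≤ 3 := by rw [← hG.deg z]; exact card_le_card inter_subset_left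
    have hYZ : ∀ y' ∈ Y, (nb G y' ∩ Z).card = (nb G y ∩ Z).card := fun y' hy' =>
      card_nb_inter_of_mem le_rfl hZinv hy'
    have hi0 : (nb G y ∩ Z).card ≠ 0 := by
      intro h0
      refine hu (eq_univ_of_closed hG ⟨v, mem_union_left _ hvX⟩ ?_)
      intro s hs t hst
      rcases mem_union.1 hs with hs | hs
      · exact mem_union_right _ (hXY s hs (by simpa))
      · by_contra ht
        have htZ : t ∈ Z := by
          have := mem_univ t
          rw [← hu3, mem_union] at this
          exact this.resolve_left ht
        have := hYZ s hs
        rw [h0, card_eq_zero] at this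
        exact notMem_empty t (this ▸ mem_inter.2 ⟨by simpa, htZ⟩)
    have hX8 : X.card = 7 ∨ X.card = 8 := by lia
    rcases hX8 with hX8 | hX8
    · have hY21 : Y.card = 21 := by lia
      have hZ12 : Z.card = 12 := by lia
      rw [hY21, hZ12] at hcount2
      lia
    have hY24 : Y.card = 24 := by lia
    have hZ8 : Z.card = 8 := by lia
    rw [hY24, hZ8] at hcount2
    have hi : (nb G y ∩ Z).card = 1 := by lia
    have hj : (nb G z ∩ Y).card = 3 := by lia
    refine bound_of_orbits_three hG hXinv hYinv hZinv hXY (fun x hx => nb_subset_of_card hG ?_)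
      hYX (fun y' hy' => ?_) (fun y' hy' => ?_) hu3 hyY rfl hY24
    · rw [card_nb_inter_of_mem le_rfl hYinv hx, hj]
    · rw [card_nb_inter_of_mem le_rfl hYinv hy']; lia
    · rw [hYZ y' hy', hi]
  · have hd : Disjoint X Y := by
      refine orb_disjoint fun h => ?_
      rw [hYdef, orb_eq_of_mem h] at hcount
      lia
    have hcXY := card_union_of_disjoint hd
    have hYl : ¬ Loc G y := by
      intro hl
      have : ¬ nb G y ⊆ X := fun h => by rw [inter_eq_left.2 h, hG.deg] at hk; lia
      obtain ⟨c, hc, hcX⟩ := not_subset.1 this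
      obtain ⟨k, hk', -, e⟩ := hl v c hy.symm (mem_nb.1 hc)
      exact hcX (e ▸ hXinv k hk' v hvX)
    by_cases h20 : Y.card ≤ 20
    · exact hwY y hyY hYl (Or.inl h20)
    have hu : X ∪ Y = univ := by
      by_contra h
      obtain ⟨z, hz⟩ : ∃ z, z ∉ X ∪ Y := by
        by_contra! h'
        exact h (eq_univ_of_forall h')
      have := card_orb_add_le hIXY hz
      have := hmin z
      lia
    rw [hu, card_univ] at hcXY
    exact bound_of_orbits_two hG hYinv hd hXY hYX hu (by lia) hloc hyY rfl (by lia)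
  · have hu : X ∪ Y = univ := by
      refine eq_univ_of_closed hG ⟨v, mem_union_left _ hvX⟩ ?_
      intro s hs t hst
      rcases mem_union.1 hs with hs | hs
      · exact mem_union_right _ (hXY s hs (by simpa))
      · exact mem_union_left _ (nb_subset_of_card hG (hYX s hs) (by simpa))
    obtain ⟨w, hw⟩ := hnl
    have hwX : w ∉ X := fun h => hw (hloc w h)
    have hwY' : w ∈ Y := by
      have := mem_univ w
      rw [← hu, mem_union] at this
      exact this.resolve_left hwX
    have hd : Disjoint X Y := by
      refine orb_disjoint fun h => hwX ?_
      rw [hX, ← orb_eq_of_mem h]; exact hwY'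
    have hcXY := card_union_of_disjoint hd
    rw [hu, card_univ] at hcXY
    exact hwY w hwY' hw (Or.inl (by lia))

lemma bound_of_bridgeless (hG : Cub G) {N : ℕ} (hN : Shape N) (hV : Fintype.card V = 2 * N)
    (hr : roots G = ∅) : 16 * Nat.card (aut G) ≤ 5 * 2 ^ N := by
  have h20 := hN.le
  have hn : 4 ∣ Fintype.card V := by have := hN.four_dvd; lia
  have : Nonempty V := Fintype.card_pos_iff.1 (by lia)
  obtain ⟨v⟩ := this
  have hC : core G = univ := by
    refine eq_univ_of_closed hG (core_nonempty hG v) fun s hs t hst => ?_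
    by_contra ht
    exact notMem_empty t (hr ▸ mem_roots.2 ⟨ht, s, hs, hst⟩)
  obtain ⟨u, hu⟩ := Finset.card_pos.1 (show 0 < (nb G v).card by rw [hG.deg]; decide)
  rw [mem_nb] at hu
  have ho : (orb (aut G) v).card * (orb (fx (aut G) {v}) u).card ≤ 2 * N * 3 :=
    Nat.mul_le_mul (hV ▸ card_le_univ _) (orb_card_le_three hG hu)
  obtain ⟨k, rfl⟩ := hN.four_dvd
  rcases (show k = 1 ∨ 2 ≤ k by lia) with rfl | hk
  · by_cases h4 : NoC4 G
    · obtain ⟨t, ht, hle⟩ := (earRate_of_noC4 hG h4).bits_arc hG hn hC (arcStab_le v u) hu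
        (fixed_arcStab v u).1 (fixed_arcStab v u).2
      rw [card_of_arc ht]
      exact sixteen_mul_le (E := 11) (by lia) (by lia)
    · exact bound_of_forty hG hV hC h4
  · obtain ⟨t, ht, hle⟩ := (earRate hG).bits_arc hG hn hC (arcStab_le v u) hu
      (fixed_arcStab v u).1 (fixed_arcStab v u).2
    rw [card_of_arc ht]
    refine sixteen_mul_le (E := 5 * k + 1) ?_ (by lia)
    have h32 : ∀ j, 192 * (j + 2) ≤ 32 ^ (j + 2) := by
      intro j
      induction j with
      | zero => norm_num
      | succ j ih => rw [show j + 1 + 2 = j + 2 + 1 by lia, pow_succ]; lia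
    obtain ⟨j, rfl⟩ : ∃ j, k = j + 2 := ⟨k - 2, by lia⟩
    have h := h32 j
    rw [pow_succ, pow_mul, show 2 ^ 5 = 32 by norm_num]
    lia

lemma conn_univ (h : G.Connected) : Conn G univ := by
  intro S _ ⟨s, hs⟩ hne
  obtain ⟨t, ht⟩ : ∃ t, t ∉ S := by
    by_contra! h'
    exact hne (eq_univ_of_forall h')
  obtain ⟨w⟩ := h.preconnected s t
  obtain ⟨d, -, hd1, hd2⟩ := w.exists_boundary_dart (S : Set V) (by simpa) (by simpa)
  exact ⟨d.fst, by simpa using hd1, d.snd, mem_univ _, by simpa using hd2, d.adj⟩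

lemma card_nb (v : V) : (nb G v).card = (G.neighborSet v).ncard := by
  rw [← Set.ncard_coe_finset]
  congr 1; ext w; simp

lemma three_mul_card (h : ∀ v, (nb G v).card = 3) : 3 * Fintype.card V = 2 * G.edgeSet.ncard := by
  have h1 := G.sum_degrees_eq_twice_card_edges
  rw [sum_congr rfl (g := fun _ => 3), sum_const, card_univ, smul_eq_mul] at h1
  · rw [← SimpleGraph.coe_edgeFinset, Set.ncard_coe_finset, ← h1, mul_comm]
  · intro v _
    rw [← h v, ← SimpleGraph.card_neighborFinset_eq_degree]
    congr 1; ext w; simp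

lemma lFun_le {N : ℕ} (h : Shape N) : lFun (N + 1) ≤ 3 := by
  obtain ⟨a, m, ha, -, rfl⟩ := h
  refine Nat.sInf_le ⟨![a, a, 1], ![m + 2, m, 0], ?_, ?_⟩
  · intro i; fin_cases i
    exacts [ha, ha, Or.inl rfl]
  · simp [Fin.sum_univ_three, pow_add]; ring

/-- The bound for all cubic graphs with `2 * N` vertices. -/
lemma bound_of_shape (hG : Cub G) {N : ℕ} (hN : Shape N) (hV : Fintype.card V = 2 * N) :
    16 * Nat.card (aut G) ≤ 5 * 2 ^ N := by
  by_cases hC : (core G).card = 1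
  · exact bound_of_core_vertex hG hN hV hC
  rcases (roots G).eq_empty_or_nonempty with hr | hr
  · exact bound_of_bridgeless hG hN hV hr
  · exact bound_of_root hG hN hV hC hr

end

end CubicAut

theorem aut_bound_cubic_five {V : Type} [Fintype V] (G : SimpleGraph V)
    (hconn : G.Connected) (hcubic : ∀ v : V, (G.neighborSet v).ncard = 3)
    (g : ℕ) (hg : 9 ≤ g)
    (hgenus : G.edgeSet.ncard + 1 = Fintype.card V + g)
    (hform : ∃ a m : ℕ, (a = 1 ∨ a = 3) ∧ 2 ≤ m ∧ g = 5 * a * 2 ^ m + 1) :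
    4 * Nat.card (G ≃g G) ≤ 5 * 2 ^ oFun g := by
  obtain ⟨N, hN, rfl⟩ : ∃ N, CubicAut.Shape N ∧ g = N + 1 := by
    obtain ⟨a, m, ha, hm, rfl⟩ := hform
    exact ⟨_, ⟨a, m, ha, hm, rfl⟩, rfl⟩
  have hG : CubicAut.Cub G :=
    ⟨fun v => (CubicAut.card_nb v).trans (hcubic v), CubicAut.conn_univ hconn⟩
  have h3 := CubicAut.three_mul_card hG.deg
  have hb := CubicAut.bound_of_shape hG hN (by lia)
  have hl := CubicAut.lFun_le hN
  rw [CubicAut.card_aut]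
  have h20 := hN.le
  have ho : N - 2 ≤ oFun (N + 1) := by unfold oFun; lia
  have hp := Nat.pow_le_pow_right (show 0 < 2 by decide) ho
  have hN2 : 2 ^ N = 4 * 2 ^ (N - 2) := by
    rw [show (4 : ℕ) = 2 ^ 2 by rfl, ← pow_add]; congr 1; lia
  lia
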